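/- Let a, b, c, d ∈ ℚ be nonzero, set K = ℚ_{a,b} and L = ℚ_{c,d}, and let α be a Witt equivalence from K to L. Then for every prime integer p there exists a prime integer q such that α(square class of p in Kˣ/Kˣ²) equals the square class of q or the square class of −q in Lˣ/Lˣ²; moreover, if p = 2 then q = 2. -/

import Mathlib

open MvPolynomial

noncomputable section

/-- The defining polynomial `a·x² + b·y² − 1` of the affine conic. -/
def conicPoly (k : Type*) [Field k] (a b : k) : MvPolynomial (Fin 2) k :=
  C a * X 0 ^ 2 + C b * X 1 ^ 2 - 1

/-- The coordinate ring `k[x,y]/(a·x² + b·y² − 1)` of the affine conic. -/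
abbrev ConicRing (k : Type*) [Field k] (a b : k) : Type _ :=
  MvPolynomial (Fin 2) k ⧸ Ideal.span {conicPoly k a b}

/-- `K` (together with the embedding `ι : k →+* K`) is a model of the function field
`k_{a,b}`, i.e. the quotient field of `k[x,y]/(a·x² + b·y² − 1)`. -/
def IsConicFunctionField (k : Type*) [Field k] (a b : k)
    (K : Type*) [Field K] (ι : k →+* K) : Prop :=
  ∃ f : ConicRing k a b →+* K,
    Function.Injective f ∧
    f.comp (algebraMap k (ConicRing k a b)) = ι ∧
    ∀ z : K, ∃ p q : ConicRing k a b, f q ≠ 0 ∧ z = f p / f q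

/-- The subgroup of squares in `Kˣ`. -/
def sqSubgroup (K : Type*) [Field K] : Subgroup Kˣ :=
  MonoidHom.range (powMonoidHom 2 : Kˣ →* Kˣ)

/-- The square class group `Kˣ/Kˣ²`. -/
abbrev SqClass (K : Type*) [Field K] := Kˣ ⧸ sqSubgroup K

/-- The square class of a unit. -/
def sqCl {K : Type*} [Field K] (u : Kˣ) : SqClass K := QuotientGroup.mk u

/-- `α : Kˣ/Kˣ² → Lˣ/Lˣ²` is a Witt equivalence: it sends `-1` to `-1` and preserves
binary value sets. -/
structure IsWittEquiv {K L : Type*} [Field K] [Field L]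
    (α : SqClass K ≃* SqClass L) : Prop where
  map_neg_one : α (sqCl (-1)) = sqCl (-1)
  represents : ∀ (a b c : Kˣ) (a' b' c' : Lˣ),
    α (sqCl a) = sqCl a' → α (sqCl b) = sqCl b' → α (sqCl c) = sqCl c' →
    ((∃ x y : K, (c : K) = (a : K) * x ^ 2 + (b : K) * y ^ 2) ↔
      (∃ x y : L, (c' : L) = (a' : L) * x ^ 2 + (b' : L) * y ^ 2))

/-- Two fields are Witt equivalent if there is a Witt equivalence between them. -/
def WittEquivalent (K L : Type*) [Field K] [Field L] : Prop :=
  ∃ α : SqClass K ≃* SqClass L, IsWittEquiv α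

/-- An ordering of a field `F`. -/
structure IsOrdering {F : Type*} [Field F] (P : Set F) : Prop where
  add_mem : ∀ x ∈ P, ∀ y ∈ P, x + y ∈ P
  mul_mem : ∀ x ∈ P, ∀ y ∈ P, x * y ∈ P
  total : ∀ x : F, x ∈ P ∨ -x ∈ P
  antisymm : ∀ x : F, x ∈ P → -x ∈ P → x = 0

/-- A pair of multiplicative subgroups `T ≤ H` of a field, with `H` of index at most two, such that
all elements outside of `H` are rigid with respect to `T`. -/
structure RigidPair (K : Type*) [Field K] where
  T : Set K
  H : Set K
  T_le : ∀ x ∈ T, x ∈ H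
  zero_notMem : (0 : K) ∉ H
  sq_mem : ∀ x : K, x ≠ 0 → x ^ 2 ∈ T
  T_mul : ∀ x ∈ T, ∀ y ∈ T, x * y ∈ T
  H_mul : ∀ x ∈ H, ∀ y ∈ H, x * y ∈ H
  neg_one_mem : (-1 : K) ∈ H
  index_two : ∀ x y : K, x ≠ 0 → y ≠ 0 → x ∉ H → y ∉ H → x * y ∈ H
  rigid : ∀ x : K, x ≠ 0 → x ∉ H → 1 + x ∈ T ∨ (1 + x) / x ∈ T

namespace RigidPair

variable {K : Type*} [Field K] (P : RigidPair K)

lemma ne_zero {x : K} (hx : x ∈ P.H) : x ≠ 0 := fun h => P.zero_notMem (h ▸ hx)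

lemma T_ne_zero {x : K} (hx : x ∈ P.T) : x ≠ 0 := P.ne_zero (P.T_le x hx)

lemma one_T : (1 : K) ∈ P.T := by simpa using P.sq_mem 1 one_ne_zero

lemma T_inv {x : K} (hx : x ∈ P.T) : x⁻¹ ∈ P.T := by
  have h0 := P.T_ne_zero hx
  have := P.T_mul x hx _ (P.sq_mem x⁻¹ (inv_ne_zero h0))
  rwa [show x * x⁻¹ ^ 2 = x⁻¹ by field_simp] at this

lemma H_inv {x : K} (hx : x ∈ P.H) : x⁻¹ ∈ P.H := by
  have h0 := P.ne_zero hx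
  have := P.H_mul x hx _ (P.T_le _ (P.sq_mem x⁻¹ (inv_ne_zero h0)))
  rwa [show x * x⁻¹ ^ 2 = x⁻¹ by field_simp] at this

lemma T_div {x y : K} (hx : x ∈ P.T) (hy : y ∈ P.T) : x / y ∈ P.T := by
  rw [div_eq_mul_inv]; exact P.T_mul _ hx _ (P.T_inv hy)

/-- The nonzero elements outside of `H`. -/
def Odd (x : K) : Prop := x ≠ 0 ∧ x ∉ P.H

/-- The odd elements `x` with `1 + x ∈ T`. -/
def Small (x : K) : Prop := P.Odd x ∧ 1 + x ∈ P.T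

variable {P}

lemma Odd.mul_H {x a : K} (hx : P.Odd x) (ha : a ∈ P.H) : P.Odd (a * x) := by
  refine ⟨mul_ne_zero (P.ne_zero ha) hx.1, fun h => hx.2 ?_⟩
  have := P.H_mul _ (P.H_inv ha) _ h
  rwa [inv_mul_cancel_left₀ (P.ne_zero ha)] at this

lemma Odd.inv {x : K} (hx : P.Odd x) : P.Odd x⁻¹ :=
  ⟨inv_ne_zero hx.1, fun h => hx.2 (by simpa using P.H_inv h)⟩

lemma Odd.div_H {x a : K} (hx : P.Odd x) (ha : a ∈ P.H) : P.Odd (x / a) := by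
  rw [div_eq_inv_mul]; exact hx.mul_H (P.H_inv ha)

lemma Odd.mul {x y : K} (hx : P.Odd x) (hy : P.Odd y) : x * y ∈ P.H :=
  P.index_two x y hx.1 hy.1 hx.2 hy.2

lemma Odd.small_or {x : K} (hx : P.Odd x) : P.Small x ∨ P.Small x⁻¹ := by
  rcases P.rigid x hx.1 hx.2 with h | h
  · exact Or.inl ⟨hx, h⟩
  · refine Or.inr ⟨hx.inv, ?_⟩
    rwa [show 1 + x⁻¹ = (1 + x) / x by have := hx.1; field_simp; ring]

lemma Small.not_inv {x : K} (hx : P.Small x) : ¬ P.Small x⁻¹ := by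
  intro h
  have h0 := hx.1.1
  apply hx.1.2
  apply P.T_le
  have := P.T_div hx.2 h.2
  have h1 := P.T_ne_zero hx.2
  rwa [show (1 + x) / (1 + x⁻¹) = x by
    rw [show 1 + x⁻¹ = (1 + x) / x by field_simp; ring]; field_simp] at this

/-- Dichotomy for an odd element relative to an element of `H`. -/
lemma Odd.cmp {x a : K} (hx : P.Odd x) (ha : a ∈ P.H) :
    P.Small (x / a) ∨ (a + x) / x ∈ P.T := by
  have h0 := P.ne_zero ha
  have h1 := hx.1
  rcases P.rigid _ (hx.div_H ha).1 (hx.div_H ha).2 with h | h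
  · exact Or.inl ⟨hx.div_H ha, h⟩
  · right
    rwa [show (1 + x / a) / (x / a) = (a + x) / x by field_simp] at h

lemma Small.not_gt {x a : K} (ha : a ∈ P.H) (hx : P.Small (x / a)) : (a + x) / x ∉ P.T := by
  intro h
  have h0 := P.ne_zero ha
  have h1 : x ≠ 0 := fun h => hx.1.1 (by simp [h])
  apply hx.1.2
  apply P.T_le
  have h2 := P.T_ne_zero hx.2
  have h3 : a + x ≠ 0 := by
    intro h4
    apply h2
    rw [show 1 + x / a = (a + x) / a by field_simp, h4, zero_div]
  have := P.T_div hx.2 h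
  rwa [show (1 + x / a) / ((a + x) / x) = x / a by field_simp] at this

lemma not_small_transfer {a b c x : K} (hx : P.Odd x) (ha : a ∈ P.H) (hb : b ∈ P.H) (hc : c ∈ P.H)
    (habc : c = a + b) (hac : a / c ∉ P.T) (h : P.Small (x / c)) : P.Small (x / b) := by
  have ha0 := P.ne_zero ha
  have hb0 := P.ne_zero hb
  have hc0 := P.ne_zero hc
  have hx0 := hx.1
  by_contra hcon
  have hz := (hx.cmp hb).resolve_left hcon
  have hzo : P.Odd (b + x) := by
    have := hx.mul_H (P.T_le _ hz)
    rwa [div_mul_cancel₀ _ hx0] at this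
  have hcx : a + (b + x) = c + x := by rw [habc]; ring
  have h2 : (c + x) / c ∈ P.T := by
    have := h.2
    rwa [show 1 + x / c = (c + x) / c by field_simp] at this
  have h3 : c + x ≠ 0 := fun h3 => P.T_ne_zero h2 (by simp [h3])
  rcases hzo.cmp ha with h1 | h1
  · have h4 := h1.2
    rw [show 1 + (b + x) / a = (c + x) / a by rw [← hcx]; field_simp] at h4
    apply hac
    have := P.T_div h2 h4
    rwa [show ((c + x) / c) / ((c + x) / a) = a / c by field_simp] at this
  · rw [hcx] at h1
    apply h.not_gt hc
    have := P.T_mul _ h1 _ hz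
    rwa [div_mul_div_cancel₀ hzo.1] at this

variable (P) in
/-- Elements of `H` stabilizing the set of small elements. -/
def Stab (a : K) : Prop := a ∈ P.H ∧ ∀ x, P.Small x ↔ P.Small (a * x)

lemma Stab.inv {a : K} (ha : P.Stab a) : P.Stab a⁻¹ := by
  refine ⟨P.H_inv ha.1, fun x => ?_⟩
  rw [ha.2 (a⁻¹ * x), mul_inv_cancel_left₀ (P.ne_zero ha.1)]

lemma Stab.mul {a b : K} (ha : P.Stab a) (hb : P.Stab b) : P.Stab (a * b) :=
  ⟨P.H_mul _ ha.1 _ hb.1, fun x => by rw [hb.2, ha.2, mul_assoc]⟩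

lemma stab_of_triple {h e : K} (he : e = 1 + h) (hH : h ∈ P.H) (eH : e ∈ P.H)
    (h1 : -h ∉ P.T) (h2 : e ∉ P.T) (h3 : h * e ∉ P.T) :
    P.Stab h ∧ P.Stab e ∧ P.Stab (-1) := by
  have h0 := P.ne_zero hH
  have e0 := P.ne_zero eH
  have one := P.T_le _ P.one_T
  have nH : ∀ {x}, x ∈ P.H → -x ∈ P.H := fun {x} hx => by
    simpa using P.H_mul _ P.neg_one_mem _ hx
  have key : ∀ {x y : K} (z : K), z ≠ 0 → x / y * z ^ 2 ∉ P.T → x / y ∉ P.T :=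
    fun z hz hx hxy => hx (P.T_mul _ hxy _ (P.sq_mem z hz))
  have inv' : ∀ {x : K}, x ∉ P.T → 1 / x ∉ P.T := fun {x} hx hx' => hx (by
    simpa using P.T_inv hx')
  have hhe : h / e ∉ P.T := key e e0 (by rwa [show h / e * e ^ 2 = h * e by field_simp])
  have heh : e / h ∉ P.T := key h h0 (by rwa [show e / h * h ^ 2 = h * e by field_simp])
  have c1 : ∀ x, P.Odd x → P.Small (x / e) → P.Small (x / h) := fun x hx =>
    not_small_transfer hx one hH eH he (inv' h2)
  have c2 : ∀ x, P.Odd x → P.Small (x / 1) → P.Small (x / e) := fun x hx =>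
    not_small_transfer hx (nH hH) eH one (by rw [he]; ring) (by simpa using h1)
  have c3 : ∀ x, P.Odd x → P.Small (x / (-h)) → P.Small (x / 1) := fun x hx =>
    not_small_transfer hx (nH eH) one (nH hH) (by rw [he]; ring) (by rwa [neg_div_neg_eq])
  have c4 : ∀ x, P.Odd x → P.Small (x / (-e)) → P.Small (x / (-h)) := fun x hx =>
    not_small_transfer hx (nH one) (nH hH) (nH eH) (by rw [he]; ring)
      (by rw [neg_div_neg_eq]; exact inv' h2)
  have c5 : ∀ x, P.Odd x → P.Small (x / (-1)) → P.Small (x / (-e)) := fun x hx =>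
    not_small_transfer hx hH (nH eH) (nH one) (by rw [he]; ring)
      (by rwa [div_neg, div_one])
  have c6 : ∀ x, P.Odd x → P.Small (x / h) → P.Small (x / (-1)) := fun x hx =>
    not_small_transfer hx eH (nH one) hH (by rw [he]; ring) heh
  have hst : ∀ a ∈ P.H, (∀ x, P.Odd x → (P.Small (x / 1) ↔ P.Small (x / a))) → P.Stab a := by
    intro a ha hx
    refine ⟨ha, fun x => ⟨fun h => ?_, fun h => ?_⟩⟩
    · have := (hx (a * x) (h.1.mul_H ha)).2 (by rwa [mul_div_cancel_left₀ _ (P.ne_zero ha)])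
      simpa using this
    · have := (hx (a * x) h.1).1 (by simpa using h)
      rwa [mul_div_cancel_left₀ _ (P.ne_zero ha)] at this
  refine ⟨hst h hH fun x hx => ⟨fun k => c1 x hx (c2 x hx k), fun k => ?_⟩,
    hst e eH fun x hx => ⟨c2 x hx, fun k => ?_⟩, hst _ (nH one) fun x hx => ⟨fun k => ?_, fun k => ?_⟩⟩
  · exact c3 x hx (c4 x hx (c5 x hx (c6 x hx k)))
  · exact c3 x hx (c4 x hx (c5 x hx (c6 x hx (c1 x hx k))))
  · exact c6 x hx (c1 x hx (c2 x hx k))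
  · exact c3 x hx (c4 x hx (c5 x hx k))

section Stable

variable {e : K} (hs1 : P.Stab (-1)) (hse : P.Stab e) (heT : e ∉ P.T)
include hs1 hse heT

omit hs1 in
lemma Small.div_one_add {x z : K} (hx : P.Small x) (hz : P.Small z) : P.Small (z / (1 + x)) := by
  have main : ∀ z, P.Small z → z / x ∉ P.T → P.Small (z / (1 + x)) := by
    intro z hz hzx
    by_contra hcon
    have h1 := (hz.1.cmp (P.T_le _ hx.2)).resolve_left hcon
    have hz0 := hz.1.1
    have hx0 := hx.1.1
    have hs : 1 + x + z ≠ 0 := fun h => P.T_ne_zero h1 (by simp [h])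
    rcases hx.1.cmp (P.T_le _ hz.2) with h2 | h2
    · have h3 := P.T_mul _ h2.2 _ hz.2
      have h1z := P.T_ne_zero hz.2
      rw [show (1 + x / (1 + z)) * (1 + z) = 1 + x + z by field_simp; ring] at h3
      have := P.T_div h3 h1
      rw [show (1 + x + z) / ((1 + x + z) / z) = z by field_simp] at this
      exact hz.1.2 (P.T_le _ this)
    · rw [show 1 + z + x = 1 + x + z by ring] at h2
      have := P.T_div h2 h1
      rw [show ((1 + x + z) / x) / ((1 + x + z) / z) = z / x by field_simp] at this
      exact hzx this
  by_cases hzx : z / x ∈ P.T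
  · have := main (e * z) ((hse.2 z).1 hz) (fun h => heT (by
      have := P.T_div h hzx
      have hz0 := hz.1.1
      have hx0 := hx.1.1
      rwa [show (e * z / x) / (z / x) = e by field_simp] at this))
    rwa [mul_div_assoc, ← hse.2] at this
  · exact main z hz hzx

omit hse heT in
lemma Small.neg {x : K} (hx : P.Small x) : P.Small (-x) := by
  simpa using (hs1.2 x).1 hx

lemma Small.mul_one_add {x z : K} (hx : P.Small x) (hz : P.Small z) : P.Small ((1 + x) * z) := by
  have h1 := Small.neg hs1 (Small.div_one_add hse heT hx hx)
  have h0 := P.T_ne_zero hx.2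
  have := Small.div_one_add hse heT h1 hz
  rwa [show z / (1 + -(x / (1 + x))) = (1 + x) * z by
    rw [show 1 + -(x / (1 + x)) = 1 / (1 + x) by field_simp; ring]; field_simp] at this

lemma Small.stab {x : K} (hx : P.Small x) : P.Stab (1 + x) := by
  refine ⟨P.T_le _ hx.2, fun z => ⟨Small.mul_one_add hs1 hse heT hx, fun h => ?_⟩⟩
  have := Small.div_one_add hse heT hx h
  rwa [mul_div_cancel_left₀ _ (P.T_ne_zero hx.2)] at this

lemma Small.one_add_mul {x y : K} (hx : P.Small x) (hy : P.Small y) :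
    1 + x * y ∈ P.T ∧ P.Stab (1 + x * y) := by
  have main : ∀ y, P.Small y → 1 + x * (y / (1 + y)) ∈ P.T ∧ P.Stab (1 + x * (y / (1 + y))) := by
    intro y hy
    have h1 := Small.mul_one_add hs1 hse heT hx hy
    have h0 := P.T_ne_zero hy.2
    have h2 : (1 + (1 + x) * y) / (1 + y) = 1 + x * (y / (1 + y)) := by field_simp; ring
    rw [← h2]
    refine ⟨P.T_div h1.2 hy.2, ?_⟩
    rw [div_eq_mul_inv]
    exact (Small.stab hs1 hse heT h1).mul (Small.stab hs1 hse heT hy).inv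
  have hn := Small.neg hs1 hy
  have h0 := P.T_ne_zero hn.2
  have := main _ (Small.div_one_add hse heT hn hy)
  rwa [show y / (1 + -y) / (1 + y / (1 + -y)) = y by
    rw [show 1 + y / (1 + -y) = 1 / (1 + -y) by field_simp; ring]; field_simp] at this

lemma Small.mul_mul {x y z : K} (hx : P.Small x) (hy : P.Small y) (hz : P.Small z) :
    P.Small (y * z * x) := by
  have main : ∀ x, P.Small x → P.Small (y * z * (x / (1 + x))) := by
    intro x hx
    have h0 := P.T_ne_zero hx.2
    have h1 := ((Small.one_add_mul hs1 hse heT hy hz).2.2 x).1 hx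
    have h2 := P.T_div h1.2 hx.2
    refine ⟨(hx.1.div_H (P.T_le _ hx.2)).mul_H (hy.1.mul hz.1), ?_⟩
    rwa [show (1 + (1 + y * z) * x) / (1 + x) = 1 + y * z * (x / (1 + x)) by
      field_simp; ring] at h2
  have hn := Small.neg hs1 hx
  have h0 := P.T_ne_zero hn.2
  have := main _ (Small.div_one_add hse heT hn hx)
  rwa [show x / (1 + -x) / (1 + x / (1 + -x)) = x by
    rw [show 1 + x / (1 + -x) = 1 / (1 + -x) by field_simp; ring]; field_simp] at this

end Stable

variable (P) in
/-- Elements of `H` mapping small elements to small elements. -/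
def Bdd (a : K) : Prop := a ∈ P.H ∧ ∀ x, P.Small x → P.Small (a * x)

lemma Stab.bdd {a : K} (ha : P.Stab a) : P.Bdd a := ⟨ha.1, fun x => (ha.2 x).1⟩

/-- An element of `H` which is not bounded is the inverse of a product of two small elements. -/
lemma exists_of_not_bdd {a : K} (ha : a ∈ P.H) (h : ¬ P.Bdd a) :
    ∃ x y, P.Small x ∧ P.Small y ∧ a⁻¹ = x * y := by
  simp only [Bdd, ha, true_and, not_forall] at h
  obtain ⟨x, hx, hax⟩ := h
  have h0 := hx.1.1
  have h1 := P.ne_zero ha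
  refine ⟨x, (a * x)⁻¹, hx, (hx.1.mul_H ha).small_or.resolve_left hax, by field_simp⟩

variable (P) in
/-- Membership in the valuation ring attached to a rigid pair. -/
def Integral (x : K) : Prop := x = 0 ∨ P.Small x ∨ P.Bdd x

section Stable

variable {e : K} (hs1 : P.Stab (-1)) (hse : P.Stab e) (heT : e ∉ P.T)
include hs1 hse heT

lemma Small.mul_bdd {x y : K} (hx : P.Small x) (hy : P.Small y) : P.Bdd (x * y) :=
  ⟨hx.1.mul hy.1, fun _ hz => Small.mul_mul hs1 hse heT hz hx hy⟩

lemma Integral.mul {x y : K} (hx : P.Integral x) (hy : P.Integral y) : P.Integral (x * y) := by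
  rcases hx with rfl | hx | hx
  · exact Or.inl (zero_mul _)
  · rcases hy with rfl | hy | hy
    · exact Or.inl (mul_zero _)
    · exact Or.inr (Or.inr (Small.mul_bdd hs1 hse heT hx hy))
    · exact Or.inr (Or.inl (mul_comm x y ▸ hy.2 x hx))
  · rcases hy with rfl | hy | hy
    · exact Or.inl (mul_zero _)
    · exact Or.inr (Or.inl (hx.2 y hy))
    · exact Or.inr (Or.inr ⟨P.H_mul _ hx.1 _ hy.1, fun z hz => by
        rw [mul_assoc]; exact hx.2 _ (hy.2 z hz)⟩)

lemma Integral.one_add {z : K} (hz : P.Integral z) : P.Integral (1 + z) := by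
  have one : P.Bdd 1 := ⟨P.T_le _ P.one_T, fun x hx => by simpa using hx⟩
  rcases hz with rfl | hz | hz
  · exact Or.inr (Or.inr (by simpa using one))
  · exact Or.inr (Or.inr (Small.stab hs1 hse heT hz).bdd)
  · by_cases h0 : 1 + z = 0
    · exact Or.inl h0
    right
    by_cases hH : 1 + z ∈ P.H
    · right
      by_contra hcon
      obtain ⟨x, y, hx, hy, hxy⟩ := exists_of_not_bdd hH hcon
      have h1 := (Small.one_add_mul hs1 hse heT (Small.neg hs1 (hz.2 x hx)) hy).2
      have h2 : 1 + -(z * x) * y = x * y := by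
        have : (1 + z) * (x * y) = 1 := by rw [← hxy, mul_inv_cancel₀ h0]
        linear_combination -this
      rw [h2, ← hxy] at h1
      exact hcon (by simpa using h1.inv.bdd)
    · left
      have hodd : P.Odd (1 + z) := ⟨h0, hH⟩
      refine hodd.small_or.resolve_right fun hy => ?_
      have h1 := hz.2 _ hy
      have h2 := (Small.neg hs1 hy).2
      apply h1.1.2
      rw [show z * (1 + z)⁻¹ = 1 + -(1 + z)⁻¹ by field_simp; ring]
      exact P.T_le _ h2

omit hse heT in
lemma Integral.neg {x : K} (hx : P.Integral x) : P.Integral (-x) := by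
  rcases hx with rfl | hx | hx
  · left; simp
  · right; left; simpa using (hs1.2 x).1 hx
  · right; right
    refine ⟨by simpa using P.H_mul _ P.neg_one_mem _ hx.1, fun z hz => ?_⟩
    simpa using (hs1.2 _).1 (hx.2 z hz)

lemma integral_or (x : K) : P.Integral x ∨ P.Integral x⁻¹ := by
  by_cases h0 : x = 0
  · exact Or.inl (Or.inl h0)
  by_cases hH : x ∈ P.H
  · by_cases hb : P.Bdd x
    · exact Or.inl (Or.inr (Or.inr hb))
    · obtain ⟨y, z, hy, hz, h⟩ := exists_of_not_bdd hH hb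
      exact Or.inr (Or.inr (Or.inr (h ▸ Small.mul_bdd hs1 hse heT hy hz)))
  · rcases Odd.small_or (P := P) ⟨h0, hH⟩ with h | h
    · exact Or.inl (Or.inr (Or.inl h))
    · exact Or.inr (Or.inr (Or.inl h))

lemma Integral.add {x y : K} (hx : P.Integral x) (hy : P.Integral y) : P.Integral (x + y) := by
  by_cases hx0 : x = 0
  · simpa [hx0] using hy
  by_cases hy0 : y = 0
  · simpa [hy0] using hx
  rcases integral_or hs1 hse heT (x / y) with h | h
  · have := (Integral.one_add hs1 hse heT h).mul hs1 hse heT hy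
    rwa [show (1 + x / y) * y = x + y by field_simp; ring] at this
  · have := (Integral.one_add hs1 hse heT h).mul hs1 hse heT hx
    rwa [show (1 + (x / y)⁻¹) * x = x + y by field_simp] at this

end Stable

/-- The valuation ring attached to a rigid pair admitting a nonexceptional triple. -/
theorem exists_valuationSubring (P : RigidPair K) {h e : K} (he : e = 1 + h) (hH : h ∈ P.H)
    (eH : e ∈ P.H) (h1 : -h ∉ P.T) (h2 : e ∉ P.T) (h3 : h * e ∉ P.T) :
    ∃ O : ValuationSubring K, (∀ m, O.valuation m < 1 → 1 + m ∈ P.T) ∧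
      (∀ u, O.valuation u = 1 → u ∈ P.H) ∧ O.valuation h = 1 ∧ O.valuation e = 1 := by
  obtain ⟨hsh, hse, hs1⟩ := stab_of_triple he hH eH h1 h2 h3
  let O : ValuationSubring K :=
    { carrier := {x | P.Integral x}
      mul_mem' := fun hx hy => Integral.mul hs1 hse h2 hx hy
      one_mem' := Or.inr (Or.inr ⟨P.T_le _ P.one_T, fun x hx => by simpa using hx⟩)
      add_mem' := fun hx hy => Integral.add hs1 hse h2 hx hy
      zero_mem' := Or.inl rfl
      neg_mem' := fun hx => Integral.neg hs1 hx
      mem_or_inv_mem' := integral_or hs1 hse h2 }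
  have memO : ∀ x, x ∈ O ↔ P.Integral x := fun x => Iff.rfl
  have unit : ∀ x, x ≠ 0 → (O.valuation x = 1 ↔ P.Integral x ∧ P.Integral x⁻¹) := by
    intro x hx
    rw [← memO, ← memO, ← O.valuation_le_one_iff, ← O.valuation_le_one_iff, map_inv₀,
      inv_le_one₀ (zero_lt_iff.2 ((O.valuation.ne_zero_iff).2 hx)), le_antisymm_iff]
  have hst : ∀ a, P.Stab a → O.valuation a = 1 := fun a ha =>
    (unit a (P.ne_zero ha.1)).2 ⟨Or.inr (Or.inr ha.bdd), Or.inr (Or.inr ha.inv.bdd)⟩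
  refine ⟨O, fun m hm => ?_, fun u hu => ?_, hst h hsh, hst e hse⟩
  · have hmO : P.Integral m := (memO m).1 ((O.valuation_le_one_iff m).1 hm.le)
    rcases hmO with rfl | hm' | hm'
    · simpa using P.one_T
    · exact hm'.2
    · have hm0 := P.ne_zero hm'.1
      have : ¬ P.Bdd m⁻¹ := fun hb =>
        hm.ne ((unit m hm0).2 ⟨Or.inr (Or.inr hm'), Or.inr (Or.inr hb)⟩)
      obtain ⟨x, y, hx, hy, hxy⟩ := exists_of_not_bdd (P.H_inv hm'.1) this
      rw [inv_inv] at hxy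
      rw [hxy]
      exact (Small.one_add_mul hs1 hse h2 hx hy).1
  · have hu0 : u ≠ 0 := fun h => by simp [h] at hu
    obtain ⟨hi, hi'⟩ := (unit u hu0).1 hu
    rcases hi with hi | hi | hi
    · exact absurd hi hu0
    · rcases hi' with hi' | hi' | hi'
      · exact absurd (inv_eq_zero.1 hi') hu0
      · exact absurd hi' hi.not_inv
      · simpa using P.H_inv hi'.1
    · exact hi.1

end RigidPair

section Correspondence

variable {K L : Type*} [Field K] [Field L]

/-- `x` and `x'` are nonzero and `α` maps the square class of `x` to that of `x'`. -/
def Corr (α : SqClass K ≃* SqClass L) (x : K) (x' : L) : Prop :=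
  ∃ (u : Kˣ) (u' : Lˣ), (u : K) = x ∧ (u' : L) = x' ∧ α (sqCl u) = sqCl u'

lemma sqCl_eq_iff {u v : Kˣ} : sqCl u = sqCl v ↔ ∃ z : K, (v : K) = u * z ^ 2 := by
  unfold sqCl
  rw [QuotientGroup.eq]
  constructor
  · rintro ⟨w, hw⟩
    refine ⟨w, ?_⟩
    have : v = u * w ^ 2 := by
      rw [show w ^ 2 = u⁻¹ * v from hw, mul_inv_cancel_left]
    rw [this]; simp
  · rintro ⟨z, hz⟩
    have hz0 : z ≠ 0 := by rintro rfl; simp at hz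
    refine ⟨Units.mk0 z hz0, ?_⟩
    ext
    simp [hz]

lemma sqCl_mul (u v : Kˣ) : sqCl (u * v) = sqCl u * sqCl v := rfl

lemma sqCl_sq {x : K} (hx : x ≠ 0) : sqCl (Units.mk0 (x ^ 2) (pow_ne_zero 2 hx)) = 1 := by
  have : (1 : SqClass K) = sqCl 1 := rfl
  rw [this, eq_comm, sqCl_eq_iff]
  exact ⟨x, by simp⟩

variable {α : SqClass K ≃* SqClass L}

lemma IsWittEquiv.symm (hα : IsWittEquiv α) : IsWittEquiv α.symm where
  map_neg_one := by rw [← hα.map_neg_one, MulEquiv.symm_apply_apply]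
  represents a b c a' b' c' ha hb hc := by
    refine (hα.represents a' b' c' a b c ?_ ?_ ?_).symm
    · rw [← ha, MulEquiv.apply_symm_apply]
    · rw [← hb, MulEquiv.apply_symm_apply]
    · rw [← hc, MulEquiv.apply_symm_apply]

namespace Corr

lemma ne_zero {x : K} {x' : L} (h : Corr α x x') : x ≠ 0 := by
  obtain ⟨u, u', rfl, rfl, -⟩ := h; exact u.ne_zero

lemma ne_zero' {x : K} {x' : L} (h : Corr α x x') : x' ≠ 0 := by
  obtain ⟨u, u', rfl, rfl, -⟩ := h; exact u'.ne_zero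

lemma exists_right {x : K} (hx : x ≠ 0) : ∃ x', Corr α x x' := by
  obtain ⟨u', hu'⟩ := QuotientGroup.mk_surjective (α (sqCl (Units.mk0 x hx)))
  exact ⟨u', Units.mk0 x hx, u', rfl, rfl, hu'.symm⟩

lemma symm {x : K} {x' : L} (h : Corr α x x') : Corr α.symm x' x := by
  obtain ⟨u, u', h1, h2, h3⟩ := h
  exact ⟨u', u, h2, h1, by rw [← h3, MulEquiv.symm_apply_apply]⟩

lemma of_symm {x : K} {x' : L} (h : Corr α.symm x' x) : Corr α x x' := by
  simpa using h.symm

lemma exists_left {x' : L} (hx : x' ≠ 0) : ∃ x, Corr α x x' := by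
  obtain ⟨x, hx⟩ := exists_right (α := α.symm) hx
  exact ⟨x, hx.of_symm⟩

lemma mul {x y : K} {x' y' : L} (h : Corr α x x') (k : Corr α y y') :
    Corr α (x * y) (x' * y') := by
  obtain ⟨u, u', rfl, rfl, h⟩ := h
  obtain ⟨v, v', rfl, rfl, k⟩ := k
  exact ⟨u * v, u' * v', by simp, by simp, by rw [sqCl_mul, map_mul, h, k, sqCl_mul]⟩

lemma sq_sq {x : K} {x' : L} (hx : x ≠ 0) (hx' : x' ≠ 0) : Corr α (x ^ 2) (x' ^ 2) := by
  refine ⟨Units.mk0 _ (pow_ne_zero 2 hx), Units.mk0 _ (pow_ne_zero 2 hx'), rfl, rfl, ?_⟩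
  rw [sqCl_sq hx, map_one, sqCl_sq hx']

lemma mul_sq {x z : K} {x' z' : L} (h : Corr α x x') (hz : z ≠ 0) (hz' : z' ≠ 0) :
    Corr α (x * z ^ 2) (x' * z' ^ 2) := h.mul (sq_sq hz hz')

lemma mul_sq_left {x z : K} {x' : L} (h : Corr α x x') (hz : z ≠ 0) : Corr α (x * z ^ 2) x' := by
  simpa using h.mul_sq hz (one_ne_zero (α := L))

lemma mul_sq_right {x : K} {x' z' : L} (h : Corr α x x') (hz' : z' ≠ 0) :
    Corr α x (x' * z' ^ 2) := by
  simpa using h.mul_sq (one_ne_zero (α := K)) hz'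

lemma div {x y : K} {x' y' : L} (h : Corr α x x') (k : Corr α y y') :
    Corr α (x / y) (x' / y') := by
  have hy := k.ne_zero
  have hy' := k.ne_zero'
  have := (h.mul k).mul_sq (inv_ne_zero hy) (inv_ne_zero hy')
  rwa [show x * y * y⁻¹ ^ 2 = x / y by field_simp,
    show x' * y' * y'⁻¹ ^ 2 = x' / y' by field_simp] at this

lemma one_one : Corr α 1 1 := by
  simpa using sq_sq (α := α) (one_ne_zero (α := K)) (one_ne_zero (α := L))

lemma neg_one (hα : IsWittEquiv α) : Corr α (-1) (-1) :=
  ⟨-1, -1, by simp, by simp, hα.map_neg_one⟩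

lemma neg (hα : IsWittEquiv α) {x : K} {x' : L} (h : Corr α x x') : Corr α (-x) (-x') := by
  simpa using (neg_one hα).mul h

lemma unique {x : K} {x' x'' : L} (h : Corr α x x') (k : Corr α x x'') :
    ∃ z, z ≠ 0 ∧ x'' = x' * z ^ 2 := by
  have h0 := k.ne_zero'
  obtain ⟨u, u', rfl, rfl, h⟩ := h
  obtain ⟨v, v', hv, rfl, k⟩ := k
  obtain rfl : v = u := Units.ext hv
  obtain ⟨z, hz⟩ := sqCl_eq_iff.1 (h.symm.trans k)
  exact ⟨z, by rintro rfl; simp at hz, hz⟩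

lemma represents (hα : IsWittEquiv α) {a b c : K} {a' b' c' : L} (ha : Corr α a a')
    (hb : Corr α b b') (hc : Corr α c c') (h : ∃ x y, c = a * x ^ 2 + b * y ^ 2) :
    ∃ x y, c' = a' * x ^ 2 + b' * y ^ 2 := by
  obtain ⟨u, u', rfl, rfl, ha⟩ := ha
  obtain ⟨v, v', rfl, rfl, hb⟩ := hb
  obtain ⟨w, w', rfl, rfl, hc⟩ := hc
  exact (hα.represents u v w u' v' w' ha hb hc).1 h

end Corr

end Correspondence

section ValuationClasses

variable {F Γ : Type*} [Field F] [LinearOrderedCommGroupWithZero Γ]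

/-- The elements which are a `1`-unit times a nonzero square. -/
def PrincipalClass (w : Valuation F Γ) : Set F :=
  {x | ∃ m z, z ≠ 0 ∧ w m < 1 ∧ x = (1 + m) * z ^ 2}

/-- The nonzero elements whose value is the value of a square. -/
def EvenClass (w : Valuation F Γ) : Set F := {x | x ≠ 0 ∧ ∃ z, w x = w z ^ 2}

/-- `ϖ` is a uniformizer of the discrete valuation `w`. -/
structure IsUnif (w : Valuation F Γ) (ϖ : F) : Prop where
  lt_one : w ϖ < 1
  ne_zero : ϖ ≠ 0
  exists_zpow : ∀ x, x ≠ 0 → ∃ n : ℤ, w x = w ϖ ^ n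

/-- The residue field has an element `h` such that none of `-h`, `1+h`, `h(1+h)` is a square. -/
def HasTriple (w : Valuation F Γ) : Prop :=
  ∃ h, w h = 1 ∧ w (1 + h) = 1 ∧ -h ∉ PrincipalClass w ∧ 1 + h ∉ PrincipalClass w ∧
    h * (1 + h) ∉ PrincipalClass w

variable {w : Valuation F Γ}

lemma PrincipalClass.mul {x y : F} (hx : x ∈ PrincipalClass w) (hy : y ∈ PrincipalClass w) :
    x * y ∈ PrincipalClass w := by
  obtain ⟨m, z, hz, hm, rfl⟩ := hx
  obtain ⟨n, t, ht, hn, rfl⟩ := hy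
  refine ⟨m + n * (1 + m), z * t, mul_ne_zero hz ht, ?_, by ring⟩
  refine w.map_add_lt hm ?_
  rwa [map_mul, w.map_one_add_of_lt hm, mul_one]

lemma PrincipalClass.sq {x : F} (hx : x ≠ 0) : x ^ 2 ∈ PrincipalClass w :=
  ⟨0, x, hx, by simp, by simp⟩

lemma PrincipalClass.one_add {m : F} (hm : w m < 1) : 1 + m ∈ PrincipalClass w :=
  ⟨m, 1, one_ne_zero, hm, by simp⟩

lemma PrincipalClass.even {x : F} (hx : x ∈ PrincipalClass w) : x ∈ EvenClass w := by
  obtain ⟨m, z, hz, hm, rfl⟩ := hx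
  have h1 := w.map_one_add_of_lt hm
  refine ⟨mul_ne_zero (fun h => by simp [h] at h1) (pow_ne_zero 2 hz), z, by simp [h1]⟩

lemma EvenClass.mul {x y : F} (hx : x ∈ EvenClass w) (hy : y ∈ EvenClass w) :
    x * y ∈ EvenClass w := by
  obtain ⟨hx, z, hz⟩ := hx
  obtain ⟨hy, t, ht⟩ := hy
  exact ⟨mul_ne_zero hx hy, z * t, by simp [hz, ht, mul_pow]⟩

lemma EvenClass.of_unit {u : F} (hu : w u = 1) : u ∈ EvenClass w :=
  ⟨fun h => by simp [h] at hu, 1, by simp [hu]⟩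

lemma EvenClass.inv {x : F} (hx : x ∈ EvenClass w) : x⁻¹ ∈ EvenClass w := by
  obtain ⟨hx, z, hz⟩ := hx
  exact ⟨inv_ne_zero hx, z⁻¹, by simp [hz]⟩

lemma EvenClass.of_sq_mul {x z : F} (hx : x * z ^ 2 ∈ EvenClass w) : x ∈ EvenClass w := by
  obtain ⟨h0, t, ht⟩ := hx
  have hz : z ≠ 0 := by rintro rfl; simp at h0
  refine ⟨left_ne_zero_of_mul h0, t / z, ?_⟩
  have : w z ≠ 0 := (w.ne_zero_iff).2 hz
  rw [map_mul, map_pow] at ht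
  rw [map_div₀, div_pow, ← ht]
  field_simp

namespace IsUnif

variable {ϖ : F} (hw : IsUnif w ϖ)
include hw

lemma pos : 0 < w ϖ := zero_lt_iff.2 ((w.ne_zero_iff).2 hw.ne_zero)

lemma zpow_inj {m n : ℤ} (h : w ϖ ^ m = w ϖ ^ n) : m = n :=
  zpow_right_injective₀ hw.pos hw.lt_one.ne h

lemma even_iff {x : F} {n : ℤ} (hx : w x = w ϖ ^ n) : x ∈ EvenClass w ↔ Even n := by
  have h0 := ((w.ne_zero_iff).2 hw.ne_zero)
  constructor
  · rintro ⟨hx0, z, hz⟩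
    have hz0 : z ≠ 0 := by
      rintro rfl
      simp at hz; exact hx0 hz
    obtain ⟨k, hk⟩ := hw.exists_zpow z hz0
    rw [hx, hk, ← zpow_natCast, ← zpow_mul] at hz
    have := hw.zpow_inj hz
    exact ⟨k, by simpa [mul_two] using this⟩
  · rintro ⟨k, rfl⟩
    refine ⟨fun h => ?_, ϖ ^ k, by rw [hx, map_zpow₀, zpow_add₀ h0, sq]⟩
    rw [h, map_zero] at hx
    exact zpow_ne_zero _ h0 hx.symm

lemma unif_notMem : ϖ ∉ EvenClass w := by
  rw [hw.even_iff (n := 1) (by simp)]; decide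

lemma mul_mem {x y : F} (hx : x ≠ 0) (hy : y ≠ 0) (hx' : x ∉ EvenClass w)
    (hy' : y ∉ EvenClass w) : x * y ∈ EvenClass w := by
  have h0 := ((w.ne_zero_iff).2 hw.ne_zero)
  obtain ⟨m, hm⟩ := hw.exists_zpow x hx
  obtain ⟨n, hn⟩ := hw.exists_zpow y hy
  rw [hw.even_iff hm, Int.not_even_iff_odd] at hx'
  rw [hw.even_iff hn, Int.not_even_iff_odd] at hy'
  rw [hw.even_iff (n := m + n) (by rw [map_mul, hm, hn, zpow_add₀ h0])]
  exact hx'.add_odd hy'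

lemma lt_of_even {x : F} (hx : x ∈ EvenClass w) (h1 : w x < 1) : w x < w ϖ := by
  obtain ⟨n, hn⟩ := hw.exists_zpow x hx.1
  have he := (hw.even_iff hn).1 hx
  rw [hn] at h1 ⊢
  have hn0 : 0 < n := by
    by_contra hcon
    push Not at hcon
    exact absurd h1 (not_lt.2 (one_le_zpow_of_nonpos₀ hw.pos hw.lt_one.le hcon))
  have hn2 : 1 < n := by
    rcases he with ⟨k, rfl⟩; omega
  simpa using zpow_lt_zpow_right_of_lt_one₀ hw.pos hw.lt_one hn2

end IsUnif

end ValuationClasses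

section Transport

variable {K L Γ Γ' : Type*} [Field K] [Field L] [LinearOrderedCommGroupWithZero Γ]
  [LinearOrderedCommGroupWithZero Γ'] {α : SqClass K ≃* SqClass L}

lemma IsWittEquiv.rigid (hα : IsWittEquiv α) (w : Valuation L Γ) {x : K} {x' : L}
    (h : Corr α x x') (hx' : x' ∉ EvenClass w) (hx1 : 1 + x ≠ 0) :
    ∃ m, w m < 1 ∧ (Corr α (1 + x) (1 + m) ∨ Corr α ((1 + x) / x) (1 + m)) := by
  obtain ⟨c', hc⟩ := Corr.exists_right (α := α) hx1
  obtain ⟨p, q, hpq⟩ := Corr.represents hα Corr.one_one h hc ⟨1, 1, by ring⟩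
  have h0 := h.ne_zero
  have h0' := h.ne_zero'
  have hc' := hc.ne_zero'
  have left : ∀ m, p ≠ 0 → c' = p ^ 2 * (1 + m) → Corr α (1 + x) (1 + m) := by
    intro m hp hm
    have := hc.mul_sq_right (inv_ne_zero hp)
    rwa [hm, show p ^ 2 * (1 + m) * p⁻¹ ^ 2 = 1 + m by field_simp] at this
  have right : ∀ m, q ≠ 0 → c' = x' * q ^ 2 * (1 + m) → Corr α ((1 + x) / x) (1 + m) := by
    intro m hq hm
    have := (hc.div h).mul_sq_right (inv_ne_zero hq)
    rwa [hm, show x' * q ^ 2 * (1 + m) / x' * q⁻¹ ^ 2 = 1 + m by field_simp] at this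
  by_cases hp : p = 0
  · have hq : q ≠ 0 := by rintro rfl; apply hc'; rw [hpq, hp]; ring
    exact ⟨0, by simp, Or.inr (right 0 hq (by rw [hpq, hp]; ring))⟩
  by_cases hq : q = 0
  · exact ⟨0, by simp, Or.inl (left 0 hp (by rw [hpq, hq]; ring))⟩
  have hwp : w p ≠ 0 := (w.ne_zero_iff).2 hp
  have hwq : w q ≠ 0 := (w.ne_zero_iff).2 hq
  have hwx : w x' ≠ 0 := (w.ne_zero_iff).2 h0'
  rcases lt_trichotomy (w (x' * q ^ 2)) (w (p ^ 2)) with hlt | heq | hgt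
  · refine ⟨x' * q ^ 2 / p ^ 2, ?_, Or.inl (left _ hp (by rw [hpq]; field_simp))⟩
    rw [map_div₀]
    exact (div_lt_one₀ (zero_lt_iff.2 (by simpa using hwp))).2 hlt
  · exfalso
    apply hx'
    refine ⟨h0', p / q, ?_⟩
    rw [map_div₀, div_pow, ← map_pow w p, ← heq, map_mul, map_pow]
    field_simp
  · refine ⟨p ^ 2 / (x' * q ^ 2), ?_, Or.inr (right _ hq (by rw [hpq]; field_simp; ring))⟩
    rw [map_div₀]
    exact (div_lt_one₀ (zero_lt_iff.2 (by simp [hwx, hwq]))).2 hgt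

/-- The rigid pair on `K` obtained from a discrete valuation on `L`. -/
def transportPair (hα : IsWittEquiv α) {w : Valuation L Γ} {ϖ : L} (hw : IsUnif w ϖ) :
    RigidPair K where
  T := {x | ∃ x', Corr α x x' ∧ x' ∈ PrincipalClass w}
  H := {x | ∃ x', Corr α x x' ∧ x' ∈ EvenClass w}
  T_le := fun _ ⟨x', h, h'⟩ => ⟨x', h, PrincipalClass.even h'⟩
  zero_notMem := fun ⟨_, h, _⟩ => h.ne_zero rfl
  sq_mem x hx := ⟨1 ^ 2, Corr.sq_sq hx one_ne_zero, PrincipalClass.sq one_ne_zero⟩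
  T_mul := fun _ ⟨x', h, h'⟩ _ ⟨y', k, k'⟩ => ⟨x' * y', h.mul k, PrincipalClass.mul h' k'⟩
  H_mul := fun _ ⟨x', h, h'⟩ _ ⟨y', k, k'⟩ => ⟨x' * y', h.mul k, EvenClass.mul h' k'⟩
  neg_one_mem := ⟨-1, Corr.neg_one hα, EvenClass.of_unit (by simp)⟩
  index_two x y hx hy hx' hy' := by
    obtain ⟨x', h⟩ := Corr.exists_right (α := α) hx
    obtain ⟨y', k⟩ := Corr.exists_right (α := α) hy
    exact ⟨x' * y', h.mul k, hw.mul_mem h.ne_zero' k.ne_zero' (fun h' => hx' ⟨x', h, h'⟩)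
      (fun h' => hy' ⟨y', k, h'⟩)⟩
  rigid x hx hx' := by
    obtain ⟨x', h⟩ := Corr.exists_right (α := α) hx
    have hx1 : 1 + x ≠ 0 := by
      intro h1
      rw [add_comm, add_eq_zero_iff_eq_neg] at h1
      exact hx' (h1 ▸ ⟨-1, Corr.neg_one hα, EvenClass.of_unit (by simp)⟩)
    obtain ⟨m, hm, h1 | h1⟩ := hα.rigid w h (fun h' => hx' ⟨x', h, h'⟩) hx1
    · exact Or.inl ⟨_, h1, PrincipalClass.one_add hm⟩
    · exact Or.inr ⟨_, h1, PrincipalClass.one_add hm⟩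

lemma PrincipalClass.of_corr {w : Valuation L Γ} {x : K} {x' x'' : L} (h : Corr α x x')
    (k : Corr α x x'') (hx : x'' ∈ PrincipalClass w) : x' ∈ PrincipalClass w := by
  obtain ⟨z, hz, rfl⟩ := k.unique h
  exact PrincipalClass.mul hx (PrincipalClass.sq hz)

lemma EvenClass.of_corr {w : Valuation L Γ} {x : K} {x' x'' : L} (h : Corr α x x')
    (k : Corr α x x'') (hx : x'' ∈ EvenClass w) : x' ∈ EvenClass w := by
  obtain ⟨z, hz, rfl⟩ := k.unique h
  exact EvenClass.mul hx (PrincipalClass.even (PrincipalClass.sq hz))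

/-- The valuation on `K` matching a discrete valuation `w` on `L`. -/
structure Matched (α : SqClass K ≃* SqClass L) (v : Valuation K Γ') (w : Valuation L Γ) :
    Prop where
  principal : ∀ m x', v m < 1 → Corr α (1 + m) x' → x' ∈ PrincipalClass w
  even : ∀ u x', v u = 1 → Corr α u x' → x' ∈ EvenClass w
  exists_principal : ∀ m, w m < 1 → ∃ k, v k < 1 ∧ Corr α (1 + k) (1 + m)
  triple : ∃ h h', v h = 1 ∧ v (1 + h) = 1 ∧ Corr α h h' ∧ Corr α (1 + h) (1 + h') ∧
    -h' ∉ PrincipalClass w ∧ 1 + h' ∉ PrincipalClass w ∧ h' * (1 + h') ∉ PrincipalClass w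

theorem exists_matched (hα : IsWittEquiv α) {w : Valuation L Γ} {ϖ : L} (hw : IsUnif w ϖ)
    (ht : HasTriple w) : ∃ O : ValuationSubring K, Matched α O.valuation w := by
  obtain ⟨h', hh', he', t1, t2, t3⟩ := ht
  have h0' : h' ≠ 0 := fun h => by simp [h] at hh'
  have e0' : 1 + h' ≠ 0 := fun h => by simp [h] at he'
  obtain ⟨h0, ch0⟩ := Corr.exists_left (α := α) h0'
  obtain ⟨e0, ce0⟩ := Corr.exists_left (α := α) e0'
  obtain ⟨p, q, hpq⟩ := Corr.represents hα.symm Corr.one_one ch0.symm ce0.symm ⟨1, 1, by ring⟩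
  have hh0 := ch0.ne_zero
  have hp : p ≠ 0 := by
    rintro rfl
    have hq : q ≠ 0 := by rintro rfl; apply ce0.ne_zero; rw [hpq]; ring
    rw [show e0 = h0 * q ^ 2 by rw [hpq]; ring] at ce0
    obtain ⟨z, hz, hz'⟩ := (ch0.mul_sq_left hq).unique ce0
    apply t3
    rw [hz', show h' * (h' * z ^ 2) = (h' * z) ^ 2 by ring]
    exact PrincipalClass.sq (mul_ne_zero h0' hz)
  have hq : q ≠ 0 := by
    rintro rfl
    rw [show e0 = 1 * p ^ 2 by rw [hpq]; ring] at ce0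
    obtain ⟨z, hz, hz'⟩ := (Corr.one_one.mul_sq_left hp).unique ce0
    apply t2
    rw [hz', one_mul]
    exact PrincipalClass.sq hz
  obtain ⟨h, ch, ce⟩ : ∃ h, Corr α h h' ∧ Corr α (1 + h) (1 + h') := by
    refine ⟨h0 * (q / p) ^ 2, ch0.mul_sq_left (div_ne_zero hq hp), ?_⟩
    have := ce0.mul_sq_left (inv_ne_zero hp)
    rwa [hpq, show (1 * p ^ 2 + h0 * q ^ 2) * p⁻¹ ^ 2 = 1 + h0 * (q / p) ^ 2 by
      field_simp] at this
  obtain ⟨O, o1, o2, o3, o4⟩ := RigidPair.exists_valuationSubring (transportPair hα hw)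
    (h := h) (e := 1 + h) rfl ⟨h', ch, EvenClass.of_unit hh'⟩ ⟨_, ce, EvenClass.of_unit he'⟩
    (fun ⟨x', c, hx⟩ => t1 (PrincipalClass.of_corr (ch.neg hα) c hx))
    (fun ⟨x', c, hx⟩ => t2 (PrincipalClass.of_corr ce c hx))
    (fun ⟨x', c, hx⟩ => t3 (PrincipalClass.of_corr (ch.mul ce) c hx))
  have principal : ∀ m x', O.valuation m < 1 → Corr α (1 + m) x' → x' ∈ PrincipalClass w := by
    intro m x' hm c
    obtain ⟨x'', c', hx⟩ := o1 m hm
    exact PrincipalClass.of_corr c c' hx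
  have even : ∀ u x', O.valuation u = 1 → Corr α u x' → x' ∈ EvenClass w := by
    intro u x' hu c
    obtain ⟨x'', c', hx⟩ := o2 u hu
    exact EvenClass.of_corr c c' hx
  have odd : ∀ m, m ≠ 0 → w m < 1 → m ∉ EvenClass w →
      ∃ k, O.valuation k < 1 ∧ Corr α (1 + k) (1 + m) := by
    intro m hm0 hm hme
    obtain ⟨m₀, c⟩ := Corr.exists_left (α := α) hm0
    have h1 : 1 + m ≠ 0 := fun h => by
      have := w.map_one_add_of_lt hm; simp [h] at this
    have hme' : m₀ ∉ EvenClass O.valuation := by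
      rintro ⟨hm₀, z, hz⟩
      apply hme
      have hz0 : z ≠ 0 := by rintro rfl; simp at hz; exact hm₀ hz
      have hz1 : O.valuation z ≠ 0 := (Valuation.ne_zero_iff _).2 hz0
      refine even (m₀ * z⁻¹ ^ 2) m ?_ (c.mul_sq_left (inv_ne_zero hz0))
      rw [map_mul, map_pow, map_inv₀, hz]
      field_simp
    obtain ⟨k, hk, c1 | c1⟩ := hα.symm.rigid O.valuation c.symm hme' h1
    · exact ⟨k, hk, c1.of_symm⟩
    · exfalso
      have h2 := PrincipalClass.even (principal k _ hk c1.of_symm)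
      apply hme
      have h3 := EvenClass.mul (EvenClass.of_unit (w.map_one_add_of_lt hm)) (EvenClass.inv h2)
      rwa [show (1 + m) * ((1 + m) / m)⁻¹ = m by field_simp] at h3
  refine ⟨O, principal, even, fun m hm => ?_, h, h', o3, o4, ch, ce, t1, t2, t3⟩
  by_cases hm0 : m = 0
  · exact ⟨0, by simp, by simpa [hm0] using Corr.one_one⟩
  by_cases hme : m ∈ EvenClass w
  · have hlt := hw.lt_of_even hme hm
    obtain ⟨k1, hk1, c1⟩ := odd ϖ hw.ne_zero hw.lt_one hw.unif_notMem
    have h1 := w.map_one_add_of_lt hw.lt_one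
    have h10 : 1 + ϖ ≠ 0 := fun h => by simp [h] at h1
    have hv : w ((m - ϖ) / (1 + ϖ)) = w ϖ := by
      rw [map_div₀, h1, div_one, w.map_sub_eq_of_lt_right hlt]
    have hne : (m - ϖ) / (1 + ϖ) ≠ 0 := by
      intro h
      rw [h, map_zero] at hv
      exact hw.ne_zero (w.zero_iff.1 hv.symm)
    obtain ⟨k2, hk2, c2⟩ := odd _ hne (hv ▸ hw.lt_one)
      (by rw [hw.even_iff (n := 1) (by simp [hv])]; decide)
    refine ⟨k1 + k2 * (1 + k1), ?_, ?_⟩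
    · refine Valuation.map_add_lt _ hk1 ?_
      rwa [map_mul, Valuation.map_one_add_of_lt _ hk1, mul_one]
    · have := c1.mul c2
      rwa [show (1 + ϖ) * (1 + (m - ϖ) / (1 + ϖ)) = 1 + m by field_simp; ring,
        show (1 + k1) * (1 + k2) = 1 + (k1 + k2 * (1 + k1)) by ring] at this
  · exact odd m hm0 hm hme

end Transport

lemma valuationSubring_residue_eq_zero_iff {K : Type*} [Field K] {O : ValuationSubring K} (x : O) :
    IsLocalRing.residue O x = 0 ↔ O.valuation x < 1 := by
  rw [IsLocalRing.residue_eq_zero_iff, ValuationSubring.valuation_lt_one_iff]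

section Rank

/-- Linearly independent families have bounded size. -/
def BddRank (A M : Type*) [CommRing A] [AddCommGroup M] [Module A M] : Prop :=
  ∃ n : ℕ, ∀ x : Fin n → M, ¬ LinearIndependent A x

lemma linearIndependent_of_dvd {A M ι : Type*} [CommRing A] [IsDomain A] [WfDvdMonoid A]
    [AddCommGroup M] [Module A M] [Fintype ι] {π : A} (hπ : ¬ IsUnit π)
    (hinj : ∀ m : M, π • m = 0 → m = 0) {x : ι → M}
    (h : ∀ c : ι → A, ∑ i, c i • x i = 0 → ∀ i, π ∣ c i) : LinearIndependent A x := by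
  rw [Fintype.linearIndependent_iff]
  intro c hc
  have main : ∀ n : ℕ, ∀ i, π ^ n ∣ c i := by
    intro n
    induction n with
    | zero => simp
    | succ n ih =>
      choose e he using ih
      have h1 : ∑ i, e i • x i = 0 := by
        have h2 : ∀ n : ℕ, ∀ m : M, π ^ n • m = 0 → m = 0 := by
          intro n
          induction n with
          | zero => simp
          | succ n ih =>
            intro m hm
            rw [pow_succ, mul_smul] at hm
            exact hinj _ (ih _ hm)
        apply h2 n
        rw [Finset.smul_sum, ← hc]
        exact Finset.sum_congr rfl fun i _ => by rw [he i, mul_smul]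
      intro i
      rw [pow_succ, he i]
      exact mul_dvd_mul_left _ (h e h1 i)
  intro i
  by_contra hi
  obtain ⟨n, hn⟩ := FiniteMultiplicity.of_not_isUnit hπ hi
  exact hn (main _ i)

open IsLocalRing

lemma BddRank.residue {A B K : Type*} [CommRing A] [IsDomain A] [WfDvdMonoid A] [CommRing B]
    [Field K] [Algebra A K] (O : ValuationSubring K) (hA : ∀ a, algebraMap A K a ∈ O)
    [Algebra B (ResidueField O)] (g : A →+* B) {π : A} (hπ : ¬ IsUnit π)
    (hπ0 : algebraMap A K π ≠ 0) (hker : ∀ a, g a = 0 → π ∣ a)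
    (hcomp : ∀ a, algebraMap B (ResidueField O) (g a) = IsLocalRing.residue O ⟨algebraMap A K a, hA a⟩)
    (hK : BddRank A K) : BddRank B (ResidueField O) := by
  obtain ⟨n, hn⟩ := hK
  refine ⟨n, fun x hx => ?_⟩
  choose y hy using fun i => residue_surjective (x i)
  apply hn (fun i => (y i : K))
  refine linearIndependent_of_dvd hπ (fun m hm => ?_) fun c hc i => hker _ ?_
  · rw [Algebra.smul_def] at hm
    exact (mul_eq_zero.1 hm).resolve_left hπ0
  · rw [Fintype.linearIndependent_iff] at hx
    refine hx (fun i => g (c i)) ?_ i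
    have h0 : ∑ i, (⟨algebraMap A K (c i), hA _⟩ : O) * y i = 0 := by
      apply Subtype.ext
      simpa [Algebra.smul_def] using hc
    have := congrArg (IsLocalRing.residue O) h0
    rw [map_sum, map_zero] at this
    rw [← this]
    refine Finset.sum_congr rfl fun i _ => ?_
    rw [Algebra.smul_def, hcomp, map_mul, hy]

lemma BddRank.finite {k M : Type*} [Field k] [AddCommGroup M] [Module k M] (h : BddRank k M) :
    Module.Finite k M := by
  obtain ⟨n, hn⟩ := h
  rw [← Module.rank_lt_aleph0_iff]
  by_contra hcon
  obtain ⟨s, hs⟩ := exists_linearIndependent_of_le_rank (R := k) (M := M) (n := n)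
    (Cardinal.natCast_lt_aleph0.le.trans (not_lt.1 hcon))
  exact hn s hs

end Rank

section Nonuniversal

open IsLocalRing

variable {A F : Type*} [CommRing A] [IsDomain A] [WfDvdMonoid A] [Field F] [Algebra A F]

omit [IsDomain A] [WfDvdMonoid A] in
/-- A valuation on `F` centered at a maximal ideal `(π)` of `A`. -/
lemma exists_valuationSubring_center (hinj : Function.Injective (algebraMap A F)) {π : A}
    (hmax : (Ideal.span {π}).IsMaximal) :
    ∃ V : ValuationSubring F, (∀ a, algebraMap A F a ∈ V) ∧
      ∀ a, V.valuation (algebraMap A F a) < 1 ↔ π ∣ a := by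
  let e : A →+* (algebraMap A F).range := (algebraMap A F).rangeRestrict
  have he : Function.Bijective e :=
    ⟨fun x y h => hinj (congrArg Subtype.val h), (algebraMap A F).rangeRestrict_surjective⟩
  have hI : (Ideal.span {π}).map e ≠ ⊤ := by
    intro h
    have := Ideal.comap_map_of_bijective e he (I := Ideal.span {π})
    rw [h, Ideal.comap_top] at this
    exact hmax.ne_top this.symm
  obtain ⟨V, hV, hV'⟩ := Ideal.image_subset_nonunits_valuationSubring _ hI
  have hmem : ∀ a, algebraMap A F a ∈ V := fun a => hV ⟨a, rfl⟩
  have hπ : ∀ a, π ∣ a → V.valuation (algebraMap A F a) < 1 := by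
    intro a ha
    rw [← ValuationSubring.mem_nonunits_iff]
    exact hV' ⟨e a, Ideal.mem_map_of_mem e (Ideal.mem_span_singleton.2 ha), rfl⟩
  refine ⟨V, hmem, fun a => ⟨fun h => ?_, hπ a⟩⟩
  by_contra hcon
  have : a ∉ Ideal.span {π} := fun h => hcon (Ideal.mem_span_singleton.1 h)
  obtain ⟨y, i, hi, hyi⟩ := hmax.exists_inv this
  have h1 := hπ i (Ideal.mem_span_singleton.1 hi)
  have h2 : V.valuation (algebraMap A F (y * a)) < 1 := by
    rw [map_mul, map_mul]
    exact (mul_le_of_le_one_left' ((V.valuation_le_one_iff _).2 (hmem y))).trans_lt h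
  have h3 := V.valuation.map_add_lt h2 h1
  rw [← map_add, hyi, map_one, map_one] at h3
  exact lt_irrefl _ h3

lemma exists_odd_value (hinj : Function.Injective (algebraMap A F)) (hb : BddRank A F) {π : A}
    (hπ0 : π ≠ 0) (hπu : ¬ IsUnit π) (V : ValuationSubring F) (hmem : ∀ a, algebraMap A F a ∈ V)
    (hV : ∀ a, V.valuation (algebraMap A F a) < 1 ↔ π ∣ a) :
    ∃ x : F, ∀ z, V.valuation x ≠ V.valuation z ^ 2 := by
  set v := V.valuation
  by_contra! hcon
  have hpow : ∀ k : ℕ, ∃ x, v x ^ (2 ^ k) = v (algebraMap A F π) := by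
    intro k
    induction k with
    | zero => exact ⟨algebraMap A F π, by simp⟩
    | succ k ih =>
      obtain ⟨x, hx⟩ := ih
      obtain ⟨z, hz⟩ := hcon x
      exact ⟨z, by rw [← hx, hz, pow_succ, mul_comm, pow_mul]⟩
  obtain ⟨n, hn⟩ := hb
  obtain ⟨x, hx⟩ := hpow n
  have hlt : n < 2 ^ n := Nat.lt_two_pow_self
  set N := 2 ^ n
  have hπF : algebraMap A F π ≠ 0 := fun h => hπ0 (hinj (by simpa using h))
  have hvπ : v (algebraMap A F π) ≠ 0 := (Valuation.ne_zero_iff v).2 hπF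
  have hvπ1 : v (algebraMap A F π) < 1 := (hV π).2 dvd_rfl
  have hx0 : v x ≠ 0 := fun h => hvπ (by rw [← hx, h, zero_pow (by omega)])
  have hx1 : v x < 1 := by
    by_contra h
    rw [← hx] at hvπ1
    exact absurd hvπ1 (not_lt.2 (one_le_pow₀ (not_lt.1 h)))
  have hanti : StrictAnti fun k : ℕ => v x ^ k := pow_right_strictAnti₀ (zero_lt_iff.2 hx0) hx1
  apply hn (fun i => x ^ (i : ℕ))
  rw [Fintype.linearIndependent_iff]
  intro c hc
  by_contra! hne
  have hval : ∀ i, ∃ m : ℕ, c i ≠ 0 → v (c i • x ^ (i : ℕ)) = v x ^ (N * m + i) := by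
    intro i
    by_cases hi : c i = 0
    · exact ⟨0, fun h => absurd hi h⟩
    obtain ⟨e, hce, he⟩ :=
      (FiniteMultiplicity.of_not_isUnit hπu hi).exists_eq_pow_mul_and_not_dvd
    refine ⟨multiplicity π (c i), fun _ => ?_⟩
    have h1 : v (algebraMap A F e) = 1 :=
      le_antisymm ((V.valuation_le_one_iff _).2 (hmem e)) (not_lt.1 (mt (hV e).1 he))
    rw [Algebra.smul_def, map_mul]
    nth_rw 1 [hce]
    rw [map_mul, map_mul, map_pow, map_pow, map_pow, h1, mul_one, ← hx, ← pow_mul, ← pow_add]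
  choose m hm using hval
  classical
  obtain ⟨j, hj, hjmin⟩ := Finset.exists_min_image (Finset.univ.filter fun i => c i ≠ 0)
    (fun i : Fin n => N * m i + i) (by
      obtain ⟨i, hi⟩ := hne
      exact ⟨i, by simpa using hi⟩)
  simp only [Finset.mem_filter, Finset.mem_univ, true_and] at hj hjmin
  have key : v (∑ i, c i • x ^ (i : ℕ)) = v (c j • x ^ (j : ℕ)) := by
    refine Valuation.map_sum_eq_of_lt v (Finset.mem_univ j) ?_
    intro i hi
    have hij : i ≠ j := by simpa using hi
    by_cases hci : c i = 0
    · rw [hci, zero_smul, map_zero, hm j hj]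
      exact zero_lt_iff.2 (pow_ne_zero _ hx0)
    · rw [hm i hci, hm j hj]
      apply hanti
      refine lt_of_le_of_ne (hjmin i hci) fun h => hij ?_
      have h1 := congrArg (· % N) h
      simp only [Nat.mul_add_mod] at h1
      rw [Nat.mod_eq_of_lt (j.2.trans hlt), Nat.mod_eq_of_lt (i.2.trans hlt)] at h1
      exact Fin.ext h1.symm
  rw [hc, map_zero, hm j hj] at key
  exact pow_ne_zero _ hx0 key.symm

theorem not_universal (hinj : Function.Injective (algebraMap A F)) (hb : BddRank A F) {π : A}
    (hπ0 : π ≠ 0) (hmax : (Ideal.span {π}).IsMaximal) (hfin : Finite (A ⧸ Ideal.span {π}))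
    (h2 : ¬ π ∣ 2) (hi : IsSquare (-1 : F))
    (huniv : ∀ a b : F, ¬ IsSquare a → ∃ p q, b = p ^ 2 + a * q ^ 2) : False := by
  obtain ⟨V, hmem, hV⟩ := exists_valuationSubring_center hinj hmax
  set v := V.valuation
  have hπu : ¬ IsUnit π := fun h => hmax.ne_top (Ideal.span_singleton_eq_top.2 h)
  have hπF : algebraMap A F π ≠ 0 := fun h => hπ0 (hinj (by simpa using h))
  obtain ⟨x, hx⟩ := exists_odd_value hinj hb hπ0 hπu V hmem hV
  let : Field (A ⧸ Ideal.span {π}) := Ideal.Quotient.field _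
  let toV : A →+* V := (algebraMap A F).codRestrict V.toSubring hmem
  have hlift : ∀ a ∈ Ideal.span {π}, (IsLocalRing.residue V).comp toV a = 0 := by
    intro a ha
    rw [RingHom.comp_apply, valuationSubring_residue_eq_zero_iff]
    exact (hV a).2 (Ideal.mem_span_singleton.1 ha)
  let : Algebra (A ⧸ Ideal.span {π}) (ResidueField V) := (Ideal.Quotient.lift _ _ hlift).toAlgebra
  have hbr : BddRank (A ⧸ Ideal.span {π}) (ResidueField V) :=
    BddRank.residue V hmem (Ideal.Quotient.mk _) hπu hπF
      (fun a ha => Ideal.mem_span_singleton.1 (Ideal.Quotient.eq_zero_iff_mem.1 ha))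
      (fun a => Ideal.Quotient.lift_mk _ _ _) hb
  have := hbr.finite
  have hF : Finite (ResidueField V) := Module.finite_of_finite (A ⧸ Ideal.span {π})
  have h2V : v 2 = 1 := by
    refine le_antisymm ((V.valuation_le_one_iff _).2 ?_) (not_lt.1 ?_)
    · simpa only [map_ofNat] using hmem 2
    · simpa only [map_ofNat] using mt (hV 2).1 h2
  have h2' : ringChar (ResidueField V) ≠ 2 := by
    intro h
    have h3 : ((2 : ℕ) : ResidueField V) = 0 := by rw [← h]; exact ringChar.Nat.cast_ringChar
    have h4 : IsLocalRing.residue V 2 = 0 := by rw [map_ofNat]; exact_mod_cast h3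
    rw [valuationSubring_residue_eq_zero_iff] at h4
    exact absurd h4 (not_lt.2 h2V.ge)
  obtain ⟨u', hu'⟩ := FiniteField.exists_nonsquare h2'
  obtain ⟨u, rfl⟩ := IsLocalRing.residue_surjective u'
  obtain ⟨i, hi⟩ := hi
  have hi1 : v i ^ 2 = 1 := by rw [← map_pow, sq, ← hi, Valuation.map_neg, map_one]
  have hiV : v i = 1 := by
    rcases lt_trichotomy (v i) 1 with h | h | h
    · exact absurd hi1 (pow_lt_one₀ zero_le h two_ne_zero).ne
    · exact h
    · exact absurd hi1 (one_lt_pow₀ h two_ne_zero).ne'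
  have key : ∀ y : F, v (y ^ 2 + u * 1) < 1 → False := by
    intro y hy
    have hyV : y ∈ V := by
      rw [← ValuationSubring.valuation_le_one_iff]
      by_contra h
      have h1 : 1 < v (y ^ 2) := by
        rw [map_pow]; exact one_lt_pow₀ (not_le.1 h) two_ne_zero
      have h2 : v ((u : F) * 1) ≤ 1 := by
        rw [mul_one]; exact (V.valuation_le_one_iff _).2 u.2
      rw [Valuation.map_add_eq_of_lt_left _ (h2.trans_lt h1)] at hy
      exact absurd h1 (not_lt.2 hy.le)
    have hiV' : i ∈ V := (V.valuation_le_one_iff _).1 hiV.le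
    let y' : V := ⟨y, hyV⟩
    let i' : V := ⟨i, hiV'⟩
    have h1 : IsLocalRing.residue V (y' ^ 2 + u) = 0 := by
      rw [valuationSubring_residue_eq_zero_iff]
      simpa [y'] using hy
    have h2 : i' * i' = -1 := Subtype.ext hi.symm
    apply hu'
    refine ⟨IsLocalRing.residue V (i' * y'), ?_⟩
    rw [map_add, add_comm, ← eq_neg_iff_add_eq_zero] at h1
    rw [h1, ← map_mul, ← map_neg]
    congr 1
    linear_combination (y' ^ 2) * (-h2)
  have hu0 : v (u : F) = 1 := by
    refine le_antisymm ((V.valuation_le_one_iff _).2 u.2) (not_lt.1 fun h => key 0 ?_)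
    simpa using h
  have husq : ¬ IsSquare (u : F) := by
    rintro ⟨z, hz⟩
    refine key (i * z) ?_
    rw [show (i * z) ^ 2 + (u : F) * 1 = 0 by rw [hz]; linear_combination -z ^ 2 * hi]
    simp
  obtain ⟨a, b, hab⟩ := huniv u x husq
  have hub : v (u * b ^ 2) = v b ^ 2 := by rw [map_mul, hu0, one_mul, map_pow]
  rcases lt_trichotomy (v (a ^ 2)) (v (u * b ^ 2)) with h | h | h
  · exact hx b (by rw [hab, Valuation.map_add_eq_of_lt_right _ h, hub])
  · by_cases hb0 : b = 0
    · rw [hb0] at hab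
      exact hx a (by rw [hab]; simp)
    have h3 : x = b ^ 2 * ((a / b) ^ 2 + u * 1) := by rw [hab]; field_simp
    have h4 : v ((a / b) ^ 2 + u * 1) = 1 := by
      refine le_antisymm ?_ (not_lt.1 (key _))
      refine (v.map_add _ _).trans (max_le ?_ (by simp [hu0]))
      rw [div_pow, map_div₀, h, hub, map_pow,
        div_self (pow_ne_zero _ ((Valuation.ne_zero_iff v).2 hb0))]
    exact hx b (by rw [h3, map_mul, h4, mul_one, map_pow])
  · exact hx a (by rw [hab, Valuation.map_add_eq_of_lt_left _ h, map_pow])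

end Nonuniversal

section Conic

lemma eq_zero_of_sq_mul_eq {c q : ℚ} (hc : c ≠ 0) (hq : q ≠ 0) {A B : Polynomial ℚ}
    (h : Polynomial.C q * A ^ 2 = (1 - Polynomial.C c * Polynomial.X ^ 2) * B ^ 2) :
    A = 0 ∧ B = 0 := by
  set r : Polynomial ℚ := 1 - Polynomial.C c * Polynomial.X ^ 2 with hr
  by_cases hB : B = 0
  · subst hB
    simpa [hq] using h
  exfalso
  have hrsep : r.Separable := by
    refine ⟨1, -Polynomial.C (1 / 2) * Polynomial.X, ?_⟩
    rw [hr]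
    have h2 : Polynomial.C (1 / 2 : ℚ) * 2 = 1 := by
      rw [← map_ofNat Polynomial.C 2, ← map_mul]; norm_num
    simp only [Polynomial.derivative_sub, Polynomial.derivative_one, Polynomial.derivative_mul,
      Polynomial.derivative_C, Polynomial.derivative_X_pow]
    simp only [Nat.cast_ofNat, map_ofNat, Nat.add_one_sub_one, pow_one]
    linear_combination (Polynomial.C c * Polynomial.X ^ 2) * h2
  have hdeg : r.degree ≠ 0 := by
    have : r.natDegree = 2 := by rw [hr]; compute_degree!
    intro h
    simp [Polynomial.natDegree_eq_of_degree_eq_some h] at this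
  let φ := algebraMap ℚ (AlgebraicClosure ℚ)
  obtain ⟨z, hz⟩ := IsAlgClosed.exists_root (r.map φ) (by rwa [Polynomial.degree_map])
  have hr0 : r.map φ ≠ 0 := (hrsep.map).ne_zero
  have hA : A ≠ 0 := by
    rintro rfl
    have : r ≠ 0 := hrsep.ne_zero
    simp [this, hB] at h
  have hA' : A.map φ ≠ 0 := (Polynomial.map_ne_zero_iff φ.injective).2 hA
  have hB' : B.map φ ≠ 0 := (Polynomial.map_ne_zero_iff φ.injective).2 hB
  have h1 : (r.map φ).rootMultiplicity z = 1 :=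
    le_antisymm (Polynomial.rootMultiplicity_le_one_of_separable hrsep.map z)
      ((Polynomial.rootMultiplicity_pos hr0).2 hz)
  have h2 := congrArg (fun p => (p.map φ).rootMultiplicity z) h
  simp only [Polynomial.map_mul, Polynomial.map_pow, Polynomial.map_C] at h2
  have hC : Polynomial.C (φ q) ≠ 0 := by simpa using hq
  rw [Polynomial.rootMultiplicity_mul (mul_ne_zero hC (pow_ne_zero 2 hA')),
    Polynomial.rootMultiplicity_mul (mul_ne_zero hr0 (pow_ne_zero 2 hB')), sq, sq,
    Polynomial.rootMultiplicity_mul (mul_ne_zero hA' hA'),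
    Polynomial.rootMultiplicity_mul (mul_ne_zero hB' hB'), h1,
    Polynomial.rootMultiplicity_C] at h2
  omega

namespace ConicRing

variable (c d : ℚ)

/-- The first coordinate function. -/
def x : ConicRing ℚ c d := Ideal.Quotient.mk _ (X 0)

/-- The second coordinate function. -/
def y : ConicRing ℚ c d := Ideal.Quotient.mk _ (X 1)

variable {c d}

lemma exists_normal_form (hd : d ≠ 0) (p : ConicRing ℚ c d) : ∃ A B : Polynomial ℚ,
    p = Polynomial.aeval (x c d) A + Polynomial.aeval (x c d) B * y c d := by
  have hrel : algebraMap ℚ (ConicRing ℚ c d) c * x c d ^ 2 + algebraMap ℚ _ d * y c d ^ 2 = 1 := by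
    rw [← sub_eq_zero]
    exact Ideal.Quotient.eq_zero_iff_mem.2 (Ideal.mem_span_singleton_self _)
  have hy : y c d ^ 2 = algebraMap ℚ _ d⁻¹ * (1 - algebraMap ℚ _ c * x c d ^ 2) := by
    have h1 : algebraMap ℚ (ConicRing ℚ c d) d⁻¹ * algebraMap ℚ _ d = 1 := by
      rw [← map_mul, inv_mul_cancel₀ hd, map_one]
    linear_combination algebraMap ℚ _ d⁻¹ * hrel - y c d ^ 2 * h1
  obtain ⟨p, rfl⟩ := Ideal.Quotient.mk_surjective p
  induction p using MvPolynomial.induction_on with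
  | C a => exact ⟨Polynomial.C a, 0, by simp; rfl⟩
  | add p q hp hq =>
    obtain ⟨A, B, h⟩ := hp
    obtain ⟨A', B', h'⟩ := hq
    exact ⟨A + A', B + B', by rw [map_add, h, h']; simp; ring⟩
  | mul_X p i hp =>
    obtain ⟨A, B, h⟩ := hp
    fin_cases i
    · exact ⟨A * Polynomial.X, B * Polynomial.X, by
        rw [map_mul, h]
        change _ * x c d = _
        simp; ring⟩
    · refine ⟨B * (Polynomial.C d⁻¹ * (1 - Polynomial.C c * Polynomial.X ^ 2)), A, ?_⟩
      rw [map_mul, h]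
      change _ * y c d = _
      simp only [map_mul, map_sub, map_one, map_pow, Polynomial.aeval_C, Polynomial.aeval_X]
      linear_combination (Polynomial.aeval (x c d) B) * hy

variable {M : Type*} [Field M] [CharZero M]

lemma eq_zero_of_eval (hc : c ≠ 0) (hd : d ≠ 0) {x' y' : M} (h : (c : M) * x' ^ 2 + d * y' ^ 2 = 1)
    (ht : Transcendental ℚ x') {A B : Polynomial ℚ}
    (h0 : Polynomial.aeval x' A + Polynomial.aeval x' B * y' = 0) : A = 0 ∧ B = 0 := by
  apply eq_zero_of_sq_mul_eq hc hd
  have h1 : Polynomial.aeval x' (Polynomial.C d * A ^ 2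
      - (1 - Polynomial.C c * Polynomial.X ^ 2) * B ^ 2) = 0 := by
    simp only [map_mul, map_sub, map_one, map_pow, Polynomial.aeval_C, Polynomial.aeval_X,
      eq_ratCast]
    linear_combination (d : M) * (Polynomial.aeval x' A - Polynomial.aeval x' B * y') * h0 +
      Polynomial.aeval x' B ^ 2 * h
  exact sub_eq_zero.1 ((transcendental_iff.1 ht) _ h1)

lemma exists_hom (hc : c ≠ 0) (hd : d ≠ 0) {x' y' : M} (h : (c : M) * x' ^ 2 + d * y' ^ 2 = 1)
    (ht : Transcendental ℚ x') :
    ∃ j : ConicRing ℚ c d →+* M, Function.Injective j ∧ j (x c d) = x' ∧ j (y c d) = y' := by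
  let j0 : MvPolynomial (Fin 2) ℚ →+* M := (MvPolynomial.aeval ![x', y']).toRingHom
  have hj0 : ∀ p ∈ Ideal.span {conicPoly ℚ c d}, j0 p = 0 := by
    intro p hp
    obtain ⟨q, rfl⟩ := Ideal.mem_span_singleton.1 hp
    rw [map_mul]
    have : j0 (conicPoly ℚ c d) = 0 := by
      simp [j0, conicPoly, h]
    rw [this, zero_mul]
  let j := Ideal.Quotient.lift _ j0 hj0
  have hx : j (x c d) = x' := by
    change j0 (X 0) = x'
    simp [j0]
  have hy : j (y c d) = y' := by
    change j0 (X 1) = y'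
    simp [j0]
  refine ⟨j, ?_, hx, hy⟩
  rw [injective_iff_map_eq_zero]
  intro p hp
  obtain ⟨A, B, rfl⟩ := exists_normal_form hd p
  have hA : ∀ A : Polynomial ℚ, j (Polynomial.aeval (x c d) A) = Polynomial.aeval x' A := by
    intro A
    rw [← hx]
    exact (Polynomial.aeval_algHom_apply j.toRatAlgHom _ _).symm
  rw [map_add, map_mul, hA, hA, hy] at hp
  obtain ⟨rfl, rfl⟩ := eq_zero_of_eval hc hd h ht hp
  simp

end ConicRing

/-- `L` is a function field of the conic `c x² + d y² = 1` with coordinates `x`, `y`. -/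
structure IsConic (c d : ℚ) {L : Type*} [Field L] [CharZero L] (x y : L) : Prop where
  ne_zero_left : c ≠ 0
  ne_zero_right : d ≠ 0
  eq_one : (c : L) * x ^ 2 + d * y ^ 2 = 1
  transcendental : Transcendental ℚ x
  exists_div : ∀ z : L, ∃ A B A' B' : Polynomial ℚ,
    Polynomial.aeval x A' + Polynomial.aeval x B' * y ≠ 0 ∧
    z = (Polynomial.aeval x A + Polynomial.aeval x B * y) /
      (Polynomial.aeval x A' + Polynomial.aeval x B' * y)

lemma IsConicFunctionField.isConic {c d : ℚ} (hc : c ≠ 0) (hd : d ≠ 0) {L : Type*} [Field L]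
    [CharZero L] {ι : ℚ →+* L} (h : IsConicFunctionField ℚ c d L ι) :
    ∃ x y : L, IsConic c d x y := by
  obtain ⟨f, hf, -, hdiv⟩ := h
  have hA : ∀ A : Polynomial ℚ, f (Polynomial.aeval (ConicRing.x c d) A) =
      Polynomial.aeval (f (ConicRing.x c d)) A := fun A =>
    (Polynomial.aeval_algHom_apply f.toRatAlgHom _ _).symm
  have hnf : ∀ p, ∃ A B : Polynomial ℚ, f p = Polynomial.aeval (f (ConicRing.x c d)) A +
      Polynomial.aeval (f (ConicRing.x c d)) B * f (ConicRing.y c d) := by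
    intro p
    obtain ⟨A, B, h⟩ := ConicRing.exists_normal_form hd p
    exact ⟨A, B, by rw [← hA, ← hA, ← map_mul, ← map_add, ← h]⟩
  refine ⟨f (ConicRing.x c d), f (ConicRing.y c d), hc, hd, ?_, ?_, fun z => ?_⟩
  · have hrel : algebraMap ℚ (ConicRing ℚ c d) c * ConicRing.x c d ^ 2 +
        algebraMap ℚ _ d * ConicRing.y c d ^ 2 = 1 := by
      rw [← sub_eq_zero]
      exact Ideal.Quotient.eq_zero_iff_mem.2 (Ideal.mem_span_singleton_self _)
    have hq : ∀ q : ℚ, f (algebraMap ℚ _ q) = q := fun q =>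
      eq_ratCast (f.comp (algebraMap ℚ (ConicRing ℚ c d))) q
    have := congrArg f hrel
    simpa only [map_add, map_mul, map_pow, map_one, hq] using this
  · let M := AlgebraicClosure (RatFunc ℚ)
    let t : M := algebraMap (RatFunc ℚ) M RatFunc.X
    obtain ⟨s, hs⟩ := IsAlgClosed.exists_pow_nat_eq ((d : M)⁻¹ * (1 - c * t ^ 2)) (n := 2) (by simp)
    have ht : Transcendental ℚ t := by
      rw [transcendental_iff]
      intro p hp
      have h1 : algebraMap (RatFunc ℚ) M (Polynomial.aeval RatFunc.X p) = 0 := by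
        rw [← hp]
        exact (Polynomial.aeval_algHom_apply (algebraMap (RatFunc ℚ) M).toRatAlgHom _ _).symm
      have hX : @Transcendental ℚ (RatFunc ℚ) _ _ DivisionRing.toRatAlgebra RatFunc.X := by
        convert RatFunc.transcendental_X (K := ℚ)
        exact Subsingleton.elim _ _
      exact (@transcendental_iff _ _ _ _ DivisionRing.toRatAlgebra _).1 hX p ((map_eq_zero _).1 h1)
    have hd' : (d : M) ≠ 0 := by exact_mod_cast hd
    obtain ⟨j, hj, hjx, hjy⟩ := ConicRing.exists_hom (M := M) hc hd (x' := t) (y' := s)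
      (by rw [hs, mul_inv_cancel_left₀ hd']; ring) ht
    rw [transcendental_iff]
    intro p hp
    rw [← hA, map_eq_zero_iff f hf] at hp
    have := congrArg j hp
    rw [map_zero, show j (Polynomial.aeval (ConicRing.x c d) p) =
      Polynomial.aeval (j (ConicRing.x c d)) p from
      (Polynomial.aeval_algHom_apply j.toRatAlgHom _ _).symm, hjx] at this
    exact transcendental_iff.1 ht p this
  · obtain ⟨p, q, hq, rfl⟩ := hdiv z
    obtain ⟨A, B, h1⟩ := hnf p
    obtain ⟨A', B', h2⟩ := hnf q
    exact ⟨A, B, A', B', h2 ▸ hq, by rw [h1, h2]⟩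

namespace IsConic

variable {c d : ℚ} {L : Type*} [Field L] [CharZero L] {x y : L}

lemma exists_ringHom (h : IsConic c d x y) {M : Type*} [Field M] [CharZero M] {x' y' : M}
    (h1 : (c : M) * x' ^ 2 + d * y' ^ 2 = 1) (ht : Transcendental ℚ x') :
    ∃ j : L →+* M, j x = x' ∧ j y = y' := by
  obtain ⟨i, hi, hix, hiy⟩ := ConicRing.exists_hom h.ne_zero_left h.ne_zero_right h.eq_one
    h.transcendental
  obtain ⟨j, hj, hjx, hjy⟩ := ConicRing.exists_hom h.ne_zero_left h.ne_zero_right h1 ht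
  have hA : ∀ A : Polynomial ℚ, i (Polynomial.aeval (ConicRing.x c d) A) =
      Polynomial.aeval x A := fun A => by
    rw [← hix]; exact (Polynomial.aeval_algHom_apply i.toRatAlgHom _ _).symm
  let : Algebra (ConicRing ℚ c d) L := i.toAlgebra
  have : FaithfulSMul (ConicRing ℚ c d) L := (faithfulSMul_iff_algebraMap_injective _ _).2 hi
  have : IsFractionRing (ConicRing ℚ c d) L := by
    refine IsFractionRing.of_field _ _ fun z => ?_
    obtain ⟨A, B, A', B', -, rfl⟩ := h.exists_div z
    refine ⟨Polynomial.aeval (ConicRing.x c d) A + Polynomial.aeval (ConicRing.x c d) B *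
      ConicRing.y c d, Polynomial.aeval (ConicRing.x c d) A' +
      Polynomial.aeval (ConicRing.x c d) B' * ConicRing.y c d, ?_⟩
    change _ = i _ / i _
    simp only [map_add, map_mul, hA, hiy]
  refine ⟨IsFractionRing.lift hj, ?_, ?_⟩
  · rw [← hix, ← hjx]; exact IsFractionRing.lift_algebraMap hj _
  · rw [← hiy, ← hjy]; exact IsFractionRing.lift_algebraMap hj _

end IsConic
end Conic

namespace IsConic

variable {c d : ℚ} {L : Type*} [Field L] [CharZero L] {x y : L}

/-- The structure of an algebra over `R[X]` given by evaluation at `t`. -/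
abbrev _root_.evalAlgebra {L : Type*} [Field L] (t : L) :
    Algebra (Polynomial ℤ) L := (Polynomial.eval₂RingHom (Int.castRingHom L) t).toAlgebra

lemma isAlgebraic_of_mem (h : IsConic c d x y) {R : Type*} [CommRing R] [IsDomain R] [Algebra R L]
    (hx : IsAlgebraic R x) : Algebra.IsAlgebraic R L := by
  have hZ : ∀ n : ℤ, IsAlgebraic R (n : L) := fun n => by
    rw [← map_intCast (algebraMap R L)]; exact isAlgebraic_algebraMap _
  have hQ : ∀ q : ℚ, IsAlgebraic R (q : L) := fun q => by
    rw [Rat.cast_def, div_eq_mul_inv]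
    exact (hZ _).mul (IsAlgebraic.inv (by exact_mod_cast hZ q.den))
  have hA : ∀ A : Polynomial ℚ, IsAlgebraic R (Polynomial.aeval x A) := by
    intro A
    induction A using Polynomial.induction_on with
    | C a => simpa using hQ a
    | add p q hp hq => rw [map_add]; exact hp.add hq
    | monomial n a hn => 
      rw [map_mul, map_pow, Polynomial.aeval_X, Polynomial.aeval_C, eq_ratCast]
      exact (hQ a).mul (hx.pow _)
  have hy : IsAlgebraic R y := by
    refine IsAlgebraic.of_pow (n := 2) (by simp) ?_
    have hd : (d : L) ≠ 0 := by exact_mod_cast h.ne_zero_right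
    have : y ^ 2 = (1 - c * x ^ 2) * (d : L)⁻¹ := by
      field_simp
      linear_combination h.eq_one
    rw [this]
    exact (isAlgebraic_one.sub ((hQ c).mul (hx.pow 2))).mul (hQ d).inv
  refine ⟨fun z => ?_⟩
  obtain ⟨A, B, A', B', -, rfl⟩ := h.exists_div z
  rw [div_eq_mul_inv]
  exact ((hA _).add ((hA _).mul hy)).mul ((hA _).add ((hA _).mul hy)).inv

lemma isAlgebraic_of_transcendental (h : IsConic c d x y) {t : L} (ht : Transcendental ℤ t) :
    letI := evalAlgebra t
    Algebra.IsAlgebraic (Polynomial ℤ) L := by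
  let := evalAlgebra t
  let S := Algebra.adjoin ℤ ({x} : Set L)
  have h1 : Algebra.IsAlgebraic S L :=
    h.isAlgebraic_of_mem (isAlgebraic_algebraMap (⟨x, Algebra.subset_adjoin rfl⟩ : S))
  have h2 : Algebra.trdeg ℤ L ≤ 1 := by
    simpa using Algebra.IsAlgebraic.trdeg_le_cardinalMk (R := ℤ) (s := ({x} : Set L))
  have hind : AlgebraicIndependent ℤ (fun _ : Unit => t) :=
    (algebraicIndependent_unique_type_iff).2 ht
  have h3 := (AlgebraicIndependent.isTranscendenceBasis_of_lift_trdeg_le_of_finite hind (by simpa using h2)).isAlgebraic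
  rw [Set.range_const, Algebra.adjoin_singleton_eq_range_aeval] at h3
  exact Algebra.IsAlgebraic.of_ringHom_of_comp_eq
    (Polynomial.aeval (R := ℤ) t).rangeRestrict.toRingHom (RingHom.id L)
    (Polynomial.aeval (R := ℤ) t).rangeRestrict_surjective Function.injective_id rfl

lemma bddRank (h : IsConic c d x y) {t : L} (ht : Transcendental ℤ t) :
    letI := evalAlgebra t
    BddRank (Polynomial ℤ) L := by
  let := evalAlgebra t
  have hinj : Function.Injective (algebraMap (Polynomial ℤ) L) := transcendental_iff_injective.1 ht
  have : FaithfulSMul (Polynomial ℤ) L := (faithfulSMul_iff_algebraMap_injective _ _).2 hinj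
  have := h.isAlgebraic_of_transcendental ht
  let Q := FractionRing (Polynomial ℤ)
  let : Algebra Q L := FractionRing.liftAlgebra _ _
  have : IsScalarTower (Polynomial ℤ) Q L := FractionRing.isScalarTower_liftAlgebra _ _
  have : Algebra.IsAlgebraic Q L := Algebra.IsAlgebraic.extendScalars (R := Polynomial ℤ)
    (IsFractionRing.injective _ _)
  have htop : IntermediateField.adjoin Q {x, y} = ⊤ := by
    rw [eq_top_iff]
    rintro z -
    obtain ⟨A, B, A', B', -, rfl⟩ := h.exists_div z
    have hx : x ∈ IntermediateField.adjoin Q {x, y} := IntermediateField.subset_adjoin _ _ (by simp)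
    have hy : y ∈ IntermediateField.adjoin Q {x, y} := IntermediateField.subset_adjoin _ _ (by simp)
    have hA : ∀ A : Polynomial ℚ, Polynomial.aeval x A ∈ IntermediateField.adjoin Q {x, y} := by
      intro A
      induction A using Polynomial.induction_on with
      | C a => simp
      | add p q hp hq => rw [map_add]; exact add_mem hp hq
      | monomial n a hn =>
        rw [map_mul, map_pow, Polynomial.aeval_X, Polynomial.aeval_C, eq_ratCast]
        exact mul_mem (SubfieldClass.ratCast_mem _ _) (pow_mem hx _)
    exact div_mem (add_mem (hA _) (mul_mem (hA _) hy)) (add_mem (hA _) (mul_mem (hA _) hy))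
  have hfin : FiniteDimensional Q L := by
    have : FiniteDimensional Q (IntermediateField.adjoin Q {x, y}) :=
      IntermediateField.finiteDimensional_adjoin fun z _ =>
        (Algebra.IsAlgebraic.isAlgebraic z).isIntegral
    rw [htop] at this
    exact Module.Finite.equiv IntermediateField.topEquiv.toLinearEquiv
  refine ⟨Module.finrank Q L + 1, fun v hv => ?_⟩
  rw [LinearIndependent.iff_fractionRing (Polynomial ℤ) Q] at hv
  have := hv.fintype_card_le_finrank
  simp at this

end IsConic

section CharTwo

lemma sum_range_two_mul {M : Type*} [AddCommMonoid M] (f : ℕ → M) (n : ℕ) :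
    ∑ i ∈ Finset.range (2 * n), f i =
      ∑ i ∈ Finset.range n, f (2 * i) + ∑ i ∈ Finset.range n, f (2 * i + 1) := by
  induction n with
  | zero => simp
  | succ n ih =>
    rw [show 2 * (n + 1) = 2 * n + 1 + 1 by ring, Finset.sum_range_succ, Finset.sum_range_succ, ih,
      Finset.sum_range_succ, Finset.sum_range_succ]
    abel

variable {κ : Type*} [Field κ] [CharP κ 2] {a b : κ}

lemma eq_zero_of_charTwo (ha : ¬ IsSquare a) (hb : ∀ p q, b ≠ p ^ 2 + a * q ^ 2) {x₀ x₁ y₀ y₁ : κ}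
    (h : x₀ ^ 2 + a * x₁ ^ 2 + b * (y₀ ^ 2 + a * y₁ ^ 2) = 0) :
    x₀ = 0 ∧ x₁ = 0 ∧ y₀ = 0 ∧ y₁ = 0 := by
  have key : ∀ {u₀ u₁ : κ}, u₀ ^ 2 + a * u₁ ^ 2 = 0 → u₀ = 0 ∧ u₁ = 0 := by
    intro u₀ u₁ hu
    by_cases h1 : u₁ = 0
    · subst h1; simpa using hu
    · refine absurd ⟨u₀ / u₁, ?_⟩ ha
      field_simp
      rw [← CharTwo.neg_eq (a * u₁ ^ 2)]
      linear_combination -hu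
  by_cases hy : y₀ ^ 2 + a * y₁ ^ 2 = 0
  · rw [hy, mul_zero, add_zero] at h
    exact ⟨(key h).1, (key h).2, (key hy).1, (key hy).2⟩
  · exfalso
    set D := y₀ ^ 2 + a * y₁ ^ 2 with hD
    refine hb ((x₀ * y₀ + a * x₁ * y₁) / D) ((x₀ * y₁ + x₁ * y₀) / D) ?_
    have h2 : (2 : κ) = 0 := CharTwo.two_eq_zero
    field_simp
    rw [← sub_eq_zero, ← neg_eq_zero]
    have h3 : b * D = - (x₀ ^ 2 + a * x₁ ^ 2) := by linear_combination h
    linear_combination (-D) * h3 + D * (x₀ ^ 2 + a * x₁ ^ 2) * h2 +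
      (x₀ * y₀ * a * x₁ * y₁ * 2 ) * h2 - (x₀ ^ 2 + a * x₁ ^ 2) * hD

lemma monomials_independent (ha : ¬ IsSquare a) (hb : ∀ p q, b ≠ p ^ 2 + a * q ^ 2) (n : ℕ) :
    ∀ c : ℕ → ℕ → κ, ∑ j ∈ Finset.range (2 ^ n), ∑ i ∈ Finset.range (2 ^ n),
      c i j ^ 2 ^ n * a ^ i * b ^ j = 0 → ∀ i < 2 ^ n, ∀ j < 2 ^ n, c i j = 0 := by
  induction n with
  | zero => intro c hc i hi j hj; simp at hc hi hj; rw [hi, hj, hc]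
  | succ n ih =>
    intro c hc
    have hsq : ∀ ε δ, ∑ j ∈ Finset.range (2 ^ n), ∑ i ∈ Finset.range (2 ^ n),
        c (2 * i + ε) (2 * j + δ) ^ 2 ^ (n + 1) * a ^ (2 * i + ε) * b ^ (2 * j + δ) =
        a ^ ε * b ^ δ * (∑ j ∈ Finset.range (2 ^ n), ∑ i ∈ Finset.range (2 ^ n),
          c (2 * i + ε) (2 * j + δ) ^ 2 ^ n * a ^ i * b ^ j) ^ 2 := by
      intro ε δ
      rw [sum_pow_char 2, Finset.mul_sum]
      refine Finset.sum_congr rfl fun j _ => ?_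
      rw [sum_pow_char 2, Finset.mul_sum]
      refine Finset.sum_congr rfl fun i _ => ?_
      ring
    have h00 := hsq 0 0
    have h01 := hsq 0 1
    have h10 := hsq 1 0
    have h11 := hsq 1 1
    simp only [pow_zero, one_mul, mul_one, pow_one, add_zero] at h00 h01 h10 h11
    rw [pow_succ 2 n, mul_comm (2 ^ n) 2, sum_range_two_mul] at hc
    simp only [sum_range_two_mul, Finset.sum_add_distrib] at hc
    rw [← pow_succ' 2 n, h00, h01, h10, h11] at hc
    have key : ∀ s₀ s₁ s₂ s₃ : κ, s₀ ^ 2 + a * s₁ ^ 2 + (b * s₂ ^ 2 + a * b * s₃ ^ 2) = 0 →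
        s₀ = 0 ∧ s₁ = 0 ∧ s₂ = 0 ∧ s₃ = 0 := fun s₀ s₁ s₂ s₃ hs =>
      eq_zero_of_charTwo ha hb (by linear_combination hs)
    obtain ⟨e1, e2, e3, e4⟩ := key _ _ _ _ hc
    have f1 := ih (fun i j => c (2 * i) (2 * j)) e1
    have f2 := ih (fun i j => c (2 * i + 1) (2 * j)) e2
    have f3 := ih (fun i j => c (2 * i) (2 * j + 1)) e3
    have f4 := ih (fun i j => c (2 * i + 1) (2 * j + 1)) e4
    intro i hi j hj
    rw [pow_succ] at hi hj
    obtain ⟨i', rfl | rfl⟩ := Nat.even_or_odd' i <;> obtain ⟨j', rfl | rfl⟩ := Nat.even_or_odd' j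
    · exact f1 i' (by omega) j' (by omega)
    · exact f3 i' (by omega) j' (by omega)
    · exact f2 i' (by omega) j' (by omega)
    · exact f4 i' (by omega) j' (by omega)

lemma two_dvd_of_sum_eval_eq_zero (ha : ¬ IsSquare a) (hb : ∀ p q, b ≠ p ^ 2 + a * q ^ 2) {N : ℕ}
    (P : Fin N → Polynomial ℤ)
    (h : ∑ j, (P j).eval₂ (Int.castRingHom κ) a * b ^ (j : ℕ) = 0) (j : Fin N) :
    Polynomial.C 2 ∣ P j := by
  rw [Polynomial.C_dvd_iff_dvd_coeff]
  intro i
  obtain ⟨D, hD⟩ : ∃ D, ∀ j, (P j).natDegree < D := by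
    obtain ⟨D, hD⟩ := (Finset.univ.image fun j => (P j).natDegree).exists_nat_subset_range
    exact ⟨D, fun j => by simpa using hD (Finset.mem_image_of_mem _ (Finset.mem_univ j))⟩
  set n := N + D + i
  have hn : n < 2 ^ n := Nat.lt_two_pow_self
  set c : ℕ → ℕ → κ := fun i j => if hj : j < N then ((P ⟨j, hj⟩).coeff i : κ) else 0 with hc
  have hpow : ∀ i j, c i j ^ 2 ^ n = c i j := by
    intro i j
    have h2 : (2 : κ) = 0 := CharTwo.two_eq_zero
    have hz : ∀ z : ℤ, (z : κ) ^ 2 ^ n = z := by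
      intro z
      obtain ⟨w, rfl | rfl⟩ := Int.even_or_odd' z <;> simp [h2]
    simp only [hc]
    split_ifs
    · exact hz _
    · simp
  have := monomials_independent ha hb n c (by
    simp only [hpow]
    rw [← h, Finset.sum_fin_eq_sum_range,
      ← Finset.sum_subset (Finset.range_subset_range.2 (show N ≤ 2 ^ n by omega))]
    · refine Finset.sum_congr rfl fun j hj => ?_
      have hj' := Finset.mem_range.1 hj
      rw [dif_pos hj', Polynomial.eval₂_eq_sum_range' (n := 2 ^ n) _
        (by have := hD ⟨j, hj'⟩; omega), Finset.sum_mul]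
      simp [hc, hj']
    · intro j _ hj
      have hj' := mt Finset.mem_range.2 hj
      simp [hc, hj']) i (by omega) j (by omega)
  simp only [hc, j.2, dif_pos] at this
  rwa [CharP.intCast_eq_zero_iff κ 2] at this

end CharTwo

lemma transcendental_of_residue {K : Type*} [Field K] [CharZero K] {O : ValuationSubring K} (t : O)
    {π : Polynomial ℤ} (hπ : ¬ IsUnit π) (hπ0 : Polynomial.aeval (t : K) π ≠ 0)
    (h : ∀ P : Polynomial ℤ, P.eval₂ (Int.castRingHom _) (IsLocalRing.residue O t) = 0 → π ∣ P) :
    Transcendental ℤ (t : K) := by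
  rw [transcendental_iff]
  intro P hP
  let := evalAlgebra (t : K)
  have h1 : LinearIndependent (Polynomial ℤ) (fun _ : Unit => (1 : K)) := by
    refine linearIndependent_of_dvd hπ (fun m hm => ?_) fun c hc i => h _ ?_
    · exact (mul_eq_zero.1 (show Polynomial.aeval (t : K) π * m = 0 from hm)).resolve_left hπ0
    · have h2 : Polynomial.aeval (t : K) (c ()) * 1 = 0 := by
        rw [← hc, Fintype.sum_unique]; rfl
      have h3 : Polynomial.aeval t (c ()) = 0 := by
        apply Subtype.ext
        rw [mul_one] at h2
        rw [ZeroMemClass.coe_zero, ← h2]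
        exact (Polynomial.aeval_algHom_apply O.subtype.toIntAlgHom _ _).symm
      have h4 := congrArg (IsLocalRing.residue O) h3
      rw [map_zero] at h4
      rw [← h4]
      rw [Polynomial.aeval_def, Polynomial.hom_eval₂]
      congr 1
  rw [Fintype.linearIndependent_iff] at h1
  refine h1 (fun _ => P) ?_ ()
  simp only [Finset.univ_unique, Finset.sum_const, Finset.card_singleton, one_smul]
  exact (mul_one _).trans hP

lemma eq_one_of_sq_eq_one₀ {Γ : Type*} [LinearOrderedCommGroupWithZero Γ] {g : Γ} (h : g ^ 2 = 1) :
    g = 1 :=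
  (pow_left_inj₀ zero_le zero_le two_ne_zero).1 (h.trans (one_pow 2).symm)

section OverTwo

variable {L Γ : Type*} [Field L] [CharZero L] [LinearOrderedCommGroupWithZero Γ]

lemma IsConic.universal {c d : ℚ} {x y : L} (h : IsConic c d x y) {w : Valuation L Γ} (h2 : w 2 < 1)
    {a b : L} (ha : w a ≤ 1) (hb : w b ≤ 1) (hna : ∀ p, w p ≤ 1 → ¬ w (a - p ^ 2) < 1) :
    ∃ p q, w p ≤ 1 ∧ w q ≤ 1 ∧ w (b - (p ^ 2 + a * q ^ 2)) < 1 := by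
  set O := w.valuationSubring
  have hlt : ∀ z : L, O.valuation z < 1 ↔ w z < 1 :=
    fun z => ((Valuation.isEquiv_valuation_valuationSubring w).lt_one_iff_lt_one).symm
  have hres : ∀ z : O, IsLocalRing.residue O z = 0 ↔ w z < 1 := fun z => by
    rw [valuationSubring_residue_eq_zero_iff, hlt]
  have : CharP (IsLocalRing.ResidueField O) 2 := by
    refine CharTwo.of_one_ne_zero_of_two_eq_zero one_ne_zero ?_
    have := (hres 2).2 h2
    rwa [map_ofNat] at this
  let a' : O := ⟨a, ha⟩
  let b' : O := ⟨b, hb⟩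
  by_contra! hcon
  have hna' : ¬ IsSquare (IsLocalRing.residue O a') := by
    rintro ⟨p, hp⟩
    obtain ⟨p, rfl⟩ := IsLocalRing.residue_surjective p
    refine hna p p.2 ((hres (a' - p ^ 2)).1 ?_)
    rw [map_sub, hp, map_pow]; ring
  have hnb : ∀ p q, IsLocalRing.residue O b' ≠ p ^ 2 + IsLocalRing.residue O a' * q ^ 2 := by
    intro p q hp
    obtain ⟨p, rfl⟩ := IsLocalRing.residue_surjective p
    obtain ⟨q, rfl⟩ := IsLocalRing.residue_surjective q
    refine absurd ((hres (b' - (p ^ 2 + a' * q ^ 2))).1 ?_) (not_lt.2 (hcon p q p.2 q.2))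
    rw [map_sub, hp, map_add, map_mul, map_pow, map_pow]; ring
  have hC2 : ¬ IsUnit (Polynomial.C (2 : ℤ)) := by
    rw [Polynomial.isUnit_C, Int.isUnit_iff]; decide
  have hC2' : Polynomial.aeval a (Polynomial.C (2 : ℤ)) ≠ 0 := by
    rw [Polynomial.aeval_C]; norm_num
  have ht : Transcendental ℤ a := by
    refine transcendental_of_residue a' hC2 hC2' fun P hP => ?_
    refine two_dvd_of_sum_eval_eq_zero hna' hnb (N := 1) (fun _ => P) ?_ 0
    simpa using hP
  let := evalAlgebra a
  obtain ⟨n, hn⟩ := h.bddRank ht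
  refine hn (fun j => b ^ (j : ℕ)) (linearIndependent_of_dvd hC2 (fun m hm => ?_) fun P hP => ?_)
  · exact (mul_eq_zero.1 (show Polynomial.aeval a (Polynomial.C (2 : ℤ)) * m = 0 from hm)).resolve_left hC2'
  · refine two_dvd_of_sum_eval_eq_zero hna' hnb P ?_
    have h1 : ∑ j, (P j).eval₂ (Int.castRingHom O) a' * b' ^ (j : ℕ) = 0 := by
      apply Subtype.ext
      rw [ZeroMemClass.coe_zero, ← hP]
      push_cast
      refine Finset.sum_congr rfl fun j _ => ?_
      have : O.subtype ((P j).eval₂ (Int.castRingHom O) a') = (P j).eval₂ (Int.castRingHom L) a := by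
        rw [Polynomial.hom_eval₂]
        congr 1
      change O.subtype ((P j).eval₂ (Int.castRingHom O) a') * b ^ (j : ℕ) = _
      rw [this]
      rfl
    have h2 := congrArg (IsLocalRing.residue O) h1
    rw [map_sum, map_zero] at h2
    rw [← h2]
    refine Finset.sum_congr rfl fun j _ => ?_
    rw [map_mul, map_pow, Polynomial.hom_eval₂]
    congr 2

variable {K : Type*} [Field K] [CharZero K] {α : SqClass K ≃* SqClass L} {O : ValuationSubring K}
  {w : Valuation L Γ}

open IsLocalRing

omit [CharZero K] in
lemma residue_ne_zero {z : K} (hz : O.valuation z = 1) :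
    residue O ⟨z, (O.valuation_le_one_iff _).1 hz.le⟩ ≠ 0 := by
  rw [Ne, valuationSubring_residue_eq_zero_iff, hz]
  exact lt_irrefl _

omit [CharZero L] [CharZero K] in
/-- Units corresponding to principal classes have square residues. -/
lemma Matched.isSquare_residue (hm : Matched α O.valuation w) {z : K} {z' : L} (h : Corr α z z')
    (hz : O.valuation z = 1) (hz' : z' ∈ PrincipalClass w) :
    IsSquare (residue O ⟨z, (O.valuation_le_one_iff _).1 hz.le⟩) := by
  obtain ⟨m, u, hu, hmw, rfl⟩ := hz'
  obtain ⟨k, hk, hc⟩ := hm.exists_principal m hmw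
  obtain ⟨s, hs, rfl⟩ := (hc.mul_sq_right hu).symm.unique h.symm
  have h1 : O.valuation (1 + k) = 1 := O.valuation.map_one_add_of_lt hk
  have hs1 : O.valuation s = 1 := by
    rw [map_mul, h1, one_mul, map_pow] at hz
    exact eq_one_of_sq_eq_one₀ hz
  have hkO : k ∈ O := (O.valuation_le_one_iff _).1 hk.le
  have hsO : s ∈ O := (O.valuation_le_one_iff _).1 hs1.le
  refine ⟨residue O ⟨s, hsO⟩, ?_⟩
  rw [← sub_eq_zero, ← map_mul, ← map_sub, valuationSubring_residue_eq_zero_iff]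
  change O.valuation ((1 + k) * s ^ 2 - s * s) < 1
  rw [show (1 + k) * s ^ 2 - s * s = k * s ^ 2 by ring, map_mul, map_pow, hs1]
  simpa using hk

omit [CharZero L] [CharZero K] in
lemma Matched.principal_of_isSquare (hm : Matched α O.valuation w) {z : K} {z' : L}
    (h : Corr α z z') (hz : O.valuation z = 1)
    (hs : IsSquare (residue O ⟨z, (O.valuation_le_one_iff _).1 hz.le⟩)) :
    z' ∈ PrincipalClass w := by
  obtain ⟨s, hs⟩ := hs
  obtain ⟨s, rfl⟩ := residue_surjective s
  have hs0 : residue O s ≠ 0 := fun h0 => residue_ne_zero hz (by rw [hs, h0, zero_mul])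
  have hs1 : O.valuation (s : K) = 1 :=
    le_antisymm ((O.valuation_le_one_iff _).2 s.2)
      (not_lt.1 (mt (valuationSubring_residue_eq_zero_iff s).2 hs0))
  have hs2 : (s : K) ≠ 0 := fun h => by simp [h] at hs1
  rw [← sub_eq_zero, ← map_mul, ← map_sub, valuationSubring_residue_eq_zero_iff] at hs
  change O.valuation (z - s * s) < 1 at hs
  refine hm.principal ((z - s * s) / s ^ 2) z' ?_ ?_
  · rwa [map_div₀, map_pow, hs1, one_pow, div_one]
  · have := h.mul_sq_left (inv_ne_zero hs2)
    rwa [show z * (s : K)⁻¹ ^ 2 = 1 + (z - s * s) / s ^ 2 by field_simp; ring] at this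

lemma Matched.neg_one_principal (h2 : w 2 < 1) : (-1 : L) ∈ PrincipalClass w :=
  ⟨-2, 1, one_ne_zero, by rwa [Valuation.map_neg], by norm_num⟩

omit [CharZero K] in
lemma Matched.isSquare_neg_one (hα : IsWittEquiv α) (hm : Matched α O.valuation w) (h2 : w 2 < 1) :
    IsSquare (-1 : ResidueField O) := by
  have := hm.isSquare_residue (Corr.neg_one hα) (by simp) (Matched.neg_one_principal h2)
  rw [← map_one (residue O), ← map_neg]
  exact this

omit [CharZero L] [CharZero K] in
lemma exists_unit_corr {z : K} {z' : L} (h : Corr α z z') (hz : z' ∈ EvenClass w) :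
    ∃ z'', w z'' = 1 ∧ Corr α z z'' := by
  obtain ⟨h0, s, hs⟩ := hz
  have hs0 : s ≠ 0 := by rintro rfl; simp at hs; exact h0 hs
  have hs1 : w s ≠ 0 := w.ne_zero_iff.2 hs0
  refine ⟨z' * s⁻¹ ^ 2, ?_, h.mul_sq_right (inv_ne_zero hs0)⟩
  rw [map_mul, map_pow, map_inv₀, hs]
  field_simp

omit [CharZero K] in
lemma Matched.residue_universal (hα : IsWittEquiv α) (hm : Matched α O.valuation w) (h2 : w 2 < 1)
    {c d : ℚ} {x y : L} (hL : IsConic c d x y) (a b : ResidueField O) (ha : ¬ IsSquare a) :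
    ∃ p q, b = p ^ 2 + a * q ^ 2 := by
  by_cases hb0 : b = 0
  · exact ⟨0, 0, by simp [hb0]⟩
  have hi := hm.isSquare_neg_one hα h2
  have ha0 : a ≠ 0 := by rintro rfl; exact ha IsSquare.zero
  obtain ⟨a, rfl⟩ := residue_surjective a
  obtain ⟨b, rfl⟩ := residue_surjective b
  have hval : ∀ z : O, residue O z ≠ 0 → O.valuation (z : K) = 1 := fun z hz =>
    le_antisymm ((O.valuation_le_one_iff _).2 z.2)
      (not_lt.1 (mt (valuationSubring_residue_eq_zero_iff z).2 hz))
  have hva := hval a ha0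
  have hvb := hval b hb0
  have hne : ∀ z : O, O.valuation (z : K) = 1 → (z : K) ≠ 0 := fun z hz h => by simp [h] at hz
  obtain ⟨a₀, ca⟩ := Corr.exists_right (α := α) (hne a hva)
  obtain ⟨b₀, cb⟩ := Corr.exists_right (α := α) (hne b hvb)
  obtain ⟨a', ha', ca⟩ := exists_unit_corr ca (hm.even _ _ hva ca)
  obtain ⟨b', hb', cb⟩ := exists_unit_corr cb (hm.even _ _ hvb cb)
  have hpc : ∀ p, w p ≤ 1 → ¬ w (a' - p ^ 2) < 1 := by
    intro p hp hlt
    apply ha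
    refine hm.isSquare_residue ca hva ?_
    have hp1 : w p = 1 := by
      have h1 : w (p ^ 2) = 1 := by
        have h3 := w.map_sub_eq_of_lt_right (x := a' - p ^ 2) (y := a') (by rwa [ha'])
        rw [show a' - p ^ 2 - a' = - p ^ 2 by ring, Valuation.map_neg, ha'] at h3
        exact h3
      rw [map_pow] at h1
      exact eq_one_of_sq_eq_one₀ h1
    have hp0 : p ≠ 0 := by rintro rfl; simp at hp1
    refine ⟨(a' - p ^ 2) / p ^ 2, p, hp0, ?_, by field_simp; ring⟩
    rwa [map_div₀, map_pow, hp1, one_pow, div_one]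
  obtain ⟨p, q, hp, hq, hpq⟩ := hL.universal h2 ha'.le hb'.le hpc
  set e' := p ^ 2 + a' * q ^ 2 with he'
  have hwe : w e' = 1 := by
    have h3 := w.map_sub_eq_of_lt_right (x := b' - e') (y := b') (by rwa [hb'])
    rwa [show b' - e' - b' = - e' by ring, Valuation.map_neg, hb'] at h3
  have he0 : e' ≠ 0 := fun h => by simp [h] at hwe
  obtain ⟨k, hk, ck⟩ := hm.exists_principal ((b' - e') / e') (by rwa [map_div₀, hwe, div_one])
  obtain ⟨e, ce⟩ := Corr.exists_left (α := α) he0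
  obtain ⟨X, Y, hXY⟩ := Corr.represents hα.symm Corr.one_one ca.symm ce.symm
    ⟨p, q, by rw [he', one_mul]⟩
  have c1 := ce.mul ck
  rw [show e' * (1 + (b' - e') / e') = b' by field_simp; ring] at c1
  obtain ⟨z, hz, hbz⟩ := c1.symm.unique cb.symm
  set X' := X * z
  set Y' := Y * z
  have hb1 : (b : K) = (1 + k) * (X' ^ 2 + a * Y' ^ 2) := by rw [hbz, hXY]; ring
  have hk1 : O.valuation (1 + k) = 1 := O.valuation.map_one_add_of_lt hk
  have hv1 : O.valuation (X' ^ 2 + a * Y' ^ 2) = 1 := by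
    rw [hb1, map_mul, hk1, one_mul] at hvb; exact hvb
  have hYv : O.valuation (a * Y' ^ 2) = O.valuation Y' ^ 2 := by rw [map_mul, hva, one_mul, map_pow]
  have hbound : O.valuation X' ≤ 1 ∧ O.valuation Y' ≤ 1 := by
    rcases lt_trichotomy (O.valuation (X' ^ 2)) (O.valuation (a * Y' ^ 2)) with h | h | h
    · rw [Valuation.map_add_eq_of_lt_right _ h, hYv] at hv1
      rw [hYv, hv1, map_pow] at h
      exact ⟨((pow_lt_one_iff two_ne_zero).1 h).le, (eq_one_of_sq_eq_one₀ hv1).le⟩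
    · rw [hYv, map_pow] at h
      have hXY' : O.valuation X' = O.valuation Y' :=
        (pow_left_inj₀ zero_le zero_le two_ne_zero).1 h
      rw [hXY', and_self]
      by_contra hgt
      rw [not_le] at hgt
      have hY0 : O.valuation Y' ≠ 0 := (zero_lt_one.trans hgt).ne'
      have hY0' : Y' ≠ 0 := (Valuation.ne_zero_iff _).1 hY0
      have hsv : O.valuation (X' / Y') = 1 := by rw [map_div₀, hXY', div_self hY0]
      have hsO : X' / Y' ∈ O := (O.valuation_le_one_iff _).1 hsv.le
      have hr : residue O (⟨X' / Y', hsO⟩ ^ 2 + a) = 0 := by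
        rw [valuationSubring_residue_eq_zero_iff]
        change O.valuation ((X' / Y') ^ 2 + a) < 1
        rw [show (X' / Y') ^ 2 + (a : K) = (X' ^ 2 + a * Y' ^ 2) / Y' ^ 2 by field_simp, map_div₀,
          hv1, one_div, map_pow]
        exact inv_lt_one_of_one_lt₀ (one_lt_pow₀ hgt two_ne_zero)
      apply ha
      rw [map_add, map_pow, add_comm, ← eq_neg_iff_add_eq_zero, ← neg_one_mul] at hr
      rw [hr]
      exact hi.mul (IsSquare.sq _)
    · rw [Valuation.map_add_eq_of_lt_left _ h, map_pow] at hv1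
      rw [hYv, map_pow, hv1] at h
      exact ⟨(eq_one_of_sq_eq_one₀ hv1).le, ((pow_lt_one_iff two_ne_zero).1 h).le⟩
  have hXO : X' ∈ O := (O.valuation_le_one_iff _).1 hbound.1
  have hYO : Y' ∈ O := (O.valuation_le_one_iff _).1 hbound.2
  refine ⟨residue O ⟨X', hXO⟩, residue O ⟨Y', hYO⟩, ?_⟩
  rw [← sub_eq_zero, ← map_pow, ← map_pow, ← map_mul, ← map_add, ← map_sub,
    valuationSubring_residue_eq_zero_iff]
  change O.valuation ((b : K) - (X' ^ 2 + a * Y' ^ 2)) < 1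
  rw [hb1, show (1 + k) * (X' ^ 2 + a * Y' ^ 2) - (X' ^ 2 + a * Y' ^ 2) =
    k * (X' ^ 2 + a * Y' ^ 2) by ring, map_mul, hv1, mul_one]
  exact hk

end OverTwo

section OverTwoRes

open IsLocalRing

variable {K : Type*} [Field K] [CharZero K]

lemma IsConic.bddRank_residue {c d : ℚ} {x y : K} (h : IsConic c d x y) {O : ValuationSubring K}
    (t : O) {π : Polynomial ℤ} (hπ : ¬ IsUnit π) (hπ0 : Polynomial.aeval (t : K) π ≠ 0)
    {B : Type*} [CommRing B] [Algebra B (ResidueField O)]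
    (hinj : Function.Injective (algebraMap B (ResidueField O))) (g : Polynomial ℤ →+* B)
    (hker : ∀ P, g P = 0 → π ∣ P)
    (hcomp : ∀ P : Polynomial ℤ, algebraMap B (ResidueField O) (g P) =
      P.eval₂ (Int.castRingHom _) (residue O t)) : BddRank B (ResidueField O) := by
  have ht : Transcendental ℤ (t : K) := transcendental_of_residue t hπ hπ0 fun P hP =>
    hker P (hinj (by rw [hcomp, hP, map_zero]))
  let := evalAlgebra (t : K)
  have hmap : ∀ P : Polynomial ℤ, O.subtype (P.eval₂ (Int.castRingHom O) t) =
      algebraMap (Polynomial ℤ) K P := by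
    intro P
    rw [Polynomial.hom_eval₂]
    change _ = P.eval₂ (Int.castRingHom K) (t : K)
    congr 1
  have hA : ∀ P, algebraMap (Polynomial ℤ) K P ∈ O := fun P => by
    rw [← hmap]; exact Subtype.property _
  refine BddRank.residue O hA g hπ hπ0 hker (fun P => ?_) (h.bddRank ht)
  rw [hcomp, show (⟨algebraMap (Polynomial ℤ) K P, hA P⟩ : O) = P.eval₂ (Int.castRingHom O) t from
    Subtype.ext (hmap P).symm, Polynomial.hom_eval₂]
  congr 1

omit [CharZero K] in
lemma natCast_residue_eq_zero_iff {O : ValuationSubring K} (n : ℕ) :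
    (n : ResidueField O) = 0 ↔ O.valuation (n : K) < 1 := by
  rw [← map_natCast (residue O), valuationSubring_residue_eq_zero_iff]
  rfl

lemma not_finite_of_triple {F : Type*} [Field F] [Finite F] {h : F} (h0 : h ≠ 0) (h1 : 1 + h ≠ 0)
    (hs : ¬ IsSquare h) (hs1 : ¬ IsSquare (1 + h)) : IsSquare (h * (1 + h)) := by
  classical
  have := Fintype.ofFinite F
  rw [← quadraticChar_one_iff_isSquare (mul_ne_zero h0 h1), map_mul,
    quadraticChar_neg_one_iff_not_isSquare.2 hs, quadraticChar_neg_one_iff_not_isSquare.2 hs1]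
  norm_num

theorem Matched.two_lt {L Γ : Type*} [Field L] [CharZero L] [LinearOrderedCommGroupWithZero Γ]
    {α : SqClass K ≃* SqClass L} (hα : IsWittEquiv α) {O : ValuationSubring K} {w : Valuation L Γ}
    (hm : Matched α O.valuation w) {ϖ : L} (hw : IsUnif w ϖ) (h2 : w 2 < 1)
    {c d : ℚ} {x y : K} (hK : IsConic c d x y) {c' d' : ℚ} {x' y' : L} (hL : IsConic c' d' x' y') :
    O.valuation 2 < 1 := by
  have hle : ∀ n : ℕ, O.valuation (n : K) ≤ 1 := fun n =>
    (O.valuation_le_one_iff _).2 (natCast_mem O n)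
  by_contra hv2
  have hv2F : (2 : ResidueField O) ≠ 0 := by
    have := (natCast_residue_eq_zero_iff (O := O) 2).not.2 (by exact_mod_cast hv2)
    exact_mod_cast this
  have hi := hm.isSquare_neg_one hα h2
  have huniv := hm.residue_universal hα h2 hL
  obtain ⟨η, η', hη, hη1, cη, cη1, t1, t2, t3⟩ := hm.triple
  have hηO : η ∈ O := (O.valuation_le_one_iff _).1 hη.le
  set h : ResidueField O := residue O ⟨η, hηO⟩ with hh
  have h1 : 1 + h = residue O ⟨1 + η, (O.valuation_le_one_iff _).1 hη1.le⟩ := by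
    rw [← map_one (residue O), hh, ← map_add]; rfl
  have s1 : ¬ IsSquare h := fun hs => t1 <| by
    rw [← neg_one_mul]
    exact PrincipalClass.mul (Matched.neg_one_principal h2) (hm.principal_of_isSquare cη hη hs)
  have s2 : ¬ IsSquare (1 + h) := fun hs => t2 (hm.principal_of_isSquare cη1 hη1 (h1 ▸ hs))
  have s3 : ¬ IsSquare (h * (1 + h)) := fun hs => t3 <| by
    have hv : O.valuation (η * (1 + η)) = 1 := by rw [map_mul, hη, hη1, one_mul]
    refine hm.principal_of_isSquare (cη.mul cη1) hv ?_
    rw [h1, hh, ← map_mul] at hs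
    exact hs
  have n1 : h ≠ 0 := residue_ne_zero hη
  have n2 : 1 + h ≠ 0 := h1 ▸ residue_ne_zero hη1
  by_cases hchar : ∀ n : ℕ, n ≠ 0 → (n : ResidueField O) ≠ 0
  · obtain ⟨t, ht0, ht⟩ : ∃ t : K, t ≠ 0 ∧ O.valuation t < 1 := by
      obtain ⟨t, ct⟩ := Corr.exists_left (α := α) hw.ne_zero
      have htv : O.valuation t ≠ 1 := fun htv => hw.unif_notMem (hm.even _ _ htv ct)
      rcases lt_or_gt_of_ne htv with hlt | hgt
      · exact ⟨t, ct.ne_zero, hlt⟩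
      · exact ⟨t⁻¹, inv_ne_zero ct.ne_zero, by rw [map_inv₀]; exact inv_lt_one_of_one_lt₀ hgt⟩
    have htO : t ∈ O := (O.valuation_le_one_iff _).1 ht.le
    have hinj : Function.Injective (algebraMap ℤ (ResidueField O)) := by
      rw [injective_iff_map_eq_zero]
      intro n hn
      by_contra hn0
      refine hchar n.natAbs (Int.natAbs_ne_zero.2 hn0) ?_
      rcases Int.natAbs_eq n with h | h
      · rw [h] at hn; simpa using hn
      · rw [h] at hn; simpa using hn
    have hb : BddRank ℤ (ResidueField O) := by
      refine hK.bddRank_residue ⟨t, htO⟩ (π := Polynomial.X) Polynomial.not_isUnit_X (by simpa)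
        hinj Polynomial.constantCoeff (fun P hP => ?_) fun P => ?_
      · exact Polynomial.X_dvd_iff.2 hP
      · rw [(valuationSubring_residue_eq_zero_iff _).2 ht, Polynomial.eval₂_at_zero]
        rfl
    have hp3 : Prime (3 : ℤ) := Int.prime_three
    refine not_universal hinj hb (π := 3) (by norm_num) ?_ ?_ (by decide) hi huniv
    · exact PrincipalIdealRing.isMaximal_of_irreducible hp3.irreducible
    · exact Finite.of_equiv _ (Int.quotientSpanEquivZMod 3).symm.toEquiv
  · push Not at hchar
    obtain ⟨n, hn, hn0⟩ := hchar
    obtain ⟨ℓ, hℓ⟩ := CharP.exists (ResidueField O)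
    have hℓ0 : ℓ ≠ 0 := by
      rintro rfl
      exact hn (by simpa using (CharP.cast_eq_zero_iff (ResidueField O) 0 n).1 hn0)
    have hp : Fact ℓ.Prime := ⟨(CharP.char_is_prime_or_zero (ResidueField O) ℓ).resolve_right hℓ0⟩
    let := ZMod.algebra (ResidueField O) ℓ
    by_cases halg : IsAlgebraic (ZMod ℓ) h
    · let E := IntermediateField.adjoin (ZMod ℓ) {h}
      have : FiniteDimensional (ZMod ℓ) E :=
        IntermediateField.adjoin.finiteDimensional halg.isIntegral
      have : Finite E := Module.finite_of_finite (ZMod ℓ)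
      let e : E := ⟨h, IntermediateField.mem_adjoin_simple_self _ _⟩
      refine s3 ?_
      have := (not_finite_of_triple (h := e) (fun h0 => n1 (congrArg Subtype.val h0))
        (fun h0 => n2 (congrArg Subtype.val h0)) (fun hs => s1 (hs.map E.val))
        (fun hs => s2 (hs.map E.val))).map E.val
      exact this
    · let := (Polynomial.aeval (R := ZMod ℓ) h).toAlgebra
      have hinj : Function.Injective (algebraMap (Polynomial (ZMod ℓ)) (ResidueField O)) :=
        transcendental_iff_injective.1 halg
      have hb : BddRank (Polynomial (ZMod ℓ)) (ResidueField O) := by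
        refine hK.bddRank_residue ⟨η, hηO⟩ (π := Polynomial.C (ℓ : ℤ)) ?_ ?_ hinj
          (Polynomial.mapRingHom (Int.castRingHom (ZMod ℓ))) (fun P hP => ?_) fun P => ?_
        · rw [Polynomial.isUnit_C]
          exact (Nat.prime_iff_prime_int.1 hp.out).not_isUnit
        · rw [Polynomial.aeval_C]
          simpa using hℓ0
        · rw [Polynomial.C_dvd_iff_dvd_coeff]
          intro i
          have := congrArg (fun Q => Polynomial.coeff Q i) hP
          simpa [ZMod.intCast_zmod_eq_zero_iff_dvd] using this
        · change Polynomial.aeval h (P.map _) = _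
          rw [Polynomial.aeval_def, Polynomial.eval₂_map]
          congr 1
          exact RingHom.ext_int _ _
      refine not_universal hinj hb (π := Polynomial.X) Polynomial.X_ne_zero ?_ ?_ ?_ hi huniv
      · exact PrincipalIdealRing.isMaximal_of_irreducible Polynomial.irreducible_X
      · have := (Polynomial.quotientSpanXSubCAlgEquiv (0 : ZMod ℓ)).symm.toEquiv
        rw [Polynomial.C_0, sub_zero] at this
        exact Finite.of_equiv _ this
      · rw [Polynomial.X_dvd_iff]
        intro h0
        apply hv2F
        have : ((2 : Polynomial (ZMod ℓ)).coeff 0) = 2 := by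
          simp
        rw [this] at h0
        have := congrArg (algebraMap (ZMod ℓ) (ResidueField O)) h0
        rwa [map_ofNat, map_zero] at this

end OverTwoRes

lemma exists_algebraMap_of_div {k L : Type*} [Field k] [Field L] [Algebra k L] {x : L}
    (hx : Transcendental k x) (U D : Polynomial k)
    (h : IsAlgebraic k (Polynomial.aeval x U / Polynomial.aeval x D)) :
    ∃ q : k, Polynomial.aeval x U / Polynomial.aeval x D = algebraMap k L q := by
  let e : RatFunc k →ₐ[k] L := (IntermediateField.val _).comp
    (RatFunc.algEquivOfTranscendental x hx).toAlgHom
  have he : ∀ P : Polynomial k, e (algebraMap _ _ P) = Polynomial.aeval x P := fun P => by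
    change ((RatFunc.algEquivOfTranscendental x hx (algebraMap _ _ P) :
      IntermediateField.adjoin k {x}) : L) = _
    rw [RatFunc.algEquivOfTranscendental_algebraMap]
    simp
  have h1 : Polynomial.aeval x U / Polynomial.aeval x D =
    e (algebraMap _ _ U / algebraMap _ _ D) := by rw [map_div₀, he, he]
  rw [h1] at h ⊢
  have h2 := (isAlgebraic_algHom_iff e e.toRingHom.injective).1 h
  by_cases hC : ∃ q, (algebraMap _ (RatFunc k) U / algebraMap _ _ D) = RatFunc.C q
  · obtain ⟨q, hq⟩ := hC
    refine ⟨q, ?_⟩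
    rw [hq, ← RatFunc.algebraMap_eq_C, AlgHom.commutes]
  · exact absurd h2 (RatFunc.transcendental_of_ne_C _ hC)

lemma exists_ratCast_of_div {L : Type*} [Field L] [CharZero L] {x : L} (hx : Transcendental ℚ x)
    (U D : Polynomial ℚ) (h : IsAlgebraic ℚ (Polynomial.aeval x U / Polynomial.aeval x D)) :
    ∃ q : ℚ, Polynomial.aeval x U / Polynomial.aeval x D = q := by
  obtain ⟨q, hq⟩ := exists_algebraMap_of_div hx U D h
  exact ⟨q, by rw [hq, eq_ratCast]⟩

namespace IsConic

variable {c d : ℚ} {L : Type*} [Field L] [CharZero L] {x y : L}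

theorem exists_ratCast (h : IsConic c d x y) {l : L} (hl : IsAlgebraic ℚ l) :
    ∃ q : ℚ, l = q := by
  obtain ⟨τ, hx, hy⟩ := h.exists_ringHom (x' := x) (y' := -y) (by rw [neg_sq]; exact h.eq_one)
    h.transcendental
  have hA : ∀ A : Polynomial ℚ, τ (Polynomial.aeval x A) = Polynomial.aeval x A := fun A => by
    rw [← RingHom.toRatAlgHom_apply τ, ← Polynomial.aeval_algHom_apply, RingHom.toRatAlgHom_apply, hx]
  obtain ⟨A, B, A', B', hne, hlq⟩ := h.exists_div l
  have hne' : Polynomial.aeval x A' - Polynomial.aeval x B' * y ≠ 0 := by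
    intro h0
    apply hne
    apply τ.injective
    rw [map_add, map_mul, hA, hA, hy, map_zero, ← h0]
    ring
  have hd : (d : L) ≠ 0 := by exact_mod_cast h.ne_zero_right
  have hy2 : (d : L) * y ^ 2 = 1 - c * x ^ 2 := by rw [← h.eq_one]; ring
  let r : Polynomial ℚ := 1 - Polynomial.C c * Polynomial.X ^ 2
  have hr : Polynomial.aeval x r = d * y ^ 2 := by
    rw [hy2]; simp [r]
  let D := Polynomial.C d * A' ^ 2 - B' ^ 2 * r
  let U := Polynomial.C d * A * A' - B * B' * r
  let V := Polynomial.C d * (B * A' - A * B')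
  have hD : Polynomial.aeval x D = d * ((Polynomial.aeval x A' + Polynomial.aeval x B' * y) *
      (Polynomial.aeval x A' - Polynomial.aeval x B' * y)) := by
    simp only [D, map_sub, map_mul, map_pow, hr, Polynomial.aeval_C, eq_ratCast]
    ring
  have hD0 : Polynomial.aeval x D ≠ 0 := by
    rw [hD]; exact mul_ne_zero hd (mul_ne_zero hne hne')
  have hlD : l * Polynomial.aeval x D = Polynomial.aeval x U + Polynomial.aeval x V * y := by
    rw [hD, hlq]
    simp only [U, V, map_sub, map_mul, hr, Polynomial.aeval_C, eq_ratCast]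
    rw [← mul_assoc, mul_comm _ (d : L), mul_assoc, ← mul_assoc (_ / _), div_mul_cancel₀ _ hne]
    ring
  have hl2 : l = Polynomial.aeval x U / Polynomial.aeval x D +
      Polynomial.aeval x V / Polynomial.aeval x D * y := by
    field_simp; exact hlD
  have hτl : τ l = Polynomial.aeval x U / Polynomial.aeval x D -
      Polynomial.aeval x V / Polynomial.aeval x D * y := by
    rw [hl2, map_add, map_mul, map_div₀, map_div₀, hA, hA, hA, hy]; ring
  have hτa : IsAlgebraic ℚ (τ l) := by
    have := hl.algHom τ.toRatAlgHom
    rwa [RingHom.toRatAlgHom_apply] at this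
  obtain ⟨q, hq⟩ := exists_ratCast_of_div h.transcendental U D <| by
    have h2 : IsAlgebraic ℚ ((2⁻¹ : ℚ) : L) := by
      simpa using isAlgebraic_algebraMap (R := ℚ) (A := L) 2⁻¹
    have h3 : Polynomial.aeval x U / Polynomial.aeval x D = (l + τ l) * ((2⁻¹ : ℚ) : L) := by
      rw [hτl]
      nth_rewrite 1 [hl2]
      push_cast
      ring
    rw [h3]
    exact (hl.add hτa).mul h2
  have hqa : IsAlgebraic ℚ (q : L) := by
    simpa using isAlgebraic_algebraMap (R := ℚ) (A := L) q
  have hb : (l - q) ^ 2 = Polynomial.aeval x (V ^ 2 * r) / Polynomial.aeval x (Polynomial.C d * D ^ 2) := by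
    rw [← hq]
    nth_rewrite 1 [hl2]
    simp only [map_mul, map_pow, hr, Polynomial.aeval_C, eq_ratCast]
    field_simp
    ring
  obtain ⟨q2, hq2⟩ := exists_ratCast_of_div h.transcendental (V ^ 2 * r) (Polynomial.C d * D ^ 2) <| by
    rw [← hb]; exact (hl.sub hqa).pow 2
  refine ⟨q, ?_⟩
  rw [← sub_eq_zero]
  by_contra hne0
  have hq20 : q2 ≠ 0 := by
    rintro rfl
    rw [hq2] at hb
    exact hne0 (by simpa using hb)
  have hpoly : Polynomial.C (d * q2) * D ^ 2 = r * V ^ 2 := by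
    apply transcendental_iff_injective.1 h.transcendental
    rw [div_eq_iff (by rw [map_mul, map_pow, Polynomial.aeval_C, eq_ratCast]; exact mul_ne_zero hd (pow_ne_zero 2 hD0))] at hq2
    simp only [map_mul, map_pow, Polynomial.aeval_C, eq_ratCast] at hq2 ⊢
    linear_combination -hq2
  have := (eq_zero_of_sq_mul_eq h.ne_zero_left (mul_ne_zero h.ne_zero_right hq20) hpoly).1
  exact hD0 (by rw [this, map_zero])

lemma exists_rat_sq (h : IsConic c d x y) {q : ℚ} {z : L} (hz : (q : L) = z ^ 2) :
    ∃ r : ℚ, q = r ^ 2 := by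
  obtain ⟨r, rfl⟩ := h.exists_ratCast (l := z) <| by
    refine IsAlgebraic.of_pow two_pos ?_
    rw [← hz]
    simpa using isAlgebraic_algebraMap (R := ℚ) (A := L) q
  exact ⟨r, by exact_mod_cast hz⟩

end IsConic

/-- An embedding of a conic function field in `N(X)` for which `X` is the slope of lines through a
rational point on the horizontal axis. -/
def IsSlope {L N : Type*} [Field L] [Field N] (x y : L) (j : L →+* RatFunc N) : Prop :=
  ∃ s : N, j x ≠ RatFunc.C s ∧ RatFunc.X * (j x - RatFunc.C s) = j y

lemma transcendental_rat_of_ne_C {N : Type*} [Field N] [CharZero N] {f : RatFunc N}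
    (hf : ¬ ∃ q, f = RatFunc.C q) : Transcendental ℚ f := by
  intro halg
  obtain ⟨P, hP0, hP⟩ := halg
  refine RatFunc.transcendental_of_ne_C f hf ⟨P.map (algebraMap ℚ N), ?_, ?_⟩
  · rwa [Ne, Polynomial.map_eq_zero_iff (algebraMap ℚ N).injective]
  · rw [Polynomial.aeval_def, Polynomial.eval₂_map, ← hP, Polynomial.aeval_def]
    congr 1
    exact Subsingleton.elim _ _

namespace IsConic

variable {c d : ℚ} {L : Type*} [Field L] [CharZero L] {x y : L}

lemma exists_isSlope (h : IsConic c d x y) {N : Type*} [Field N] [CharZero N] {s : N}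
    (hs : s ^ 2 = c) : ∃ j : L →+* RatFunc N, IsSlope x y j := by
  have hc : (c : N) ≠ 0 := by exact_mod_cast h.ne_zero_left
  have hd : (d : N) ≠ 0 := by exact_mod_cast h.ne_zero_right
  have hs0 : s ≠ 0 := by rintro rfl; apply hc; rw [← hs]; simp
  have hS0 : (RatFunc.C s : RatFunc N) ≠ 0 := by simpa
  have hD0 : RatFunc.C (d : N) * RatFunc.X ^ 2 + RatFunc.C (c : N) ≠ 0 := by
    have h1 : Polynomial.C (d : N) * Polynomial.X ^ 2 + Polynomial.C (c : N) ≠ 0 := by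
      intro h0
      have := congrArg (fun P => Polynomial.coeff P 0) h0
      simp at this
      exact h.ne_zero_left this
    have := (RatFunc.algebraMap_injective N).ne h1
    simpa using this
  set S : RatFunc N := RatFunc.C s
  have hSc : S ^ 2 = (c : RatFunc N) := by
    rw [← map_pow, hs, map_ratCast]
  have hdr : RatFunc.C (d : N) = (d : RatFunc N) := map_ratCast _ _
  have hcr : RatFunc.C (c : N) = (c : RatFunc N) := map_ratCast _ _
  have hc0 : (c : RatFunc N) ≠ 0 := by exact_mod_cast h.ne_zero_left
  have hd0 : (d : RatFunc N) ≠ 0 := by exact_mod_cast h.ne_zero_right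
  rw [hdr, hcr] at hD0
  set T : RatFunc N := RatFunc.X
  set x' := (d * T ^ 2 - c) / (S * (d * T ^ 2 + c)) with hx'
  set y' := - 2 * S * T / (d * T ^ 2 + c) with hy'
  have h1 : (c : RatFunc N) * x' ^ 2 + d * y' ^ 2 = 1 := by
    rw [hx', hy']
    field_simp
    rw [hSc]
    linear_combination (4 * d * T ^ 2) * (S ^ 2 + c) * hSc
  have ht : Transcendental ℚ x' := by
    apply transcendental_rat_of_ne_C
    rintro ⟨q, hq⟩
    rw [hx', div_eq_iff (mul_ne_zero hS0 hD0), ← hdr, ← hcr] at hq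
    have hq' : Polynomial.C (d : N) * Polynomial.X ^ 2 - Polynomial.C (c : N) =
        Polynomial.C q * (Polynomial.C s * (Polynomial.C (d : N) * Polynomial.X ^ 2 +
          Polynomial.C (c : N))) := by
      apply RatFunc.algebraMap_injective N
      simpa using hq
    have h0 := congrArg (fun P => Polynomial.coeff P 0) hq'
    have h2 := congrArg (fun P => Polynomial.coeff P 2) hq'
    simp at h0 h2
    have e1 : q * s = 1 := by
      apply mul_right_cancel₀ hd; linear_combination -h2
    have e2 : q * s = -1 := by
      apply mul_right_cancel₀ hc; linear_combination -h0
    rw [e1] at e2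
    norm_num at e2
  obtain ⟨j, hjx, hjy⟩ := h.exists_ringHom (x' := x') (y' := y') h1 ht
  refine ⟨j, s⁻¹, ?_, ?_⟩
  · rw [hjx, hx', map_inv₀, Ne, div_eq_iff (mul_ne_zero hS0 hD0)]
    change ¬ _ = S⁻¹ * _
    rw [inv_mul_cancel_left₀ hS0]
    intro h0
    have : (c : RatFunc N) = 0 := by linear_combination -h0 / 2
    exact hc0 this
  · rw [hjx, hjy, map_inv₀]
    change T * (x' - S⁻¹) = y'
    have e1 : d * T ^ 2 - (c : RatFunc N) = (d * T ^ 2 + c) - 2 * S ^ 2 := by rw [hSc]; ring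
    rw [hx', hy', e1]
    generalize (d * T ^ 2 + c : RatFunc N) = D at hD0
    field_simp
    ring

end IsConic

lemma IsSlope.map {L N N' : Type*} [Field L] [Field N] [Field N'] {x y : L} {j : L →+* RatFunc N}
    (hj : IsSlope x y j) (φ : RatFunc N →+* RatFunc N') (hX : φ RatFunc.X = RatFunc.X)
    (f : N →+* N') (hC : ∀ n, φ (RatFunc.C n) = RatFunc.C (f n)) : IsSlope x y (φ.comp j) := by
  obtain ⟨s, h1, h2⟩ := hj
  refine ⟨f s, fun h => h1 (φ.injective (by rw [hC]; exact h)), ?_⟩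
  rw [RingHom.comp_apply, RingHom.comp_apply, ← h2, map_mul, map_sub, hX, hC]

lemma Subfield.mem_of_ratFunc {N : Type*} [Field N] (E : Subfield (RatFunc N))
    (hC : ∀ n, RatFunc.C n ∈ E) (hX : RatFunc.X ∈ E) (f : RatFunc N) : f ∈ E := by
  have hP : ∀ P : Polynomial N, algebraMap _ (RatFunc N) P ∈ E := by
    intro P
    induction P using Polynomial.induction_on' with
    | add p q hp hq => rw [map_add]; exact E.add_mem hp hq
    | monomial n a =>
      rw [← Polynomial.C_mul_X_pow_eq_monomial, map_mul, map_pow, RatFunc.algebraMap_C,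
        RatFunc.algebraMap_X]
      exact E.mul_mem (hC a) (E.pow_mem hX n)
  rw [← f.num_div_denom]
  exact E.div_mem (hP _) (hP _)

/-- A function on a conic that becomes a square after a finite constant extension is a square up
to a constant. -/
theorem IsConic.exists_of_isSquare_map {c d : ℚ} {L : Type*} [Field L] [CharZero L] {x y : L}
    (h : IsConic c d x y) {N : Type*} [Field N] [CharZero N] [FiniteDimensional ℚ N] [IsGalois ℚ N]
    {j : L →+* RatFunc N} (hj : IsSlope x y j) {f : L} (hf0 : f ≠ 0) {g : RatFunc N}
    (hg : j f = g ^ 2) : ∃ (q : ℚ) (l : L), l ≠ 0 ∧ f = q * l ^ 2 := by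
  let := j.toAlgebra
  have hjalg : ∀ l, algebraMap L (RatFunc N) l = j l := fun _ => rfl
  obtain ⟨s, hs1, hs2⟩ := hj
  have hgen : ∀ E : Subfield (RatFunc N), (∀ l, j l ∈ E) → (∀ n, RatFunc.C n ∈ E) → ∀ f, f ∈ E := by
    intro E hL hC
    refine Subfield.mem_of_ratFunc E hC ?_
    rw [eq_div_of_mul_eq (sub_ne_zero.2 hs1) hs2]
    exact E.div_mem (hL y) (E.sub_mem (hL x) (hC s))
  obtain ⟨θ, hθ⟩ := Field.exists_primitive_element ℚ N
  have hθi : IsIntegral ℚ θ := IsIntegral.of_finite ℚ θ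
  let p := (minpoly ℚ θ).map (algebraMap ℚ L)
  have hCθ : ∀ P : Polynomial ℚ, RatFunc.C (Polynomial.aeval θ P) =
      Polynomial.eval₂ (algebraMap ℚ (RatFunc N)) (RatFunc.C θ) P := by
    intro P
    rw [Polynomial.aeval_def, Polynomial.hom_eval₂]
    congr 1
    exact Subsingleton.elim _ _
  have hpC : Polynomial.map (algebraMap L (RatFunc N)) p = ((minpoly ℚ θ).map (algebraMap ℚ N)).map RatFunc.C := by
    rw [Polynomial.map_map, Polynomial.map_map]
    congr 1
    exact Subsingleton.elim _ _
  have hCmem : ∀ E : Subfield (RatFunc N), (∀ q : ℚ, (q : (RatFunc N)) ∈ E) → RatFunc.C θ ∈ E → ∀ n, RatFunc.C n ∈ E := by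
    intro E hQ hE n
    have : n ∈ IntermediateField.adjoin ℚ {θ} := by rw [hθ]; trivial
    rw [IntermediateField.mem_adjoin_simple_iff] at this
    obtain ⟨P, Q, rfl⟩ := this
    have hP : ∀ P : Polynomial ℚ, RatFunc.C (Polynomial.aeval θ P) ∈ E := fun P => by
      rw [hCθ, Polynomial.eval₂_eq_sum_range]
      refine E.sum_mem fun i _ => E.mul_mem ?_ (E.pow_mem hE i)
      rw [eq_ratCast]; exact hQ _
    rw [map_div₀]
    exact E.div_mem (hP P) (hP Q)
  have hp : p.Separable := (Polynomial.separable_map _).2 (minpoly.irreducible hθi).separable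
  have hsplit : p.IsSplittingField L (RatFunc N) := by
    rw [isSplittingField_iff_intermediateField]
    constructor
    · rw [hpC]
      exact (Normal.splits inferInstance θ).map _
    · rw [eq_top_iff]
      rintro m -
      refine hgen (IntermediateField.adjoin L _).toSubfield (fun l => ?_) (hCmem _ (fun q => ?_) ?_) m
      · exact (IntermediateField.adjoin L _).algebraMap_mem l
      · have := (IntermediateField.adjoin L (p.rootSet (RatFunc N))).algebraMap_mem (q : L)
        rwa [map_ratCast] at this
      · apply IntermediateField.subset_adjoin
        rw [Polynomial.mem_rootSet']
        refine ⟨?_, ?_⟩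
        · rw [hpC]
          exact Polynomial.map_ne_zero (Polynomial.map_ne_zero (minpoly.ne_zero hθi))
        · rw [Polynomial.aeval_def, ← Polynomial.eval_map, hpC, Polynomial.eval_map,
            Polynomial.eval₂_hom, Polynomial.eval_map_algebraMap, minpoly.aeval, map_zero]
  have hfin : FiniteDimensional L (RatFunc N) := Polynomial.IsSplittingField.finiteDimensional (RatFunc N) p
  have hgal : IsGalois L (RatFunc N) := IsGalois.of_separable_splitting_field hp
  have hg0 : g ≠ 0 := by
    rintro rfl
    rw [zero_pow two_ne_zero, map_eq_zero] at hg
    exact hf0 hg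
  have hσg : ∀ σ : RatFunc N ≃ₐ[L] RatFunc N, σ g = g ∨ σ g = -g := fun σ => by
    apply sq_eq_sq_iff_eq_or_eq_neg.1
    rw [← map_pow, ← hg, ← hjalg, σ.commutes]
  let χ : (RatFunc N ≃ₐ[L] RatFunc N) → RatFunc N := fun σ => σ g / g
  have hχ : ∀ σ, χ σ = 1 ∨ χ σ = -1 := fun σ => by
    rcases hσg σ with h | h
    · left; simp only [χ]; rw [h, div_self hg0]
    · right; simp only [χ]; rw [h, neg_div, div_self hg0]
  have hχfix : ∀ σ τ : RatFunc N ≃ₐ[L] RatFunc N, τ (χ σ) = χ σ := fun σ τ => by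
    rcases hχ σ with h | h <;> rw [h] <;> simp
  have hχmul : ∀ σ τ : RatFunc N ≃ₐ[L] RatFunc N, χ (τ * σ) = χ τ * χ σ := fun σ τ => by
    have h1 : σ g = χ σ * g := (div_mul_cancel₀ _ hg0).symm
    have h2 : τ g = χ τ * g := (div_mul_cancel₀ _ hg0).symm
    change τ (σ g) / g = _
    rw [h1, map_mul, hχfix, h2]
    field_simp
  let ψ : (RatFunc N ≃ₐ[L] RatFunc N) → (N →* RatFunc N) := fun σ =>
    ((σ : RatFunc N →+* RatFunc N).comp RatFunc.C : N →+* RatFunc N)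
  have hψ : Function.Injective ψ := by
    intro σ τ hστ
    have h1 : ∀ f, f ∈ RingHom.eqLocusField (σ : RatFunc N →+* RatFunc N) τ :=
      hgen _ (fun l => (σ.commutes l).trans (τ.commutes l).symm)
        (fun n => DFunLike.congr_fun hστ n)
    exact AlgEquiv.ext h1
  let T : N → RatFunc N := fun ω => ∑ σ, χ σ * ψ σ ω
  obtain ⟨ω, hω⟩ : ∃ ω, T ω ≠ 0 := by
    by_contra! hT
    have hli := (linearIndependent_monoidHom N (RatFunc N)).comp ψ hψ
    rw [Fintype.linearIndependent_iff] at hli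
    have := hli χ (by ext ω; simpa using hT ω) 1
    rcases hχ 1 with h | h <;> rw [h] at this <;> simp at this
  have hTσ : ∀ τ : RatFunc N ≃ₐ[L] RatFunc N, T ω = χ τ * τ (T ω) := fun τ => by
    simp only [T]
    rw [map_sum, Finset.mul_sum, ← Equiv.sum_comp (Equiv.mulLeft τ)]
    refine Finset.sum_congr rfl fun σ _ => ?_
    rw [Equiv.coe_mulLeft, hχmul, map_mul, hχfix, mul_assoc]
    rfl
  obtain ⟨l, hl⟩ : ∃ l, j l = T ω * g := by
    refine (IsGalois.mem_range_algebraMap_iff_fixed (F := L) _).2 fun τ => ?_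
    have h2 : τ g = χ τ * g := (div_mul_cancel₀ _ hg0).symm
    conv_rhs => rw [hTσ τ]
    rw [map_mul, h2]; ring
  obtain ⟨l', hl'⟩ : ∃ l, j l = T ω ^ 2 := by
    refine (IsGalois.mem_range_algebraMap_iff_fixed (F := L) _).2 fun τ => ?_
    conv_rhs => rw [hTσ τ]
    rw [map_pow]
    rcases hχ τ with h | h <;> rw [h] <;> ring
  have halg : IsAlgebraic ℚ (T ω) := by
    have hψa : ∀ σ, IsAlgebraic ℚ (ψ σ ω) := fun σ =>
      (Algebra.IsAlgebraic.isAlgebraic (R := ℚ) ω).algHom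
        ((σ : RatFunc N →+* RatFunc N).comp RatFunc.C : N →+* RatFunc N).toRatAlgHom
    have : ∀ σ, χ σ * ψ σ ω ∈ algebraicClosure ℚ (RatFunc N) := fun σ => by
      have := mem_algebraicClosure_iff.2 (hψa σ)
      rcases hχ σ with h | h <;> rw [h]
      · rwa [one_mul]
      · rw [neg_one_mul]; exact neg_mem this
    exact mem_algebraicClosure_iff.1 (sum_mem fun σ _ => this σ)
  have hl'a : IsAlgebraic ℚ l' := by
    have : IsAlgebraic ℚ (j.toRatAlgHom l') := by
      change IsAlgebraic ℚ (j l')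
      rw [hl']; exact halg.pow 2
    exact (isAlgebraic_algHom_iff _ j.toRatAlgHom.injective).1 this
  obtain ⟨q, rfl⟩ := h.exists_ratCast hl'a
  refine ⟨q⁻¹, l, ?_, ?_⟩
  · rintro rfl
    rw [map_zero] at hl
    exact mul_ne_zero hω hg0 hl.symm
  · apply j.injective
    rw [map_mul, map_pow, hl, hg, Rat.cast_inv, map_inv₀, hl']
    field_simp

/-- The map `N(X) → N'(X)` induced by a field homomorphism `N → N'`. -/
def ratFuncMap {N N' : Type*} [Field N] [Field N'] (φ : N →+* N') : RatFunc N →+* RatFunc N' :=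
  RatFunc.mapRingHom (Polynomial.mapRingHom φ) fun P hP => by
    rw [Submonoid.mem_comap, mem_nonZeroDivisors_iff_ne_zero, Polynomial.coe_mapRingHom,
      Polynomial.map_ne_zero_iff φ.injective]
    exact nonZeroDivisors.ne_zero hP

lemma ratFuncMap_algebraMap {N N' : Type*} [Field N] [Field N'] (φ : N →+* N')
    (P : Polynomial N) :
    ratFuncMap φ (algebraMap _ _ P) = algebraMap _ (RatFunc N') (P.map φ) := by
  have := RatFunc.map_apply_div (Polynomial.mapRingHom φ) (fun P hP => by
    rw [Submonoid.mem_comap, mem_nonZeroDivisors_iff_ne_zero, Polynomial.coe_mapRingHom,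
      Polynomial.map_ne_zero_iff φ.injective]
    exact nonZeroDivisors.ne_zero hP) P 1
  rw [map_one, map_one, map_one, div_one, div_one] at this
  exact this

lemma ratFuncMap_C {N N' : Type*} [Field N] [Field N'] (φ : N →+* N') (n : N) :
    ratFuncMap φ (RatFunc.C n) = RatFunc.C (φ n) := by
  rw [← RatFunc.algebraMap_C, ratFuncMap_algebraMap, Polynomial.map_C, RatFunc.algebraMap_C]

lemma ratFuncMap_X {N N' : Type*} [Field N] [Field N'] (φ : N →+* N') :
    ratFuncMap φ RatFunc.X = RatFunc.X := by
  rw [← RatFunc.algebraMap_X, ratFuncMap_algebraMap, Polynomial.map_X, RatFunc.algebraMap_X]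

lemma IsSlope.ratFuncMap {L N N' : Type*} [Field L] [Field N] [Field N'] {x y : L}
    {j : L →+* RatFunc N} (hj : IsSlope x y j) (φ : N →+* N') :
    IsSlope x y ((ratFuncMap φ).comp j) :=
  hj.map _ (ratFuncMap_X φ) φ (ratFuncMap_C φ)

lemma exists_numberField_sq (N : Type) [Field N] [NumberField N] (γ : N) :
    ∃ (N' : Type) (_ : Field N') (_ : NumberField N') (_ : IsGalois ℚ N') (φ : N →+* N') (δ : N'),
      δ ^ 2 = φ γ := by
  let P : Polynomial N := Polynomial.X ^ 2 - Polynomial.C γ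
  let N₁ := P.SplittingField
  have : NumberField N₁ := NumberField.of_module_finite N N₁
  let N₂ := IntermediateField.normalClosure ℚ N₁ (AlgebraicClosure N₁)
  have : NumberField N₂ := { }
  have : Algebra.IsAlgebraic ℚ (AlgebraicClosure N₁) := Algebra.IsAlgebraic.trans ℚ N₁ _
  have : IsAlgClosure ℚ (AlgebraicClosure N₁) := ⟨inferInstance, inferInstance⟩
  have : Normal ℚ (AlgebraicClosure N₁) := IsAlgClosure.normal ℚ _
  have : Normal ℚ N₂ := normalClosure.normal ℚ N₁ _
  have hG : IsGalois ℚ N₂ := IsGalois.mk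
  obtain ⟨δ, hδ⟩ := (Polynomial.SplittingField.splits P).exists_eval_eq_zero (by
    simp only [P]; rw [Polynomial.degree_map, Polynomial.degree_X_pow_sub_C two_pos]; decide)
  refine ⟨N₂, inferInstance, inferInstance, hG, (algebraMap N₁ N₂).comp (algebraMap N N₁),
    algebraMap N₁ N₂ δ, ?_⟩
  rw [RingHom.comp_apply, ← map_pow]
  congr 1
  simpa [P, sub_eq_zero] using hδ

lemma Polynomial.exists_eq_C_mul_sq {N : Type*} [Field N] {P : Polynomial N} (hP : P.Splits)
    (heven : ∀ a, Even (P.rootMultiplicity a)) : ∃ (γ : N) (e : Polynomial N),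
      P = Polynomial.C γ * e ^ 2 := by
  classical
  refine ⟨P.leadingCoeff, ∏ a ∈ P.roots.toFinset,
    (Polynomial.X - Polynomial.C a) ^ (P.rootMultiplicity a / 2), ?_⟩
  conv_lhs => rw [hP.eq_prod_roots]
  congr 1
  rw [Finset.prod_multiset_map_count, ← Finset.prod_pow]
  refine Finset.prod_congr rfl fun a _ => ?_
  rw [Polynomial.count_roots, ← pow_mul, Nat.div_mul_cancel (heven a).two_dvd]

/-- A function on a conic which is not a square up to a constant has a zero or pole of odd order at
some point, rational over a number field, where the slope is a coordinate. -/
theorem IsConic.exists_odd_root {c d : ℚ} {L : Type*} [Field L] [CharZero L] {x y : L}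
    (h : IsConic c d x y) {f : L} (hf0 : f ≠ 0) (hf : ¬ ∃ (q : ℚ) (l : L), l ≠ 0 ∧ f = q * l ^ 2) :
    ∃ (N : Type) (_ : Field N) (_ : NumberField N) (j : L →+* RatFunc N) (β : N) (m : ℕ)
      (Q E : Polynomial N), IsSlope x y j ∧ Odd m ∧ Q.eval β ≠ 0 ∧ E ≠ 0 ∧
        j f * algebraMap _ _ E ^ 2 =
          algebraMap _ (RatFunc N) ((Polynomial.X - Polynomial.C β) ^ m * Q) := by
  obtain ⟨N₀, _, _, _, φ₀, s, hs⟩ := exists_numberField_sq ℚ c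
  rw [eq_ratCast] at hs
  obtain ⟨j₀, hj₀⟩ := h.exists_isSlope hs
  let P₀ := (j₀ f).num * (j₀ f).denom
  have hP₀ : j₀ f * algebraMap _ _ (j₀ f).denom ^ 2 = algebraMap _ _ P₀ := by
    have hd : algebraMap _ (RatFunc N₀) (j₀ f).denom ≠ 0 :=
      RatFunc.algebraMap_ne_zero (j₀ f).denom_ne_zero
    rw [map_mul, pow_two, ← mul_assoc]
    congr 1
    nth_rw 1 [← (j₀ f).num_div_denom]
    exact div_mul_cancel₀ _ hd
  have hjf : j₀ f ≠ 0 := (map_ne_zero _).2 hf0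
  have hP₀0 : P₀ ≠ 0 := mul_ne_zero (RatFunc.num_ne_zero hjf) (RatFunc.denom_ne_zero _)
  let N₁ := P₀.SplittingField
  have : NumberField N₁ := NumberField.of_module_finite N₀ N₁
  let φ₁ : N₀ →+* N₁ := algebraMap N₀ N₁
  have hj₁ := hj₀.ratFuncMap φ₁
  set j₁ := (ratFuncMap φ₁).comp j₀
  have hP₁ : j₁ f * algebraMap _ _ ((j₀ f).denom.map φ₁) ^ 2 = algebraMap _ _ (P₀.map φ₁) := by
    have := congrArg (ratFuncMap φ₁) hP₀
    rwa [map_mul, map_pow, ratFuncMap_algebraMap, ratFuncMap_algebraMap] at this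
  have hP₁0 : P₀.map φ₁ ≠ 0 := Polynomial.map_ne_zero hP₀0
  have hE₁ : (j₀ f).denom.map φ₁ ≠ 0 := Polynomial.map_ne_zero (RatFunc.denom_ne_zero _)
  by_cases heven : ∀ a, Even ((P₀.map φ₁).rootMultiplicity a)
  · exfalso
    apply hf
    obtain ⟨γ, e, he⟩ := Polynomial.exists_eq_C_mul_sq (Polynomial.SplittingField.splits P₀) heven
    obtain ⟨N₂, _, _, _, φ₂, δ, hδ⟩ := exists_numberField_sq N₁ γ
    have hE₂ : algebraMap _ (RatFunc N₂) (((j₀ f).denom.map φ₁).map φ₂) ≠ 0 :=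
      RatFunc.algebraMap_ne_zero (Polynomial.map_ne_zero hE₁)
    refine h.exists_of_isSquare_map (hj₁.ratFuncMap φ₂) hf0 (g := RatFunc.C δ *
      algebraMap _ _ (e.map φ₂) / algebraMap _ _ (((j₀ f).denom.map φ₁).map φ₂)) ?_
    rw [div_pow, eq_div_iff (pow_ne_zero 2 hE₂)]
    have := congrArg (ratFuncMap φ₂) hP₁
    rw [map_mul, map_pow, ratFuncMap_algebraMap, ratFuncMap_algebraMap] at this
    rw [RingHom.comp_apply, this, he]
    rw [Polynomial.map_mul, Polynomial.map_pow, Polynomial.map_C, ← hδ, map_mul, map_pow, map_pow,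
      map_pow, RatFunc.algebraMap_C, mul_pow]
  · push Not at heven
    obtain ⟨β, hβ⟩ := heven
    obtain ⟨Q, hQ, hQβ⟩ := (P₀.map φ₁).exists_eq_pow_rootMultiplicity_mul_and_not_dvd hP₁0 β
    refine ⟨N₁, inferInstance, inferInstance, j₁, β, _, Q, _, hj₁, Nat.not_even_iff_odd.1 hβ,
      ?_, hE₁, ?_⟩
    · rwa [Polynomial.dvd_iff_isRoot] at hQβ
    · rw [hP₁, ← hQ]

section

open IsLocalRing

section Gauss

variable {N : Type*} [Field N] (A : ValuationSubring N)

/-- The inclusion of `A[X]` in `N(X)`. -/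
def polyIncl : Polynomial A →+* RatFunc N :=
  (algebraMap (Polynomial N) (RatFunc N)).comp (Polynomial.mapRingHom A.subtype)

/-- The reduction of polynomials over a valuation ring, viewed in the rational function field. -/
def polyRed : Polynomial A →+* RatFunc (ResidueField A) :=
  (algebraMap (Polynomial (ResidueField A)) (RatFunc (ResidueField A))).comp
    (Polynomial.mapRingHom (residue A))

lemma polyIncl_injective : Function.Injective (polyIncl A) :=
  (RatFunc.algebraMap_injective N).comp (Polynomial.map_injective _ Subtype.val_injective)

variable {A}

lemma polyRed_eq_zero_iff (P : Polynomial A) :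
    polyRed A P = 0 ↔ ∀ n, A.valuation (P.coeff n : N) < 1 := by
  rw [polyRed, RingHom.comp_apply, map_eq_zero_iff _ (RatFunc.algebraMap_injective _),
    Polynomial.coe_mapRingHom, Polynomial.ext_iff]
  simp only [Polynomial.coeff_map, Polynomial.coeff_zero, valuationSubring_residue_eq_zero_iff]

lemma polyIncl_C (a : A) : polyIncl A (Polynomial.C a) = RatFunc.C (a : N) := by
  simp [polyIncl]

lemma polyIncl_X : polyIncl A Polynomial.X = RatFunc.X := by simp [polyIncl]

lemma polyRed_C (a : A) : polyRed A (Polynomial.C a) = RatFunc.C (residue A a) := by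
  simp [polyRed]

lemma polyRed_X : polyRed A Polynomial.X = RatFunc.X := by simp [polyRed]

lemma exists_polyIncl_eq {ϖ : N} (hw : IsUnif A.valuation ϖ) {P : Polynomial N} (hP : P ≠ 0) :
    ∃ (n : ℤ) (P₀ : Polynomial A), polyRed A P₀ ≠ 0 ∧
      algebraMap _ (RatFunc N) P = RatFunc.C ϖ ^ n * polyIncl A P₀ := by
  obtain ⟨i, hi, hmax⟩ := P.support.exists_max_image (fun i => A.valuation (P.coeff i))
    (Polynomial.support_nonempty.2 hP)
  have hi0 : P.coeff i ≠ 0 := Polynomial.mem_support_iff.1 hi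
  have hle : ∀ n, A.valuation (P.coeff n) ≤ A.valuation (P.coeff i) := fun n => by
    by_cases hn : n ∈ P.support
    · exact hmax n hn
    · rw [Polynomial.notMem_support_iff.1 hn, map_zero]; exact zero_le
  obtain ⟨n, hn⟩ := hw.exists_zpow _ hi0
  have hϖ : ϖ ^ n ≠ 0 := zpow_ne_zero _ hw.ne_zero
  have hv : 0 < A.valuation (ϖ ^ n) := by rwa [zero_lt_iff, Valuation.ne_zero_iff]
  rw [← map_zpow₀] at hn
  obtain ⟨P₀, hP₀⟩ : ∃ P₀ : Polynomial A, P₀.map A.subtype = Polynomial.C (ϖ ^ n)⁻¹ * P := by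
    rw [← Polynomial.mem_lifts, Polynomial.lifts_iff_coeff_lifts]
    intro m
    rw [Polynomial.coeff_C_mul]
    refine ⟨⟨(ϖ ^ n)⁻¹ * P.coeff m, (A.valuation_le_one_iff _).1 ?_⟩, rfl⟩
    rw [map_mul, map_inv₀, inv_mul_le_one₀ hv, ← hn]
    exact hle m
  refine ⟨n, P₀, ?_, ?_⟩
  · rw [Ne, polyRed_eq_zero_iff]
    intro h
    have h1 : (P₀.coeff i : N) = (ϖ ^ n)⁻¹ * P.coeff i := by
      rw [← Polynomial.coeff_C_mul, ← hP₀, Polynomial.coeff_map]; rfl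
    have h2 := h i
    rw [h1, map_mul, map_inv₀, hn, inv_mul_cancel₀ hv.ne'] at h2
    exact lt_irrefl _ h2
  · change _ = _ * algebraMap _ _ (P₀.map A.subtype)
    rw [hP₀, map_mul, RatFunc.algebraMap_C, map_inv₀, map_zpow₀, mul_inv_cancel_left₀]
    exact zpow_ne_zero _ ((map_ne_zero _).2 hw.ne_zero)

lemma polyIncl_ne_zero {P : Polynomial A} (hP : polyRed A P ≠ 0) : polyIncl A P ≠ 0 := by
  intro h
  rw [map_eq_zero_iff _ (polyIncl_injective A)] at h
  rw [h, map_zero] at hP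
  exact hP rfl

lemma exists_zpow_mul_div {ϖ : N} (hw : IsUnif A.valuation ϖ) {f : RatFunc N} (hf : f ≠ 0) :
    ∃ (n : ℤ) (P Q : Polynomial A), polyRed A P ≠ 0 ∧ polyRed A Q ≠ 0 ∧
      f = RatFunc.C ϖ ^ n * (polyIncl A P / polyIncl A Q) := by
  obtain ⟨a, P, hP, hP'⟩ := exists_polyIncl_eq hw (RatFunc.num_ne_zero hf)
  obtain ⟨b, Q, hQ, hQ'⟩ := exists_polyIncl_eq hw (RatFunc.denom_ne_zero f)
  refine ⟨a - b, P, Q, hP, hQ, ?_⟩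
  have hC : RatFunc.C ϖ ≠ 0 := (map_ne_zero _).2 hw.ne_zero
  conv_lhs => rw [← f.num_div_denom, hP', hQ']
  rw [zpow_sub₀ hC]
  field_simp

/-- The valuation ring of the Gauss extension to `N(X)` of a discrete valuation of `N`. -/
def gaussSubring {ϖ : N} (hw : IsUnif A.valuation ϖ) : ValuationSubring (RatFunc N) where
  carrier := {f | ∃ P Q : Polynomial A, polyRed A Q ≠ 0 ∧ f = polyIncl A P / polyIncl A Q}
  mul_mem' := by
    rintro _ _ ⟨P, Q, hQ, rfl⟩ ⟨P', Q', hQ', rfl⟩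
    exact ⟨P * P', Q * Q', by rw [map_mul]; exact mul_ne_zero hQ hQ',
      by rw [map_mul, map_mul, div_mul_div_comm]⟩
  one_mem' := ⟨1, 1, by simp, by simp⟩
  add_mem' := by
    rintro _ _ ⟨P, Q, hQ, rfl⟩ ⟨P', Q', hQ', rfl⟩
    exact ⟨P * Q' + Q * P', Q * Q', by rw [map_mul]; exact mul_ne_zero hQ hQ',
      by simp only [map_mul, map_add, div_add_div _ _ (polyIncl_ne_zero hQ) (polyIncl_ne_zero hQ')]⟩
  zero_mem' := ⟨0, 1, by simp, by simp⟩
  neg_mem' := by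
    rintro _ ⟨P, Q, hQ, rfl⟩
    exact ⟨-P, Q, hQ, by rw [map_neg, neg_div]⟩
  mem_or_inv_mem' := by
    intro f
    by_cases hf : f = 0
    · left; exact ⟨0, 1, by simp, by simp [hf]⟩
    obtain ⟨n, P, Q, hP, hQ, rfl⟩ := exists_zpow_mul_div hw hf
    have hϖ : ϖ ∈ A := (A.valuation_le_one_iff _).1 hw.lt_one.le
    have key : ∀ (n : ℕ) (P Q : Polynomial A), polyRed A Q ≠ 0 → ∃ P' Q' : Polynomial A,
        polyRed A Q' ≠ 0 ∧
        RatFunc.C ϖ ^ n * (polyIncl A P / polyIncl A Q) = polyIncl A P' / polyIncl A Q' :=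
      fun n P Q hQ => ⟨Polynomial.C ⟨ϖ, hϖ⟩ ^ n * P, Q, hQ, by
        rw [map_mul, map_pow, polyIncl_C, mul_div_assoc]⟩
    obtain ⟨n, rfl | rfl⟩ := n.eq_nat_or_neg
    · left
      rw [zpow_natCast]
      exact key n P Q hQ
    · right
      rw [mul_inv, zpow_neg, inv_inv, inv_div, zpow_natCast]
      exact key n Q P hP

variable {ϖ : N} (hw : IsUnif A.valuation ϖ)

lemma exists_reduction (f : gaussSubring hw) : ∃ z : RatFunc (ResidueField A),
    ∃ P Q : Polynomial A, polyRed A Q ≠ 0 ∧ (f : RatFunc N) = polyIncl A P / polyIncl A Q ∧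
      z = polyRed A P / polyRed A Q := by
  obtain ⟨P, Q, hQ, hf⟩ := f.2
  exact ⟨_, P, Q, hQ, hf, rfl⟩

lemma exists_reduction_eq (f : gaussSubring hw) {P Q : Polynomial A} (hQ : polyRed A Q ≠ 0)
    (hf : (f : RatFunc N) = polyIncl A P / polyIncl A Q) :
    (exists_reduction hw f).choose = polyRed A P / polyRed A Q := by
  obtain ⟨P', Q', hQ', hf', hz⟩ := (exists_reduction hw f).choose_spec
  rw [hz, div_eq_div_iff hQ' hQ, ← map_mul, ← map_mul]
  congr 1
  apply polyIncl_injective A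
  rw [hf', div_eq_div_iff (polyIncl_ne_zero hQ') (polyIncl_ne_zero hQ)] at hf
  rw [map_mul, map_mul, hf]

/-- The residue map of the Gauss extension. -/
def gaussRes : gaussSubring hw →+* RatFunc (ResidueField A) where
  toFun f := (exists_reduction hw f).choose
  map_one' := by
    rw [exists_reduction_eq hw 1 (P := 1) (Q := 1) (by simp) (by simp)]; simp
  map_zero' := by
    rw [exists_reduction_eq hw 0 (P := 0) (Q := 1) (by simp) (by simp)]; simp
  map_mul' f g := by
    obtain ⟨P, Q, hQ, hf, hz⟩ := (exists_reduction hw f).choose_spec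
    obtain ⟨P', Q', hQ', hg, hz'⟩ := (exists_reduction hw g).choose_spec
    rw [hz, hz', exists_reduction_eq hw (f * g) (P := P * P') (Q := Q * Q')
      (by rw [map_mul]; exact mul_ne_zero hQ hQ')
      (by rw [map_mul, map_mul, ← div_mul_div_comm, ← hf, ← hg]; rfl),
      map_mul, map_mul, div_mul_div_comm]
  map_add' f g := by
    obtain ⟨P, Q, hQ, hf, hz⟩ := (exists_reduction hw f).choose_spec
    obtain ⟨P', Q', hQ', hg, hz'⟩ := (exists_reduction hw g).choose_spec
    rw [hz, hz', exists_reduction_eq hw (f + g) (P := P * Q' + Q * P') (Q := Q * Q')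
      (by rw [map_mul]; exact mul_ne_zero hQ hQ')
      (by
        rw [map_add, map_mul, map_mul, map_mul,
          ← div_add_div _ _ (polyIncl_ne_zero hQ) (polyIncl_ne_zero hQ'), ← hf, ← hg]; rfl),
      map_add, map_mul, map_mul, map_mul, div_add_div _ _ hQ hQ']

lemma polyIncl_mem (P : Polynomial A) : polyIncl A P ∈ gaussSubring hw :=
  ⟨P, 1, by simp, by simp⟩

lemma gaussRes_polyIncl (P : Polynomial A) :
    gaussRes hw ⟨polyIncl A P, polyIncl_mem hw P⟩ = polyRed A P := by
  have := exists_reduction_eq hw ⟨polyIncl A P, polyIncl_mem hw P⟩ (P := P) (Q := 1) (by simp)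
    (by simp)
  rw [map_one, div_one] at this
  exact this

lemma gaussRes_eq_zero_iff (f : gaussSubring hw) :
    gaussRes hw f = 0 ↔ (gaussSubring hw).valuation (f : RatFunc N) < 1 := by
  rw [← ValuationSubring.valuation_lt_one_iff, IsLocalRing.mem_maximalIdeal, mem_nonunits_iff,
    iff_comm, not_iff_comm]
  constructor
  · intro h
    obtain ⟨P, Q, hQ, hf, hz⟩ := (exists_reduction hw f).choose_spec
    have hP : polyRed A P ≠ 0 := by
      rintro h0
      rw [h0, zero_div] at hz
      exact h hz
    refine IsUnit.of_mul_eq_one ⟨polyIncl A Q / polyIncl A P, Q, P, hP, rfl⟩ ?_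
    apply Subtype.ext
    change (f : RatFunc N) * (polyIncl A Q / polyIncl A P) = 1
    rw [hf, div_mul_div_cancel₀ (polyIncl_ne_zero hQ), div_self (polyIncl_ne_zero hP)]
  · intro h
    exact (h.map (gaussRes hw)).ne_zero

lemma gaussRes_C (a : A) :
    gaussRes hw ⟨RatFunc.C (a : N), polyIncl_C a ▸ polyIncl_mem hw _⟩ =
      RatFunc.C (residue A a) := by
  have := gaussRes_polyIncl hw (Polynomial.C a)
  simp only [polyIncl_C, polyRed_C] at this
  exact this

lemma X_mem_gaussSubring : RatFunc.X ∈ gaussSubring hw :=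
  polyIncl_X (A := A) ▸ polyIncl_mem hw _

lemma gaussRes_X :
    gaussRes hw ⟨RatFunc.X, X_mem_gaussSubring hw⟩ = RatFunc.X := by
  have := gaussRes_polyIncl hw Polynomial.X
  simp only [polyIncl_X, polyRed_X] at this
  exact this

lemma gauss_lt_one {a : N} (ha : A.valuation a < 1) :
    (gaussSubring hw).valuation (RatFunc.C a) < 1 := by
  have h := gaussRes_C hw ⟨a, (A.valuation_le_one_iff _).1 ha.le⟩
  rw [(valuationSubring_residue_eq_zero_iff _).2 ha, map_zero, gaussRes_eq_zero_iff] at h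
  exact h

lemma gauss_eq_one {a : N} (ha : A.valuation a = 1) :
    (gaussSubring hw).valuation (RatFunc.C a) = 1 := by
  have h1 : RatFunc.C a ∈ gaussSubring hw :=
    polyIncl_C (A := A) ⟨a, (A.valuation_le_one_iff _).1 ha.le⟩ ▸ polyIncl_mem hw _
  have h := gaussRes_C hw ⟨a, (A.valuation_le_one_iff _).1 ha.le⟩
  refine le_antisymm (((gaussSubring hw).valuation_le_one_iff _).2 h1) (not_lt.1 fun h0 => ?_)
  rw [(gaussRes_eq_zero_iff hw _).2 h0, eq_comm, map_eq_zero,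
    valuationSubring_residue_eq_zero_iff] at h
  exact h.ne ha

lemma isUnif_gauss : IsUnif (gaussSubring hw).valuation (RatFunc.C ϖ) where
  lt_one := gauss_lt_one hw hw.lt_one
  ne_zero := (map_ne_zero _).2 hw.ne_zero
  exists_zpow f hf := by
    obtain ⟨n, P, Q, hP, hQ, rfl⟩ := exists_zpow_mul_div hw hf
    have h1 : ∀ P : Polynomial A, polyRed A P ≠ 0 →
        (gaussSubring hw).valuation (polyIncl A P) = 1 := fun P hP => by
      refine le_antisymm (((gaussSubring hw).valuation_le_one_iff _).2 (polyIncl_mem hw P))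
        (not_lt.1 fun h0 => hP ?_)
      rw [← gaussRes_polyIncl hw]
      exact (gaussRes_eq_zero_iff hw ⟨_, polyIncl_mem hw P⟩).2 h0
    refine ⟨n, ?_⟩
    rw [map_mul, map_div₀, h1 P hP, h1 Q hQ, div_one, mul_one, map_zpow₀]

end Gauss

section Height

variable {k : Type*} [Field k]

/-- The rational function `z` is a quotient of polynomials of degree at most `n`. -/
def HeightLE (z : RatFunc k) (n : ℕ) : Prop :=
  ∃ A B : Polynomial k, B ≠ 0 ∧ A.natDegree ≤ n ∧ B.natDegree ≤ n ∧
    z = algebraMap _ _ A / algebraMap _ _ B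

lemma exists_heightLE (z : RatFunc k) : ∃ n, HeightLE z n :=
  ⟨max z.num.natDegree z.denom.natDegree, z.num, z.denom, z.denom_ne_zero, le_max_left _ _,
    le_max_right _ _, z.num_div_denom.symm⟩

lemma HeightLE.neg {z : RatFunc k} {n : ℕ} (h : HeightLE z n) : HeightLE (-z) n := by
  obtain ⟨A, B, hB, hA', hB', rfl⟩ := h
  exact ⟨-A, B, hB, by rwa [Polynomial.natDegree_neg], hB', by rw [map_neg, neg_div]⟩

lemma HeightLE.one_add {z : RatFunc k} {n : ℕ} (h : HeightLE z n) : HeightLE (1 + z) n := by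
  obtain ⟨A, B, hB, hA', hB', rfl⟩ := h
  have hB0 : algebraMap _ (RatFunc k) B ≠ 0 := RatFunc.algebraMap_ne_zero hB
  exact ⟨B + A, B, hB, Polynomial.natDegree_add_le_of_degree_le hB' hA', hB', by
    rw [map_add, add_div, div_self hB0]⟩

lemma HeightLE.inv {z : RatFunc k} {n : ℕ} (h : HeightLE z n) (hz : z ≠ 0) : HeightLE z⁻¹ n := by
  obtain ⟨A, B, hB, hA', hB', rfl⟩ := h
  exact ⟨B, A, by rintro rfl; simp at hz, hB', hA', by rw [inv_div]⟩

lemma HeightLE.sqrt {u : RatFunc k} {n : ℕ} (h : HeightLE (u ^ 2) n) : HeightLE u (n / 2) := by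
  obtain ⟨A, B, hB, hA', hB', he⟩ := h
  by_cases hu : u = 0
  · subst hu
    exact ⟨0, 1, one_ne_zero, by simp, by simp, by simp⟩
  have hB0 : algebraMap _ (RatFunc k) B ≠ 0 := RatFunc.algebraMap_ne_zero hB
  have hd0 : algebraMap _ (RatFunc k) u.denom ≠ 0 := RatFunc.algebraMap_ne_zero u.denom_ne_zero
  have hA : A ≠ 0 := by
    rintro rfl
    rw [map_zero, zero_div] at he
    exact hu (pow_eq_zero_iff two_ne_zero |>.1 he)
  have h1 : u.num ^ 2 * B = A * u.denom ^ 2 := by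
    apply RatFunc.algebraMap_injective k
    rw [map_mul, map_mul, map_pow, map_pow]
    have h2 : u * algebraMap _ _ u.denom = algebraMap _ _ u.num := by
      nth_rw 1 [← u.num_div_denom]; exact div_mul_cancel₀ _ hd0
    rw [eq_div_iff hB0] at he
    rw [← h2, ← he]; ring
  have hco : IsCoprime (u.num ^ 2) (u.denom ^ 2) := (RatFunc.isCoprime_num_denom u).pow
  have hn : u.num ^ 2 ∣ A := hco.dvd_of_dvd_mul_right ⟨B, h1.symm⟩
  have hd : u.denom ^ 2 ∣ B := hco.symm.dvd_of_dvd_mul_left ⟨A, by rw [h1]; ring⟩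
  have hn' := Polynomial.natDegree_le_of_dvd hn hA
  have hd' := Polynomial.natDegree_le_of_dvd hd hB
  rw [Polynomial.natDegree_pow] at hn' hd'
  exact ⟨u.num, u.denom, u.denom_ne_zero, by omega, by omega, u.num_div_denom.symm⟩

lemma HeightLE.exists_eq_C {z : RatFunc k} (h : HeightLE z 0) : ∃ c, z = RatFunc.C c := by
  obtain ⟨A, B, hB, hA', hB', rfl⟩ := h
  rw [Polynomial.eq_C_of_natDegree_le_zero hA', Polynomial.eq_C_of_natDegree_le_zero hB']
  exact ⟨A.coeff 0 / B.coeff 0, by simp⟩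

end Height

section Comap

variable {M Γ L : Type*} [Field M] [Field L] [LinearOrderedCommGroupWithZero Γ]

lemma IsUnif.exists_comap {w : Valuation M Γ} {ϖ : M} (hw : IsUnif w ϖ) (j : L →+* M) {l : L}
    (hl0 : l ≠ 0) (hl : w (j l) < 1) : ∃ l₀, IsUnif (w.comap j) l₀ := by
  classical
  have hlt : ∀ n : ℤ, w ϖ ^ n < 1 ↔ 0 < n := fun n => by
    have := zpow_lt_zpow_iff_right_of_lt_one₀ hw.pos hw.lt_one (m := n) (n := 0)
    rwa [zpow_zero] at this
  have hex : ∃ n : ℕ, 0 < n ∧ ∃ l : L, l ≠ 0 ∧ w (j l) = w ϖ ^ n := by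
    obtain ⟨n, hn⟩ := hw.exists_zpow (j l) ((map_ne_zero _).2 hl0)
    rw [hn, hlt] at hl
    obtain ⟨n, rfl⟩ := Int.eq_ofNat_of_zero_le hl.le
    exact ⟨n, by exact_mod_cast hl, l, hl0, by rw [hn, zpow_natCast]⟩
  obtain ⟨hn0, l₀, hl₀, hv⟩ := Nat.find_spec hex
  set n := Nat.find hex
  refine ⟨l₀, ?_, hl₀, fun x hx => ?_⟩
  · rw [Valuation.comap_apply, hv, ← zpow_natCast, hlt]
    exact_mod_cast hn0
  · obtain ⟨a, ha⟩ := hw.exists_zpow (j x) ((map_ne_zero _).2 hx)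
    have hn0' : (0 : ℤ) < n := by exact_mod_cast hn0
    refine ⟨a / n, ?_⟩
    rw [Valuation.comap_apply, Valuation.comap_apply, ha, hv, ← zpow_natCast, ← zpow_mul]
    congr 1
    have hr : a % n = 0 := by
      by_contra hr
      have hpos := lt_of_le_of_ne (Int.emod_nonneg a hn0'.ne') (Ne.symm hr)
      have hlt' := Int.emod_lt_of_pos a hn0'
      obtain ⟨r, hr'⟩ := Int.eq_ofNat_of_zero_le hpos.le
      rw [hr'] at hpos hlt'
      refine Nat.find_min hex (m := r) (by exact_mod_cast hlt') ⟨by exact_mod_cast hpos,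
        x * (l₀ ^ (a / n))⁻¹, mul_ne_zero hx (inv_ne_zero (zpow_ne_zero _ hl₀)), ?_⟩
      rw [map_mul, map_mul, map_inv₀, map_inv₀, map_zpow₀, map_zpow₀, ha, hv, ← zpow_natCast,
        ← zpow_natCast, ← zpow_mul, ← zpow_neg, ← zpow_add₀ hw.pos.ne']
      congr 1
      have := Int.mul_ediv_add_emod a n
      change a % n = r at hr'
      rw [← hr']
      linarith
    have := Int.mul_ediv_add_emod a n
    rw [hr] at this
    linarith

lemma PrincipalClass.exists_sq {w : Valuation M Γ} {x : M} (hx : x ∈ PrincipalClass w)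
    (h1 : w x = 1) : ∃ m z, w m < 1 ∧ w z = 1 ∧ x = (1 + m) * z ^ 2 := by
  obtain ⟨m, z, hz, hm, rfl⟩ := hx
  refine ⟨m, z, hm, ?_, rfl⟩
  rw [map_mul, Valuation.map_one_add_of_lt w hm, one_mul, map_pow] at h1
  exact eq_one_of_sq_eq_one₀ h1

end Comap

section Triple

variable {N : Type*} [Field N] {A : ValuationSubring N} {ϖ : N} (hw : IsUnif A.valuation ϖ)
  {L : Type*} [Field L] (j : L →+* RatFunc N)

lemma exists_gaussRes_ne_C {P : Polynomial L} (hP : P ≠ 0) (hPX : P.eval₂ j RatFunc.X = 0) :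
    ∃ (l : L) (hl : j l ∈ gaussSubring hw), ∀ c, gaussRes hw ⟨j l, hl⟩ ≠ RatFunc.C c := by
  by_contra! hcon
  set W := (gaussSubring hw).valuation
  obtain ⟨i, hi, hmax⟩ := P.support.exists_max_image (fun i => W (j (P.coeff i)))
    (Polynomial.support_nonempty.2 hP)
  have hi0 : j (P.coeff i) ≠ 0 := (map_ne_zero _).2 (Polynomial.mem_support_iff.1 hi)
  have hpos : 0 < W (j (P.coeff i)) := by rwa [zero_lt_iff, Valuation.ne_zero_iff]
  have hmem : ∀ n, j (P.coeff n / P.coeff i) ∈ gaussSubring hw := fun n => by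
    rw [← ValuationSubring.valuation_le_one_iff, map_div₀, map_div₀]
    apply div_le_one_of_le₀ _ hpos.le
    by_cases hn : n ∈ P.support
    · exact hmax n hn
    · rw [Polynomial.notMem_support_iff.1 hn, map_zero, map_zero]; exact zero_le
  choose c hc using fun n => hcon _ (hmem n)
  have h0 : ∑ n ∈ P.support, (⟨_, hmem n⟩ * ⟨RatFunc.X, X_mem_gaussSubring hw⟩ ^ n :
      gaussSubring hw) = 0 := by
    apply Subtype.ext
    rw [AddSubmonoidClass.coe_finsetSum]
    rw [Polynomial.eval₂_eq_sum, Polynomial.sum_def] at hPX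
    change ∑ n ∈ P.support, j (P.coeff n / P.coeff i) * RatFunc.X ^ n = 0
    have : ∀ n, j (P.coeff n / P.coeff i) * RatFunc.X ^ n =
        (j (P.coeff i))⁻¹ * (j (P.coeff n) * RatFunc.X ^ n) := fun n => by
      rw [map_div₀]; ring
    simp_rw [this]
    rw [← Finset.mul_sum, hPX, mul_zero]
  have h1 := congrArg (gaussRes hw) h0
  simp only [map_sum, map_mul, map_pow, map_zero, hc, gaussRes_X] at h1
  have h2 : ∑ n ∈ P.support, Polynomial.monomial n (c n) = 0 := by
    apply RatFunc.algebraMap_injective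
    rw [map_zero, ← h1, map_sum]
    refine Finset.sum_congr rfl fun n _ => ?_
    rw [← Polynomial.C_mul_X_pow_eq_monomial, map_mul, map_pow, RatFunc.algebraMap_C,
      RatFunc.algebraMap_X]
  have h3 := congrArg (fun Q => Polynomial.coeff Q i) h2
  simp only [Polynomial.finsetSum_coeff, Polynomial.coeff_monomial, Finset.sum_ite_eq', hi, if_true,
    Polynomial.coeff_zero] at h3
  have h4 := hc i
  rw [h3, map_zero, gaussRes_eq_zero_iff] at h4
  simp only [div_self (Polynomial.mem_support_iff.1 hi), map_one, lt_self_iff_false] at h4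

theorem hasTriple_comap_gauss {P : Polynomial L} (hP : P ≠ 0) (hPX : P.eval₂ j RatFunc.X = 0) :
    HasTriple ((gaussSubring hw).valuation.comap j) := by
  classical
  set W := (gaussSubring hw).valuation with hW
  have hex : ∃ n, ∃ (l : L) (hl : j l ∈ gaussSubring hw),
      (∀ c, gaussRes hw ⟨j l, hl⟩ ≠ RatFunc.C c) ∧ HeightLE (gaussRes hw ⟨j l, hl⟩) n := by
    obtain ⟨l, hl, h⟩ := exists_gaussRes_ne_C hw j hP hPX
    obtain ⟨n, hn⟩ := exists_heightLE (gaussRes hw ⟨j l, hl⟩)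
    exact ⟨n, l, hl, h, hn⟩
  obtain ⟨l, hl, hC, hn⟩ := Nat.find_spec hex
  have hmin := fun m hm => Nat.find_min hex (m := m) hm
  set n := Nat.find hex
  set z := gaussRes hw ⟨j l, hl⟩ with hz
  have hn0 : 0 < n := by
    rw [Nat.pos_iff_ne_zero]
    intro h0
    rw [h0] at hn
    obtain ⟨c, hc⟩ := hn.exists_eq_C
    exact hC c hc
  have hW1 : ∀ (x : L) (hx : j x ∈ gaussSubring hw), gaussRes hw ⟨j x, hx⟩ ≠ 0 → W (j x) = 1 := by
    intro x hx h
    refine le_antisymm (((gaussSubring hw).valuation_le_one_iff _).2 hx) (not_lt.1 fun h' => h ?_)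
    exact (gaussRes_eq_zero_iff hw ⟨j x, hx⟩).2 h'
  have hCsq : ∀ (x : L) (hx : j x ∈ gaussSubring hw),
      HeightLE (gaussRes hw ⟨j x, hx⟩) n → (∀ c, gaussRes hw ⟨j x, hx⟩ ≠ RatFunc.C c) →
      x ∉ PrincipalClass (W.comap j) := by
    intro x hx hh hc hP
    have hx0 : gaussRes hw ⟨j x, hx⟩ ≠ 0 := fun h => hc 0 (by rw [h, map_zero])
    obtain ⟨m, u, hm, hu, hxe⟩ := PrincipalClass.exists_sq hP (hW1 x hx hx0)
    have hu' : j u ∈ gaussSubring hw := ((gaussSubring hw).valuation_le_one_iff _).1 hu.le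
    have hm' : j m ∈ gaussSubring hw := ((gaussSubring hw).valuation_le_one_iff _).1 hm.le
    have he : gaussRes hw ⟨j x, hx⟩ = gaussRes hw ⟨j u, hu'⟩ ^ 2 := by
      have : (⟨j x, hx⟩ : gaussSubring hw) = (1 + ⟨j m, hm'⟩) * ⟨j u, hu'⟩ ^ 2 := by
        apply Subtype.ext
        change j x = (1 + j m) * j u ^ 2
        rw [hxe]; simp
      rw [this, map_mul, map_add, map_one, (gaussRes_eq_zero_iff hw ⟨j m, hm'⟩).2 hm, map_pow,
        add_zero, one_mul]
    rw [he] at hh hc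
    refine hmin (n / 2) (Nat.div_lt_self hn0 one_lt_two) ⟨u, hu', ?_, hh.sqrt⟩
    intro c hcu
    exact hc (c ^ 2) (by rw [hcu, map_pow])
  have hz0 : z ≠ 0 := fun h => hC 0 (by rw [h, map_zero])
  have hWl : W (j l) = 1 := hW1 l hl hz0
  have hl0 : l ≠ 0 := by rintro rfl; simp at hWl
  have h1l : j (1 + l) ∈ gaussSubring hw := by
    rw [map_add, map_one]; exact add_mem (one_mem _) hl
  have hr1 : gaussRes hw ⟨j (1 + l), h1l⟩ = 1 + z := by
    rw [hz, ← map_one (gaussRes hw), ← map_add]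
    congr 1
    apply Subtype.ext
    change j (1 + l) = 1 + j l
    rw [map_add, map_one]
  have h1z0 : 1 + z ≠ 0 := fun h => hC (-1) (by rw [map_neg, map_one]; linear_combination h)
  have hil : j l⁻¹ ∈ gaussSubring hw := by
    rw [← ValuationSubring.valuation_le_one_iff, map_inv₀, map_inv₀, ← hW, hWl, inv_one]
  have hri : gaussRes hw ⟨j l⁻¹, hil⟩ = z⁻¹ := by
    apply eq_inv_of_mul_eq_one_left
    rw [hz, ← map_mul, ← map_one (gaussRes hw)]
    congr 1
    apply Subtype.ext
    change j l⁻¹ * j l = 1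
    rw [← map_mul, inv_mul_cancel₀ hl0, map_one]
  have h1il : j (1 + l⁻¹) ∈ gaussSubring hw := by
    rw [map_add, map_one]; exact add_mem (one_mem _) hil
  have hr1i : gaussRes hw ⟨j (1 + l⁻¹), h1il⟩ = 1 + z⁻¹ := by
    rw [← hri, ← map_one (gaussRes hw), ← map_add]
    congr 1
    apply Subtype.ext
    change j (1 + l⁻¹) = 1 + j l⁻¹
    rw [map_add, map_one]
  have hnl : j (-l) ∈ gaussSubring hw := by rw [map_neg]; exact neg_mem hl
  have hrn : gaussRes hw ⟨j (-l), hnl⟩ = -z := by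
    rw [hz, ← map_neg]
    congr 1
    apply Subtype.ext
    change j (-l) = - j l
    rw [map_neg]
  refine ⟨l, hWl, ?_, ?_, ?_, ?_⟩
  · exact hW1 _ h1l (by rw [hr1]; exact h1z0)
  · refine hCsq _ hnl (by rw [hrn]; exact hn.neg) fun c hc => hC (-c) ?_
    rw [hrn] at hc
    rw [map_neg, ← hc, neg_neg]
  · refine hCsq _ h1l (by rw [hr1]; exact hn.one_add) fun c hc => hC (c - 1) ?_
    rw [hr1] at hc
    rw [map_sub, ← hc, map_one]; ring
  · intro hP
    refine hCsq _ h1il (by rw [hr1i]; exact (hn.inv hz0).one_add) (fun c hc => hC (c - 1)⁻¹ ?_) ?_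
    · rw [hr1i] at hc
      rw [map_inv₀, map_sub, ← hc, map_one, add_sub_cancel_left, inv_inv]
    · have := PrincipalClass.mul hP (PrincipalClass.sq (w := W.comap j) (inv_ne_zero hl0))
      convert this using 1
      field_simp
      ring

end Triple

lemma IsUnif.of_isEquiv {N Γ Γ' : Type*} [Field N] [LinearOrderedCommGroupWithZero Γ]
    [LinearOrderedCommGroupWithZero Γ'] {v : Valuation N Γ} {v' : Valuation N Γ'}
    (h : v.IsEquiv v') {ϖ : N} (hv : IsUnif v ϖ) : IsUnif v' ϖ where
  lt_one := h.lt_one_iff_lt_one.1 hv.lt_one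
  ne_zero := hv.ne_zero
  exists_zpow x hx := by
    obtain ⟨n, hn⟩ := hv.exists_zpow x hx
    refine ⟨n, ?_⟩
    rw [← map_zpow₀] at hn ⊢
    exact h.eq_iff.1 hn

/-- A number field has a discrete valuation ring in which a given prime is not a unit. -/
lemma NumberField.exists_isUnif (N : Type*) [Field N] [NumberField N] :
    ∃ (A : ValuationSubring N) (ϖ : N), IsUnif A.valuation ϖ ∧ A.valuation 2 < 1 := by
  have h2 : (Ideal.span {(2 : ℤ)}).IsMaximal := Int.ideal_span_isMaximal_of_prime 2
  obtain ⟨I, hI, hI2⟩ := Ideal.exists_maximal_ideal_liesOver_of_isIntegral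
    (S := NumberField.RingOfIntegers N) (Ideal.span {(2 : ℤ)})
  have hmem : (2 : NumberField.RingOfIntegers N) ∈ I := by
    have : algebraMap ℤ (NumberField.RingOfIntegers N) 2 ∈ I := by
      rw [← Ideal.mem_comap, ← Ideal.under_def, ← hI2.over]
      exact Ideal.mem_span_singleton_self 2
    simpa using this
  have hI0 : I ≠ ⊥ := by
    rintro rfl
    rw [Ideal.mem_bot] at hmem
    exact two_ne_zero hmem
  let P : IsDedekindDomain.HeightOneSpectrum (NumberField.RingOfIntegers N) :=
    ⟨I, hI.isPrime, hI0⟩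
  obtain ⟨ϖ, hϖ⟩ := P.valuation_exists_uniformizer N
  have hu : IsUnif (P.valuation N) ϖ := by
    refine ⟨?_, ?_, fun x hx => ?_⟩
    · rw [hϖ, ← WithZero.exp_zero, WithZero.exp_lt_exp]; norm_num
    · rintro rfl
      rw [map_zero] at hϖ
      exact WithZero.exp_ne_zero hϖ.symm
    · obtain ⟨n, hn⟩ : ∃ n : ℤ, P.valuation N x = WithZero.exp n :=
        ⟨_, (WithZero.exp_log ((Valuation.ne_zero_iff _).2 hx)).symm⟩
      refine ⟨-n, ?_⟩
      rw [hn, hϖ, ← WithZero.exp_zsmul]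
      simp
  have he := (P.valuation N).isEquiv_valuation_valuationSubring
  refine ⟨(P.valuation N).valuationSubring, ϖ, hu.of_isEquiv he, he.lt_one_iff_lt_one.1 ?_⟩
  have := (P.valuation_lt_one_iff_mem (K := N) 2).2 hmem
  have h2 : algebraMap (NumberField.RingOfIntegers N) N 2 = 2 := map_ofNat _ 2
  rw [← h2]
  exact this

/-- The substitution `X ↦ q` in `N(X)`, for a nonconstant polynomial `q`. -/
def ratSubst {N : Type*} [Field N] (q : Polynomial N) (hq : q.natDegree ≠ 0) :
    RatFunc N →+* RatFunc N :=
  RatFunc.mapRingHom (Polynomial.compRingHom q) fun P hP => by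
    rw [Submonoid.mem_comap, mem_nonZeroDivisors_iff_ne_zero, Polynomial.coe_compRingHom_apply, Ne,
      Polynomial.comp_eq_zero_iff]
    rintro (h | ⟨-, h⟩)
    · exact nonZeroDivisors.ne_zero hP h
    · rw [h, Polynomial.natDegree_C] at hq
      exact hq rfl

lemma ratSubst_algebraMap {N : Type*} [Field N] (q : Polynomial N) (hq : q.natDegree ≠ 0)
    (P : Polynomial N) :
    ratSubst q hq (algebraMap _ _ P) = algebraMap _ (RatFunc N) (P.comp q) := by
  have := RatFunc.map_apply_div (Polynomial.compRingHom q) (fun P hP => by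
    rw [Submonoid.mem_comap, mem_nonZeroDivisors_iff_ne_zero, Polynomial.coe_compRingHom_apply, Ne,
      Polynomial.comp_eq_zero_iff]
    rintro (h | ⟨-, h⟩)
    · exact nonZeroDivisors.ne_zero hP h
    · rw [h, Polynomial.natDegree_C] at hq
      exact hq rfl) P 1
  rw [map_one, map_one, map_one, div_one, div_one] at this
  exact this

/-- If the slope of a line through a rational point is `a + bX`, then `X` is algebraic over the
function field of the conic. -/
lemma exists_eval₂_X {L N : Type*} [Field L] [CharZero L] [Field N] [CharZero N]
    (hN : ∀ n : N, IsAlgebraic ℚ n) (j : L →+* RatFunc N) {l₁ l₂ : L} {s t a b : N} (hb : b ≠ 0)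
    (hne : j l₁ ≠ RatFunc.C s)
    (h : (RatFunc.C a + RatFunc.C b * RatFunc.X) * (j l₁ - RatFunc.C s) = j l₂ - RatFunc.C t) :
    ∃ P : Polynomial L, P ≠ 0 ∧ P.eval₂ j RatFunc.X = 0 := by
  let := j.toAlgebra
  have hC : ∀ n : N, IsAlgebraic L (RatFunc.C n) := fun n => by
    obtain ⟨P, hP0, hP⟩ := hN n
    refine ⟨P.map (algebraMap ℚ L), ?_, ?_⟩
    · rwa [Ne, Polynomial.map_eq_zero_iff (algebraMap ℚ L).injective]
    · have := congrArg (RatFunc.C : N →+* RatFunc N) hP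
      rw [Polynomial.aeval_def, Polynomial.hom_eval₂, map_zero] at this
      rw [Polynomial.aeval_def, Polynomial.eval₂_map, ← this]
      congr 1
      exact Subsingleton.elim _ _
  have hj : ∀ l, IsAlgebraic L (j l) := fun l => isAlgebraic_algebraMap l
  have hX : RatFunc.X = ((j l₂ - RatFunc.C t) * (j l₁ - RatFunc.C s)⁻¹ - RatFunc.C a) *
      (RatFunc.C b)⁻¹ := by
    have h1 : j l₁ - RatFunc.C s ≠ 0 := sub_ne_zero.2 hne
    have h2 : (RatFunc.C b : RatFunc N) ≠ 0 := (map_ne_zero _).2 hb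
    rw [← h]
    field_simp
    ring
  have hXa : IsAlgebraic L (RatFunc.X : RatFunc N) := by
    rw [hX]
    exact ((((hj _).sub (hC _)).mul ((hj _).sub (hC _)).inv).sub (hC _)).mul (hC _).inv
  obtain ⟨P, hP, hP'⟩ := hXa
  exact ⟨P, hP, hP'⟩

section Subst

variable {N : Type*} [Field N]

lemma natDegree_linear {a b : N} (hb : b ≠ 0) :
    (Polynomial.C b * Polynomial.X + Polynomial.C a).natDegree ≠ 0 := by
  rw [Polynomial.natDegree_linear hb]; exact one_ne_zero

lemma IsUnif.exists_le {M Γ : Type*} [Field M] [LinearOrderedCommGroupWithZero Γ]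
    {w : Valuation M Γ} {ϖ : M} (hw : IsUnif w ϖ) (x : M) : ∃ n : ℕ, w x * w ϖ ^ n ≤ 1 := by
  by_cases hx : x = 0
  · exact ⟨0, by simp [hx]⟩
  obtain ⟨a, ha⟩ := hw.exists_zpow x hx
  refine ⟨a.natAbs, ?_⟩
  rw [ha, ← zpow_natCast, ← zpow_add₀ hw.pos.ne']
  have h1 := zpow_le_zpow_iff_right_of_lt_one₀ hw.pos hw.lt_one (m := a + a.natAbs) (n := 0)
  rw [zpow_zero] at h1
  exact h1.2 (by omega)

variable {A : ValuationSubring N} {ϖ : N} (hw : IsUnif A.valuation ϖ)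

lemma gauss_subst_le (β : N) (R : Polynomial N) : ∃ n : ℕ, ∀ b ≠ 0, A.valuation b ≤ 1 →
    (gaussSubring hw).valuation
      (algebraMap _ _ (R.comp (Polynomial.C b * Polynomial.X + Polynomial.C β))) *
        (gaussSubring hw).valuation (RatFunc.C ϖ) ^ n ≤ 1 := by
  have hu := isUnif_gauss hw
  set W := (gaussSubring hw).valuation
  induction R using Polynomial.induction_on' with
  | add P Q hP hQ =>
    obtain ⟨n, hn⟩ := hP
    obtain ⟨m, hm⟩ := hQ
    refine ⟨max n m, fun b hb hb' => ?_⟩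
    have key : ∀ {g : RatFunc N} {n k : ℕ}, W g * W (RatFunc.C ϖ) ^ n ≤ 1 → n ≤ k →
        W (g * RatFunc.C ϖ ^ k) ≤ 1 := by
      intro g n k h hk
      obtain ⟨i, rfl⟩ := Nat.exists_eq_add_of_le hk
      rw [map_mul, map_pow, pow_add, ← mul_assoc]
      exact mul_le_one' h (pow_le_one' hu.lt_one.le _)
    rw [Polynomial.add_comp, map_add, ← map_pow, ← map_mul, add_mul]
    exact W.map_add_le (key (hn b hb hb') (le_max_left _ _)) (key (hm b hb hb') (le_max_right _ _))
  | monomial i a =>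
    obtain ⟨n₁, hn₁⟩ := hu.exists_le (RatFunc.C a)
    obtain ⟨n₂, hn₂⟩ := hu.exists_le (RatFunc.C β)
    refine ⟨n₁ + n₂ * i, fun b hb hb' => ?_⟩
    have hX : W (RatFunc.X) ≤ 1 := ((gaussSubring hw).valuation_le_one_iff _).2
      (X_mem_gaussSubring hw)
    have hCb : W (RatFunc.C b) ≤ 1 := by
      rcases hb'.lt_or_eq with h | h
      · exact (gauss_lt_one hw h).le
      · exact (gauss_eq_one hw h).le
    have h : algebraMap _ (RatFunc N) ((Polynomial.monomial i a).comp
        (Polynomial.C b * Polynomial.X + Polynomial.C β)) =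
        RatFunc.C a * (RatFunc.C b * RatFunc.X + RatFunc.C β) ^ i := by
      simp [Polynomial.monomial_comp]
    rw [h, map_mul, map_pow, pow_add, pow_mul, mul_mul_mul_comm, ← mul_pow]
    refine mul_le_one' hn₁ (pow_le_one' ?_ _)
    rw [← map_pow, ← map_mul, add_mul]
    refine W.map_add_le ?_ (by rw [map_mul, map_pow]; exact hn₂)
    rw [map_mul, map_mul, map_pow]
    exact mul_le_one' (mul_le_one' hCb hX) (pow_le_one' hu.lt_one.le _)

/-- Near a point where it does not vanish, a polynomial is almost constant. -/
lemma exists_subst_eq {β : N} {Q : Polynomial N} (hQ : Q.eval β ≠ 0) : ∃ b ≠ 0, ∃ μ : RatFunc N,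
    (gaussSubring hw).valuation μ < 1 ∧
      algebraMap _ _ (Q.comp (Polynomial.C b * Polynomial.X + Polynomial.C β)) =
        RatFunc.C (Q.eval β) * (1 + μ) := by
  have hu := isUnif_gauss hw
  obtain ⟨R, hR⟩ : Polynomial.X - Polynomial.C β ∣ Q - Polynomial.C (Q.eval β) := by
    rw [Polynomial.dvd_iff_isRoot]; simp
  obtain ⟨n, hn⟩ := gauss_subst_le hw β R
  set W := (gaussSubring hw).valuation
  obtain ⟨m, hm⟩ := hu.exists_le (RatFunc.C (Q.eval β))⁻¹
  have hb : ϖ ^ (n + m + 1) ≠ 0 := pow_ne_zero _ hw.ne_zero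
  have hc : (RatFunc.C (Q.eval β) : RatFunc N) ≠ 0 := (map_ne_zero _).2 hQ
  refine ⟨ϖ ^ (n + m + 1), hb, (RatFunc.C (Q.eval β))⁻¹ * (RatFunc.C (ϖ ^ (n + m + 1)) * RatFunc.X *
    algebraMap _ _ (R.comp (Polynomial.C (ϖ ^ (n + m + 1)) * Polynomial.X + Polynomial.C β))),
    ?_, ?_⟩
  · have h1 := hn _ hb (by rw [map_pow]; exact pow_le_one' hw.lt_one.le _)
    set r := W (algebraMap _ _ (R.comp (Polynomial.C (ϖ ^ (n + m + 1)) * Polynomial.X +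
      Polynomial.C β)))
    have hX : W (RatFunc.X) ≤ 1 := ((gaussSubring hw).valuation_le_one_iff _).2
      (X_mem_gaussSubring hw)
    have h2 : W (RatFunc.C (Q.eval β))⁻¹ * (W (RatFunc.C (ϖ ^ (n + m + 1))) * W RatFunc.X * r) =
        (W (RatFunc.C (Q.eval β))⁻¹ * W (RatFunc.C ϖ) ^ m) * (r * W (RatFunc.C ϖ) ^ n) *
          W RatFunc.X * W (RatFunc.C ϖ) := by
      rw [map_pow, map_pow, pow_add, pow_add, pow_one]
      ac_rfl
    rw [map_mul, map_mul, map_mul, h2]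
    calc _ ≤ 1 * W (RatFunc.C ϖ) :=
          mul_le_mul_left (mul_le_one' (mul_le_one' hm h1) hX) _
      _ < 1 := by rw [one_mul]; exact hu.lt_one
  · rw [mul_add, mul_one, mul_inv_cancel_left₀ hc, ← sub_eq_iff_eq_add']
    have := congrArg (fun P => algebraMap _ (RatFunc N)
      (P.comp (Polynomial.C (ϖ ^ (n + m + 1)) * Polynomial.X + Polynomial.C β))) hR
    simp only [Polynomial.sub_comp, Polynomial.mul_comp, Polynomial.X_comp, Polynomial.C_comp,
      map_sub, map_mul, RatFunc.algebraMap_C, RatFunc.algebraMap_X, add_sub_cancel_right] at this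
    exact this

lemma not_odd_of_sq {M : ℕ} {c u : N} (hu : A.valuation u = 1) {e : ℤ} (hc : c = ϖ ^ e * u)
    {μ ν Y : RatFunc N} (hμ : (gaussSubring hw).valuation μ < 1)
    (hν : (gaussSubring hw).valuation ν < 1)
    (h : (1 + ν) * Y ^ 2 = RatFunc.C c * RatFunc.X ^ M * (1 + μ)) : ¬ Odd M := by
  have hun := isUnif_gauss hw
  set W := (gaussSubring hw).valuation with hW
  have hu' := gauss_eq_one hw hu
  have hC : (RatFunc.C ϖ : RatFunc N) ≠ 0 := (map_ne_zero _).2 hw.ne_zero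
  have hresX := gaussRes_X hw
  have hX1 : W RatFunc.X = 1 := by
    refine le_antisymm (((gaussSubring hw).valuation_le_one_iff _).2 (X_mem_gaussSubring hw))
      (not_lt.1 fun h0 => ?_)
    rw [(gaussRes_eq_zero_iff hw ⟨_, X_mem_gaussSubring hw⟩).2 h0] at hresX
    exact RatFunc.X_ne_zero hresX.symm
  have hWs : W Y ^ 2 = W (RatFunc.C ϖ) ^ e := by
    have := congrArg W h
    rw [map_mul, map_mul, map_mul, Valuation.map_one_add_of_lt W hν,
      Valuation.map_one_add_of_lt W hμ, map_pow, map_pow, hX1, hc, map_mul, map_mul, map_zpow₀,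
      map_zpow₀, hu'] at this
    simpa using this
  have hY0 : Y ≠ 0 := by
    rintro rfl
    rw [map_zero, zero_pow two_ne_zero] at hWs
    exact zpow_ne_zero e hun.pos.ne' hWs.symm
  obtain ⟨n, hn⟩ := hun.exists_zpow Y hY0
  have he : e = n * 2 := by
    rw [hn, ← zpow_natCast, ← zpow_mul] at hWs
    exact (hun.zpow_inj hWs).symm
  set Z := Y * (RatFunc.C ϖ ^ n)⁻¹ with hZ
  have hCn := zpow_ne_zero n hC
  have hYZ : Y = Z * RatFunc.C ϖ ^ n := by rw [hZ, inv_mul_cancel_right₀ hCn]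
  have hZ1 : W Z = 1 := by
    rw [hZ, map_mul, map_inv₀, map_zpow₀, hn, mul_inv_cancel₀ (zpow_ne_zero n hun.pos.ne')]
  have h' : (1 + ν) * Z ^ 2 = RatFunc.C u * RatFunc.X ^ M * (1 + μ) := by
    have h2 : (RatFunc.C ϖ ^ n) ^ 2 = RatFunc.C (ϖ ^ e) := by
      rw [he, map_zpow₀, zpow_mul]; rfl
    rw [hYZ, hc, mul_pow, h2, map_mul] at h
    apply mul_right_cancel₀ ((map_ne_zero RatFunc.C).2 (zpow_ne_zero e hw.ne_zero))
    rw [mul_assoc, h]; ring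
  have hmem : ∀ g, W g ≤ 1 → g ∈ gaussSubring hw := fun g hg =>
    ((gaussSubring hw).valuation_le_one_iff _).1 hg
  have hlift : (1 + ⟨ν, hmem _ hν.le⟩) * (⟨Z, hmem _ hZ1.le⟩ : gaussSubring hw) ^ 2 =
      ⟨RatFunc.C u, hmem _ hu'.le⟩ * ⟨RatFunc.X, X_mem_gaussSubring hw⟩ ^ M *
        (1 + ⟨μ, hmem _ hμ.le⟩) := Subtype.ext h'
  have hres := congrArg (gaussRes hw) hlift
  have huA : u ∈ A := (A.valuation_le_one_iff _).1 hu.le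
  rw [map_mul (gaussRes hw), map_mul (gaussRes hw), map_mul (gaussRes hw), map_add (gaussRes hw),
    map_add (gaussRes hw), map_pow (gaussRes hw), map_pow (gaussRes hw), map_one,
    (gaussRes_eq_zero_iff hw ⟨ν, _⟩).2 hν, (gaussRes_eq_zero_iff hw ⟨μ, _⟩).2 hμ, hresX, add_zero,
    one_mul, mul_one] at hres
  have hCu := gaussRes_C hw ⟨u, huA⟩
  have hu0 : residue A ⟨u, huA⟩ ≠ 0 := fun h0 => by
    rw [valuationSubring_residue_eq_zero_iff] at h0
    exact h0.ne hu
  have hz0 : gaussRes hw ⟨Z, hmem _ hZ1.le⟩ ≠ 0 := fun h0 => by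
    rw [gaussRes_eq_zero_iff] at h0
    exact h0.ne hZ1
  have hdeg : ∀ (z : RatFunc (ResidueField A)) (n : ℕ), z ≠ 0 →
      (z ^ n).intDegree = n * z.intDegree := by
    intro z n hz
    induction n with
    | zero => simp
    | succ n ih =>
      rw [pow_succ, RatFunc.intDegree_mul (pow_ne_zero n hz) hz, ih]; push_cast; ring
  have hd := congrArg RatFunc.intDegree hres
  rw [hCu, RatFunc.intDegree_mul ((map_ne_zero _).2 hu0) (pow_ne_zero _ RatFunc.X_ne_zero),
    hdeg _ _ hz0, hdeg _ _ RatFunc.X_ne_zero, RatFunc.intDegree_C, RatFunc.intDegree_X] at hd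
  rintro ⟨t, rfl⟩
  push_cast at hd
  omega

end Subst

/-- A function on a conic that is not a square up to a constant is not a square near the generic
point of some component of a dyadic fibre. -/
theorem IsConic.exists_notMem_principalClass {c d : ℚ} {L : Type*} [Field L] [CharZero L] {x y : L}
    (h : IsConic c d x y) {f : L} (hf0 : f ≠ 0)
    (hf : ¬ ∃ (q : ℚ) (l : L), l ≠ 0 ∧ f = q * l ^ 2) :
    ∃ (Γ : Type) (_ : LinearOrderedCommGroupWithZero Γ) (w : Valuation L Γ) (ϖ : L),
      IsUnif w ϖ ∧ HasTriple w ∧ w 2 < 1 ∧ f ∉ PrincipalClass w := by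
  obtain ⟨N, _, _, j, β, m, Q, E, ⟨s, hs1, hs2⟩, hm, hQ, hE, hfE⟩ := h.exists_odd_root hf0 hf
  obtain ⟨A, ϖ, hw, h2⟩ := NumberField.exists_isUnif N
  obtain ⟨b, hb, μ, hμ, hQb⟩ := exists_subst_eq hw hQ
  let φ := ratSubst (Polynomial.C b * Polynomial.X + Polynomial.C β) (natDegree_linear hb)
  have hφC : ∀ n, φ (RatFunc.C n) = RatFunc.C n := fun n => by
    rw [← RatFunc.algebraMap_C, ratSubst_algebraMap, Polynomial.C_comp]
  have hφX : φ RatFunc.X = RatFunc.C b * RatFunc.X + RatFunc.C β := by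
    rw [← RatFunc.algebraMap_X, ratSubst_algebraMap, Polynomial.X_comp]; simp
  let j' := φ.comp j
  obtain ⟨P, hP, hPX⟩ := exists_eval₂_X (l₁ := x) (l₂ := y) (s := s) (t := 0) (a := β)
    (fun n => Algebra.IsAlgebraic.isAlgebraic n) j' hb
    (fun h0 => hs1 (φ.injective (by rw [hφC]; exact h0))) (by
      have := congrArg φ hs2
      rw [map_mul, map_sub, hφX, hφC] at this
      rw [map_zero, sub_zero, add_comm]
      exact this)
  have hW2 : (gaussSubring hw).valuation (j' 2) < 1 := by
    have := gauss_lt_one hw h2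
    rwa [map_ofNat] at this ⊢
  obtain ⟨l₀, hl₀⟩ := (isUnif_gauss hw).exists_comap j' two_ne_zero hW2
  refine ⟨_, _, _, l₀, hl₀, hasTriple_comap_gauss hw j' hP hPX, hW2, ?_⟩
  rintro ⟨n, z, hz, hn, hfz⟩
  have hc0 : b ^ m * Q.eval β ≠ 0 := mul_ne_zero (pow_ne_zero m hb) hQ
  obtain ⟨e, he⟩ := hw.exists_zpow _ hc0
  rw [← map_zpow₀] at he
  have hϖe : ϖ ^ e ≠ 0 := zpow_ne_zero e hw.ne_zero
  refine not_odd_of_sq hw (u := (ϖ ^ e)⁻¹ * (b ^ m * Q.eval β)) (e := e) (c := b ^ m * Q.eval β)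
    ?_ (mul_inv_cancel_left₀ hϖe _).symm hμ (ν := j' n) hn
    (Y := j' z * φ (algebraMap _ _ E)) ?_ hm
  · rw [map_mul, map_inv₀, he, inv_mul_cancel₀ ((Valuation.ne_zero_iff _).2 hϖe)]
  · have h1 := congrArg φ hfE
    have h2 : φ (j f) = (1 + j' n) * j' z ^ 2 := by
      change j' f = _
      rw [hfz]; simp
    rw [map_mul, map_pow, h2, ratSubst_algebraMap _ _ (_ * Q), Polynomial.mul_comp, map_mul, hQb,
      Polynomial.pow_comp, Polynomial.sub_comp, Polynomial.X_comp, Polynomial.C_comp,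
      add_sub_cancel_right, map_pow, map_mul, RatFunc.algebraMap_C, RatFunc.algebraMap_X] at h1
    rw [mul_pow, ← mul_assoc, h1, map_mul, map_pow, mul_pow]
    ring

/-- Simple roots of quadratic polynomials lift to the Witt vectors. -/
lemma WittVector.exists_quadratic_root (ℓ : ℕ) [Fact ℓ.Prime] {k : Type*} [Field k] [CharP k ℓ]
    [IsAlgClosed k] {b c : ℤ} (h : ¬ (ℓ : ℤ) ∣ b ^ 2 - 4 * c) :
    ∃ z : WittVector ℓ k, z ^ 2 + b * z + c = 0 := by
  obtain ⟨t, ht⟩ := IsAlgClosed.exists_root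
    (Polynomial.X ^ 2 + Polynomial.C (b : k) * Polynomial.X + Polynomial.C (c : k)) (by
      have : (Polynomial.X ^ 2 + Polynomial.C (b : k) * Polynomial.X +
        Polynomial.C (c : k)).degree = 2 := by compute_degree!
      rw [this]; norm_num)
  have ht' : t ^ 2 + b * t + c = 0 := by simpa using ht
  have hd : 2 * t + (b : k) ≠ 0 := fun h0 => by
    have : ((b ^ 2 - 4 * c : ℤ) : k) = 0 := by
      push_cast
      linear_combination (2 * t + b) * h0 - 4 * ht'
    exact h ((CharP.intCast_eq_zero_iff k ℓ _).1 this)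
  obtain ⟨a, ha⟩ := WittVector.constantCoeff_surjective (p := ℓ) t
  let f : Polynomial (WittVector ℓ k) :=
    Polynomial.X ^ 2 + Polynomial.C (b : WittVector ℓ k) * Polynomial.X +
      Polynomial.C (c : WittVector ℓ k)
  have hf : f.Monic := by simp only [f]; monicity!
  obtain ⟨z, hz, -⟩ := HenselianRing.is_henselian (I := Ideal.span {(ℓ : WittVector ℓ k)}) f hf a
    (by
      rw [← WittVector.ker_constantCoeff, RingHom.mem_ker]
      simp only [f, Polynomial.eval_add, Polynomial.eval_mul, Polynomial.eval_pow,
        Polynomial.eval_X, Polynomial.eval_intCast, map_add, map_mul, map_pow, map_intCast, ha]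
      exact ht')
    (by
      apply IsUnit.map
      apply WittVector.isUnit_of_coeff_zero_ne_zero
      change WittVector.constantCoeff _ ≠ 0
      have hdf : f.derivative.eval a = 2 * a + b := by
        simp [f, one_add_one_eq_two]
      rw [hdf, map_add, map_mul, map_ofNat, map_intCast, ha]
      exact hd)
  exact ⟨z, by simpa [f] using hz⟩

/-- The field of algebraic numbers in a strictly unramified complete field. -/
theorem exists_unramified (ℓ : ℕ) [Fact ℓ.Prime] :
    ∃ (N : Type) (_ : Field N) (_ : CharZero N) (A : ValuationSubring N),
      IsUnif A.valuation (ℓ : N) ∧ (∀ n : N, IsAlgebraic ℚ n) ∧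
        ∀ b c : ℤ, ¬ (ℓ : ℤ) ∣ b ^ 2 - 4 * c → ∃ z : N, z ^ 2 + b * z + c = 0 := by
  let k := AlgebraicClosure (ZMod ℓ)
  let R := WittVector ℓ k
  let F := FractionRing R
  have hRF : Function.Injective (algebraMap R F) := IsFractionRing.injective R F
  have hR0 : CharZero R := charZero_of_inj_zero fun n hn => by
    by_contra h0
    obtain ⟨e, m, hm, rfl⟩ := Nat.exists_eq_pow_mul_and_not_dvd h0 ℓ
      (Fact.out : ℓ.Prime).ne_one
    rw [Nat.cast_mul, Nat.cast_pow] at hn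
    have hm0 := (mul_eq_zero.1 hn).resolve_left
      (pow_ne_zero _ (WittVector.irreducible (p := ℓ) (k := k)).ne_zero)
    have := congrArg WittVector.constantCoeff hm0
    rw [map_natCast, map_zero] at this
    exact hm ((CharP.cast_eq_zero_iff k ℓ _).1 this)
  have : CharZero F := charZero_of_injective_algebraMap hRF
  let N := algebraicClosure ℚ F
  let V := ValuationRing.valuation R F
  have hle : ∀ a : R, V (algebraMap R F a) ≤ 1 := fun a =>
    (ValuationRing.mem_integer_iff R F _).2 ⟨a, rfl⟩
  have hunit : ∀ a : Rˣ, V (algebraMap R F a) = 1 := fun a => by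
    have h1 : V (algebraMap R F a) * V (algebraMap R F (a⁻¹ : Rˣ)) = 1 := by
      rw [← map_mul, ← map_mul, Units.mul_inv, map_one, map_one]
    refine le_antisymm (hle _) ?_
    rw [← h1]
    exact mul_le_of_le_one_right' (hle _)
  have hℓ : algebraMap R F ℓ = (ℓ : F) := map_natCast _ _
  have hℓ0 : (ℓ : F) ≠ 0 := Nat.cast_ne_zero.2 (Fact.out : ℓ.Prime).ne_zero
  have hpow : ∀ a : R, a ≠ 0 → ∃ n : ℕ, V (algebraMap R F a) = V (ℓ : F) ^ n := fun a ha => by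
    obtain ⟨n, b, rfl⟩ := WittVector.exists_eq_pow_p_mul' a ha
    refine ⟨n, ?_⟩
    rw [map_mul, map_mul, map_pow, map_pow, hunit, mul_one, hℓ]
  have hV : IsUnif V (ℓ : F) := by
    refine ⟨lt_of_le_of_ne (hℓ ▸ hle _) fun h1 => ?_, hℓ0, fun x hx => ?_⟩
    · have h2 : V (ℓ : F)⁻¹ ≤ 1 := by rw [map_inv₀, h1, inv_one]
      obtain ⟨a, ha⟩ := (ValuationRing.mem_integer_iff R F _).1 h2
      refine (WittVector.irreducible (p := ℓ) (k := k)).not_isUnit (IsUnit.of_mul_eq_one a (hRF ?_))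
      rw [map_mul, ha, hℓ, mul_inv_cancel₀ hℓ0, map_one]
    · obtain ⟨a, b, hb, rfl⟩ := IsFractionRing.div_surjective (A := R) x
      have hb0 : b ≠ 0 := nonZeroDivisors.ne_zero hb
      have ha0 : a ≠ 0 := by rintro rfl; simp at hx
      obtain ⟨n, hn⟩ := hpow a ha0
      obtain ⟨m, hm⟩ := hpow b hb0
      refine ⟨n - m, ?_⟩
      rw [map_div₀, hn, hm, zpow_sub₀ ((Valuation.ne_zero_iff _).2 hℓ0), zpow_natCast, zpow_natCast]
  let v := V.comap (algebraMap N F)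
  have hv : IsUnif v (ℓ : N) := by
    have hN : algebraMap N F ℓ = (ℓ : F) := map_natCast _ _
    refine ⟨?_, ?_, fun x hx => ?_⟩
    · change V (algebraMap N F ℓ) < 1
      rw [hN]; exact hV.lt_one
    · exact Nat.cast_ne_zero.2 (Fact.out : ℓ.Prime).ne_zero
    · obtain ⟨n, hn⟩ := hV.exists_zpow (algebraMap N F x) ((map_ne_zero _).2 hx)
      refine ⟨n, ?_⟩
      change V (algebraMap N F x) = V (algebraMap N F ℓ) ^ n
      rw [hN, hn]
  refine ⟨N, inferInstance, inferInstance, v.valuationSubring,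
    hv.of_isEquiv v.isEquiv_valuation_valuationSubring, fun n => ?_, fun b c h => ?_⟩
  · obtain ⟨P, hP, hPn⟩ := (mem_algebraicClosure_iff (F := ℚ) (E := F)).1 n.2
    refine ⟨P, hP, ?_⟩
    rw [Polynomial.aeval_def, Polynomial.eval₂_eq_eval_map] at hPn ⊢
    apply (algebraMap N F).injective
    rw [map_zero, ← hPn, ← Polynomial.eval_map_apply, Polynomial.map_map]
    congr 2
  · obtain ⟨z, hz⟩ := WittVector.exists_quadratic_root ℓ (k := k) h
    have hz' : (algebraMap R F z) ^ 2 + b * algebraMap R F z + c = 0 := by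
      have := congrArg (algebraMap R F) hz
      rwa [map_add, map_add, map_mul, map_pow, map_intCast, map_intCast, map_zero] at this
    have hmem : algebraMap R F z ∈ N := by
      rw [mem_algebraicClosure_iff]
      refine ⟨Polynomial.X ^ 2 + Polynomial.C (b : ℚ) * Polynomial.X + Polynomial.C (c : ℚ), ?_, ?_⟩
      · apply Polynomial.Monic.ne_zero
        monicity!
      · simpa using hz'
    exact ⟨⟨_, hmem⟩, Subtype.ext hz'⟩

/-- Parametrization of a conic by the slopes of the lines through a point. -/
lemma IsConic.exists_slope {c d : ℚ} {L : Type*} [Field L] [CharZero L] {x y : L}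
    (h : IsConic c d x y) {N : Type*} [Field N] [CharZero N] {s t : N}
    (hst : (c : N) * s ^ 2 + d * t ^ 2 = 1) :
    ∃ j : L →+* RatFunc N, j x ≠ RatFunc.C s ∧
      RatFunc.X * (j x - RatFunc.C s) = j y - RatFunc.C t := by
  have hc : (c : N) ≠ 0 := by exact_mod_cast h.ne_zero_left
  have hd : (d : N) ≠ 0 := by exact_mod_cast h.ne_zero_right
  have hD0 : RatFunc.C (c : N) + RatFunc.C (d : N) * RatFunc.X ^ 2 ≠ 0 := by
    have h1 : Polynomial.C (c : N) + Polynomial.C (d : N) * Polynomial.X ^ 2 ≠ 0 := by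
      intro h0
      have := congrArg (fun P => Polynomial.coeff P 0) h0
      simp at this
      exact h.ne_zero_left this
    have := (RatFunc.algebraMap_injective N).ne h1
    simpa using this
  obtain ⟨l, hl⟩ : ∃ l : RatFunc N, l * (RatFunc.C (c : N) + RatFunc.C (d : N) * RatFunc.X ^ 2) =
      -2 * (RatFunc.C (c * s) + RatFunc.C (d * t) * RatFunc.X) := ⟨_, div_mul_cancel₀ _ hD0⟩
  have hlc : ∀ q : N, l ≠ RatFunc.C q := by
    intro q hq
    rw [hq] at hl
    have hq' : Polynomial.C q * (Polynomial.C (c : N) + Polynomial.C (d : N) * Polynomial.X ^ 2) =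
        -2 * (Polynomial.C (c * s) + Polynomial.C (d * t) * Polynomial.X) := by
      apply RatFunc.algebraMap_injective N
      rw [map_mul, map_mul, map_neg, map_ofNat]
      simpa using hl
    have e0 := congrArg (fun P => Polynomial.eval 0 P) hq'
    have e1 := congrArg (fun P => Polynomial.eval 1 P) hq'
    have e2 := congrArg (fun P => Polynomial.eval (-1) P) hq'
    simp at e0 e1 e2
    have hqd : q * d = 0 := by linear_combination (e1 + e2 - 2 * e0) / 2
    have hq0 : q = 0 := (mul_eq_zero.1 hqd).resolve_right hd
    subst hq0
    have hs : s = 0 := by simpa [hc] using e0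
    have ht : t = 0 := by
      have : (d : N) * t = 0 := by linear_combination (e1 - e2) / 4
      exact (mul_eq_zero.1 this).resolve_left hd
    rw [hs, ht] at hst
    simp at hst
  have h1 : (c : RatFunc N) * (RatFunc.C s + l) ^ 2 +
      (d : RatFunc N) * (RatFunc.C t + l * RatFunc.X) ^ 2 = 1 := by
    have h2 := congrArg (RatFunc.C : N →+* RatFunc N) hst
    simp only [map_add, map_mul, map_pow, map_ratCast, map_one] at h2 hl
    linear_combination h2 + l * hl
  have ht : Transcendental ℚ (RatFunc.C s + l) := by
    apply transcendental_rat_of_ne_C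
    rintro ⟨q, hq⟩
    apply hlc (q - s)
    rw [map_sub, ← hq]; ring
  obtain ⟨j, hx, hy⟩ := h.exists_ringHom h1 ht
  refine ⟨j, ?_, ?_⟩
  · rw [hx]
    intro h0
    apply hlc 0
    rw [map_zero]
    linear_combination h0
  · rw [hx, hy]; ring

/-- Up to squares, a rational number is a prime-to-`ℓ` integer, or `ℓ` times such an integer. -/
lemma Rat.exists_eq_mul_sq {ℓ : ℕ} (hℓ : ℓ.Prime) {q : ℚ} (hq : q ≠ 0) :
    ∃ (m : ℤ) (r : ℚ), r ≠ 0 ∧ ¬ (ℓ : ℤ) ∣ m ∧ (q = m * r ^ 2 ∨ q = ℓ * m * r ^ 2) := by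
  have hn : q.num * q.den ≠ 0 :=
    mul_ne_zero (Rat.num_ne_zero.2 hq) (by exact_mod_cast q.den_ne_zero)
  have hfin : FiniteMultiplicity (ℓ : ℤ) (q.num * q.den) :=
    Int.finiteMultiplicity_iff.2 ⟨by simpa using hℓ.ne_one, hn⟩
  obtain ⟨m, hm, hdvd⟩ := hfin.exists_eq_pow_mul_and_not_dvd
  have hden : (q.den : ℚ) ≠ 0 := by exact_mod_cast q.den_ne_zero
  have hℓ0 : (ℓ : ℚ) ≠ 0 := by exact_mod_cast hℓ.ne_zero
  have hq' : q = (ℓ : ℚ) ^ (multiplicity (ℓ : ℤ) (q.num * q.den)) * m * (1 / q.den) ^ 2 := by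
    have h1 : (q.num * q.den : ℚ) = ℓ ^ (multiplicity (ℓ : ℤ) (q.num * q.den)) * m := by
      exact_mod_cast hm
    rw [← h1]
    field_simp
    exact (Rat.mul_den_eq_num q)
  rcases Nat.even_or_odd' (multiplicity (ℓ : ℤ) (q.num * q.den)) with ⟨e, he | he⟩
  · refine ⟨m, ℓ ^ e * (1 / q.den), by positivity, hdvd, Or.inl ?_⟩
    rw [he] at hq'
    rw [mul_pow, ← pow_mul, mul_comm e 2, ← mul_assoc, mul_comm (m : ℚ)]
    exact hq'
  · refine ⟨m, ℓ ^ e * (1 / q.den), by positivity, hdvd, Or.inr ?_⟩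
    rw [he] at hq'
    rw [mul_pow, ← pow_mul, mul_comm e 2]
    linear_combination hq'

/-- The conic `c x² + d y² = 1` has a point over `N`. -/
def HasPoint {N : Type*} [Field N] (c d : N) : Prop := ∃ x y, c * x ^ 2 + d * y ^ 2 = 1

section HasPoint

variable {N : Type*} [Field N]

lemma HasPoint.symm {c d : N} : HasPoint c d → HasPoint d c := fun ⟨x, y, h⟩ =>
  ⟨y, x, by rw [add_comm, h]⟩

lemma HasPoint.mul_sq {c d : N} (h : HasPoint c d) {s t : N} (hs : s ≠ 0) (ht : t ≠ 0) :
    HasPoint (c * s ^ 2) (d * t ^ 2) := by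
  obtain ⟨x, y, h⟩ := h
  refine ⟨x / s, y / t, ?_⟩
  field_simp
  exact h

lemma hasPoint_one (d : N) : HasPoint 1 d := ⟨1, 0, by ring⟩

lemma hasPoint_neg {c : N} [CharZero N] (hc : c ≠ 0) : HasPoint c (-c) :=
  ⟨(1 + 1 / c) / 2, (1 - 1 / c) / 2, by field_simp; ring⟩

/-- Conics over a field in which every rational prime-to-`ℓ` quadratic has a root, for `ℓ` odd. -/
lemma hasPoint_of_odd [CharZero N] {ℓ : ℕ} (hℓ : ℓ.Prime) (h2 : ℓ ≠ 2)
    (h : ∀ b c : ℤ, ¬ (ℓ : ℤ) ∣ b ^ 2 - 4 * c → ∃ z : N, z ^ 2 + b * z + c = 0) {c d : ℚ}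
    (hc : c ≠ 0) (hd : d ≠ 0) : HasPoint (c : N) d := by
  have hsq : ∀ m : ℤ, ¬ (ℓ : ℤ) ∣ m → ∃ z : N, (m : N) = z ^ 2 := by
    intro m hm
    obtain ⟨z, hz⟩ := h 0 (-m) (by
      rw [show (0 : ℤ) ^ 2 - 4 * -m = 2 ^ 2 * m by ring]
      intro h0
      rcases (Nat.prime_iff_prime_int.1 hℓ).dvd_or_dvd h0 with h1 | h1
      · have := (Nat.prime_iff_prime_int.1 hℓ).dvd_of_dvd_pow h1
        exact h2 ((Nat.prime_dvd_prime_iff_eq hℓ Nat.prime_two).1 (by exact_mod_cast this))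
      · exact hm h1)
    refine ⟨z, ?_⟩
    push_cast at hz
    linear_combination -hz
  have hℓ0 : (ℓ : N) ≠ 0 := Nat.cast_ne_zero.2 hℓ.ne_zero
  have hcl : ∀ q : ℚ, q ≠ 0 → ∃ z : N, z ≠ 0 ∧ ((q : N) = 1 * z ^ 2 ∨ (q : N) = ℓ * z ^ 2) := by
    intro q hq
    obtain ⟨m, r, hr, hm, hqm⟩ := Rat.exists_eq_mul_sq hℓ hq
    obtain ⟨z, hz⟩ := hsq m hm
    have hr0 : (r : N) ≠ 0 := by exact_mod_cast hr
    have hz0 : z ≠ 0 := by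
      rintro rfl
      rw [zero_pow two_ne_zero, Int.cast_eq_zero] at hz
      exact hm (hz ▸ dvd_zero _)
    refine ⟨z * r, mul_ne_zero hz0 hr0, hqm.imp ?_ ?_⟩
    · rintro rfl
      push_cast
      rw [hz]; ring
    · rintro rfl
      push_cast
      rw [hz]; ring
  have hℓℓ : HasPoint (ℓ : N) ℓ := by
    obtain ⟨i, hi⟩ := hsq (-1) fun h0 => hℓ.ne_one (by
      simpa using Int.isUnit_iff_natAbs_eq.1 (isUnit_of_dvd_unit h0 (by simp)))
    push_cast at hi
    refine ⟨(1 + 1 / ℓ) / 2, i * (1 - 1 / ℓ) / 2, ?_⟩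
    field_simp
    linear_combination (-(ℓ : N) ^ 2 + 2 * ℓ - 1) * hi
  obtain ⟨s, hs, hs'⟩ := hcl c hc
  obtain ⟨t, ht, ht'⟩ := hcl d hd
  rcases hs' with hs' | hs' <;> rcases ht' with ht' | ht' <;> rw [hs', ht']
  · exact (hasPoint_one _).mul_sq hs ht
  · exact (hasPoint_one _).mul_sq hs ht
  · exact (hasPoint_one _).symm.mul_sq hs ht
  · exact hℓℓ.mul_sq hs ht

/-- Conics over a field in which every odd rational quadratic has a root. -/
lemma hasPoint_of_two [CharZero N]
    (h : ∀ b c : ℤ, ¬ (2 : ℤ) ∣ b ^ 2 - 4 * c → ∃ z : N, z ^ 2 + b * z + c = 0) {c d : ℚ}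
    (hc : c ≠ 0) (hd : d ≠ 0) : HasPoint (c : N) d := by
  have hsq : ∀ m : ℤ, ¬ (2 : ℤ) ∣ m → ∃ z : N, (m : N) = z ^ 2 ∨ (m : N) = - z ^ 2 := by
    intro m hm
    have key : ∀ n k : ℤ, n = 4 * k + 1 → ∃ z : N, (n : N) = z ^ 2 := by
      rintro n k rfl
      obtain ⟨z, hz⟩ := h (-1) (-k) (by omega)
      refine ⟨2 * z - 1, ?_⟩
      push_cast at hz ⊢
      linear_combination -4 * hz
    rcases (by omega : m % 4 = 1 ∨ m % 4 = 3) with h1 | h1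
    · obtain ⟨z, hz⟩ := key m (m / 4) (by omega)
      exact ⟨z, Or.inl hz⟩
    · obtain ⟨z, hz⟩ := key (-m) (-m / 4) (by omega)
      refine ⟨z, Or.inr ?_⟩
      push_cast at hz
      linear_combination -hz
  have hcl : ∀ q : ℚ, q ≠ 0 → ∃ z : N, z ≠ 0 ∧ ((q : N) = 1 * z ^ 2 ∨ (q : N) = (-1) * z ^ 2 ∨
      (q : N) = 2 * z ^ 2 ∨ (q : N) = (-2) * z ^ 2) := by
    intro q hq
    obtain ⟨m, r, hr, hm, hqm⟩ := Rat.exists_eq_mul_sq Nat.prime_two hq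
    obtain ⟨z, hz⟩ := hsq m hm
    have hr0 : (r : N) ≠ 0 := by exact_mod_cast hr
    have hz0 : z ≠ 0 := by
      rintro rfl
      rw [zero_pow two_ne_zero, neg_zero, or_self, Int.cast_eq_zero] at hz
      exact hm (hz ▸ dvd_zero _)
    refine ⟨z * r, mul_ne_zero hz0 hr0, ?_⟩
    rcases hqm with rfl | rfl <;> rcases hz with hz | hz <;> push_cast <;> rw [hz]
    · exact Or.inl (by ring)
    · exact Or.inr (Or.inl (by ring))
    · exact Or.inr (Or.inr (Or.inl (by ring)))
    · exact Or.inr (Or.inr (Or.inr (by ring)))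
  obtain ⟨ω, hω⟩ := h 1 1 (by norm_num)
  push_cast at hω
  have h11 : HasPoint (-1 : N) (-1) := ⟨ω, ω ^ 2, by linear_combination (-ω ^ 2 + ω - 1) * hω⟩
  have h12 : HasPoint (-1 : N) 2 := ⟨1, 1, by norm_num⟩
  have h1n2 : HasPoint (-1 : N) (-2) := ⟨2 * ω + 1, 1, by linear_combination -4 * hω⟩
  have h22 : HasPoint (2 : N) 2 := ⟨1 / 2, 1 / 2, by norm_num⟩
  have h2n2 : HasPoint (2 : N) (-2) := hasPoint_neg two_ne_zero
  have hn2n2 : HasPoint (-2 : N) (-2) :=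
    ⟨(ω + ω ^ 2) / 2, (ω - ω ^ 2) / 2, by linear_combination (-ω ^ 2 + ω - 1) * hω⟩
  obtain ⟨s, hs, hs'⟩ := hcl c hc
  obtain ⟨t, ht, ht'⟩ := hcl d hd
  rcases hs' with hs' | hs' | hs' | hs' <;> rcases ht' with ht' | ht' | ht' | ht' <;>
    rw [hs', ht'] <;> refine HasPoint.mul_sq ?_ hs ht <;>
    first
    | exact hasPoint_one _
    | exact (hasPoint_one _).symm
    | assumption
    | exact HasPoint.symm (by assumption)

end HasPoint

/-- On the function field of a conic there is, for each prime `ℓ`, a suitable discrete valuation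
with uniformizer `ℓ`. -/
theorem IsConic.exists_isUnif_prime {c d : ℚ} {L : Type*} [Field L] [CharZero L] {x y : L}
    (h : IsConic c d x y) {ℓ : ℕ} (hℓ : ℓ.Prime) :
    ∃ (Γ : Type) (_ : LinearOrderedCommGroupWithZero Γ) (w : Valuation L Γ),
      IsUnif w (ℓ : L) ∧ HasTriple w := by
  have := Fact.mk hℓ
  obtain ⟨N, _, _, A, hw, halg, hroot⟩ := exists_unramified ℓ
  obtain ⟨s, t, hst⟩ : HasPoint (c : N) d := by
    rcases eq_or_ne ℓ 2 with rfl | h2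
    · exact hasPoint_of_two (by exact_mod_cast hroot) h.ne_zero_left h.ne_zero_right
    · exact hasPoint_of_odd hℓ h2 hroot h.ne_zero_left h.ne_zero_right
  obtain ⟨j, hj, hjX⟩ := h.exists_slope hst
  obtain ⟨P, hP, hPX⟩ := exists_eval₂_X (l₂ := y) (t := t) halg j (a := 0) (b := 1) one_ne_zero hj
    (by rw [map_zero RatFunc.C, map_one, zero_add, one_mul]; exact hjX)
  refine ⟨_, _, (gaussSubring hw).valuation.comap j, ?_, hasTriple_comap_gauss hw j hP hPX⟩
  have hu := isUnif_gauss hw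
  have hjℓ : j (ℓ : L) = RatFunc.C (ℓ : N) := by rw [map_natCast, map_natCast]
  refine ⟨?_, Nat.cast_ne_zero.2 hℓ.ne_zero, fun l hl => ?_⟩
  · rw [Valuation.comap_apply, hjℓ]; exact hu.lt_one
  · rw [Valuation.comap_apply, Valuation.comap_apply, hjℓ]
    exact hu.exists_zpow _ ((map_ne_zero j).2 hl)

section Integers

variable {F Γ : Type*} [Field F] [LinearOrderedCommGroupWithZero Γ]

lemma Valuation.map_intCast_le_one (w : Valuation F Γ) (n : ℤ) : w n ≤ 1 := by
  have h : ∀ n : ℕ, w (n : F) ≤ 1 := fun n => by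
    induction n with
    | zero => simp
    | succ n ih =>
      rw [Nat.cast_succ]
      exact w.map_add_le ih (map_one w).le
  rcases Int.eq_nat_or_neg n with ⟨m, rfl | rfl⟩
  · exact_mod_cast h m
  · rw [Int.cast_neg, Valuation.map_neg]
    exact_mod_cast h m

lemma Valuation.map_intCast_eq_one {w : Valuation F Γ} {p : ℕ} (hp : p.Prime) (hw : w (p : F) < 1)
    {n : ℤ} (hn : ¬ (p : ℤ) ∣ n) : w n = 1 := by
  obtain ⟨u, v, huv⟩ := (Nat.prime_iff_prime_int.1 hp).coprime_iff_not_dvd.2 hn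
  have h1 : w ((-u : ℤ) * p : F) < 1 := by
    rw [map_mul, mul_comm]
    exact mul_lt_one_of_lt_of_le hw (w.map_intCast_le_one _)
  have h2 : w (v : F) * w n = 1 := by
    rw [← map_mul, ← w.map_one_add_of_lt h1]
    congr 1
    have := congrArg (Int.cast : ℤ → F) huv
    push_cast at this ⊢
    linear_combination this
  refine le_antisymm (w.map_intCast_le_one _) ?_
  rw [← h2]
  exact mul_le_of_le_one_left' (w.map_intCast_le_one _)

lemma IsUnif.mul_notMem_evenClass [CharZero F] {w : Valuation F Γ} {ℓ : ℕ} (hℓ : ℓ.Prime)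
    (hw : IsUnif w (ℓ : F)) {m : ℤ} (hm : ¬ (ℓ : ℤ) ∣ m) {r : ℚ} (hr : r ≠ 0) :
    ((ℓ * m * r ^ 2 : ℚ) : F) ∉ EvenClass w := by
  intro h
  have hm1 : w (m : F) = 1 := Valuation.map_intCast_eq_one hℓ hw.lt_one hm
  have hr' : (r : F) ≠ 0 := by exact_mod_cast hr
  have h' : (ℓ : F) * m * r ^ 2 ∈ EvenClass w := by
    convert h using 1; push_cast; ring
  have h2 := EvenClass.mul (EvenClass.of_sq_mul h') (EvenClass.inv (EvenClass.of_unit hm1))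
  have hm0 : (m : F) ≠ 0 := fun h0 => by rw [h0, map_zero] at hm1; exact zero_ne_one hm1
  rw [mul_inv_cancel_right₀ hm0] at h2
  exact hw.unif_notMem h2

end Integers

section Conics

variable {K L : Type*} [Field K] [Field L] [CharZero L] {α : SqClass K ≃* SqClass L}
  {a b c d : ℚ} {x y : K} {x' y' : L}

/-- If the image of `p` has odd value at `ℓ`, then the image of any prime-to-`p` integer has even
value at `ℓ`. -/
lemma IsWittEquiv.not_corr_mul (hα : IsWittEquiv α) (hL : IsConic c d x' y') {p ℓ : ℕ}
    (hp : p.Prime) (hℓ : ℓ.Prime) {m m' n : ℤ} {r r' : ℚ} (hr : r ≠ 0) (hr' : r' ≠ 0)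
    (hm : ¬ (ℓ : ℤ) ∣ m) (hm' : ¬ (ℓ : ℤ) ∣ m') (hn : ¬ (p : ℤ) ∣ n)
    (h : Corr α (p : K) ((ℓ * m * r ^ 2 : ℚ) : L)) :
    ¬ Corr α (n : K) ((ℓ * m' * r' ^ 2 : ℚ) : L) := by
  intro h'
  obtain ⟨Γ, _, w, hw, ht⟩ := hL.exists_isUnif_prime hℓ
  obtain ⟨O, hO⟩ := exists_matched hα hw ht
  have hp1 : O.valuation (p : K) < 1 := by
    refine lt_of_le_of_ne (by exact_mod_cast O.valuation.map_intCast_le_one p) fun h1 => ?_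
    exact hw.mul_notMem_evenClass hℓ hm hr (hO.even _ _ h1 h)
  exact hw.mul_notMem_evenClass hℓ hm' hr'
    (hO.even _ _ (Valuation.map_intCast_eq_one hp hp1 hn) h')

variable [CharZero K]

/-- The image of the square class of an odd integer is constant. -/
lemma IsWittEquiv.exists_rat_of_odd (hα : IsWittEquiv α) (hK : IsConic a b x y)
    (hL : IsConic c d x' y') {n : ℤ} (hn : Odd n) : ∃ q : ℚ, Corr α (n : K) (q : L) := by
  obtain ⟨k, rfl⟩ := hn
  have hn0 : ((2 * k + 1 : ℤ) : K) ≠ 0 := by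
    rw [Int.cast_ne_zero]; omega
  obtain ⟨f, hf⟩ := Corr.exists_right (α := α) hn0
  by_contra hcon
  obtain ⟨Γ, _, w, ϖ, hw, ht, h2, hfw⟩ := hL.exists_notMem_principalClass hf.ne_zero'
    (fun ⟨q, l, hl, hq⟩ => hcon ⟨q, by
      have := hf.mul_sq_right (inv_ne_zero hl)
      rwa [hq, mul_assoc, ← mul_pow, mul_inv_cancel₀ hl, one_pow, mul_one] at this⟩)
  obtain ⟨O, hO⟩ := exists_matched hα hw ht
  have hO2 := hO.two_lt hα hw h2 hK hL
  refine hfw (hO.principal (2 * k) f ?_ (by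
    convert hf using 1; push_cast; ring))
  rw [map_mul]
  exact mul_lt_one_of_lt_of_le hO2 (O.valuation.map_intCast_le_one _)

/-- The square class of an odd integer is sent to the square class of an odd integer. -/
lemma IsWittEquiv.exists_odd (hα : IsWittEquiv α) (hK : IsConic a b x y)
    (hL : IsConic c d x' y') {n : ℤ} (hn : Odd n) : ∃ m : ℤ, Odd m ∧ Corr α (n : K) (m : L) := by
  obtain ⟨q, hq⟩ := hα.exists_rat_of_odd hK hL hn
  have hq0 : q ≠ 0 := by
    have := hq.ne_zero'
    exact_mod_cast this
  obtain ⟨m, r, hr, hm, h⟩ := Rat.exists_eq_mul_sq Nat.prime_two hq0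
  have hr' : (r : L) ≠ 0 := by exact_mod_cast hr
  refine ⟨m, by rwa [← Int.not_even_iff_odd, even_iff_two_dvd], ?_⟩
  rcases h with rfl | rfl
  · have := hq.mul_sq_right (inv_ne_zero hr')
    convert this using 1
    push_cast
    field_simp
  · exfalso
    obtain ⟨Γ, _, w, hw, ht⟩ := hL.exists_isUnif_prime Nat.prime_two
    obtain ⟨O, hO⟩ := exists_matched hα hw ht
    have h2 : w 2 < 1 := by exact_mod_cast hw.lt_one
    have hO2 := hO.two_lt hα hw h2 hK hL
    obtain ⟨k, rfl⟩ := hn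
    refine hw.mul_notMem_evenClass Nat.prime_two hm hr (PrincipalClass.even
      (hO.principal (2 * k) _ ?_ (by convert hq using 1; push_cast; ring)))
    rw [map_mul]
    exact mul_lt_one_of_lt_of_le hO2 (O.valuation.map_intCast_le_one _)

end Conics

/-- A form `X² - m Y²` with `m` not a square takes only values of even multiplicity. -/
lemma Polynomial.isSquare_of_sq_sub_eq {N : Type*} [Field N] {μ β : N} {Q : Polynomial N}
    (hQ : Q.eval β ≠ 0) (k : ℕ) : ∀ (A B E : Polynomial N) (m : ℕ), E.natDegree ≤ k → E ≠ 0 → Odd m →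
    A ^ 2 - Polynomial.C μ * E ^ 2 = (Polynomial.X - Polynomial.C β) ^ m * Q * B ^ 2 →
    ∃ z, μ = z ^ 2 := by
  induction k using Nat.strong_induction_on with
  | _ k ih =>
    intro A B E m hk hE hm h
    have h0 := congrArg (Polynomial.eval β) h
    have hm0 : m ≠ 0 := by rintro rfl; exact absurd hm (by decide)
    simp [hm0] at h0
    by_cases hEβ : E.eval β = 0
    · have hAβ : A.eval β = 0 := by simpa [hEβ] using h0
      obtain ⟨A, rfl⟩ := Polynomial.dvd_iff_isRoot.2 hAβ
      obtain ⟨E, rfl⟩ := Polynomial.dvd_iff_isRoot.2 hEβ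
      have hX : (Polynomial.X - Polynomial.C β) ≠ 0 := Polynomial.X_sub_C_ne_zero β
      have hE' : E ≠ 0 := right_ne_zero_of_mul hE
      rw [Polynomial.natDegree_mul hX hE', Polynomial.natDegree_X_sub_C] at hk
      obtain ⟨t, rfl⟩ := hm
      rcases t with _ | t
      · have hB : B.eval β = 0 := by
          have h1 : (Polynomial.X - Polynomial.C β) * (A ^ 2 - Polynomial.C μ * E ^ 2) =
              Q * B ^ 2 := by
            apply mul_left_cancel₀ hX
            linear_combination h
          have h2 := congrArg (Polynomial.eval β) h1
          simpa [hQ] using h2.symm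
        obtain ⟨B, rfl⟩ := Polynomial.dvd_iff_isRoot.2 hB
        refine ih E.natDegree (by omega) A B E 1 le_rfl hE' odd_one ?_
        apply mul_left_cancel₀ (pow_ne_zero 2 hX)
        linear_combination h
      · refine ih E.natDegree (by omega) A B E (2 * t + 1) le_rfl hE' ⟨t, rfl⟩ ?_
        apply mul_left_cancel₀ (pow_ne_zero 2 hX)
        linear_combination h
    · refine ⟨A.eval β / E.eval β, ?_⟩
      field_simp
      linear_combination -h0

lemma trace_eq_zero_of_sq {N : Type*} [Field N] [NumberField N] {t : N} {r : ℚ}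
    (ht : t ^ 2 = algebraMap ℚ N r) (hr : ∀ s : ℚ, r ≠ s ^ 2) : Algebra.trace ℚ N t = 0 := by
  have hmon : (Polynomial.X ^ 2 - Polynomial.C r).Monic := Polynomial.monic_X_pow_sub_C r two_ne_zero
  have hirr : Irreducible (Polynomial.X ^ 2 - Polynomial.C r) :=
    X_pow_sub_C_irreducible_of_prime Nat.prime_two fun b hb => hr b hb.symm
  have hmin := minpoly.eq_of_irreducible_of_monic hirr (x := t) (by simp [ht]) hmon
  rw [trace_eq_finrank_mul_minpoly_nextCoeff, ← hmin, Polynomial.nextCoeff_of_natDegree_pos,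
    Polynomial.natDegree_X_pow_sub_C]
  · simp [Polynomial.coeff_X_pow]
  · rw [Polynomial.natDegree_X_pow_sub_C]; norm_num

/-- A number field contains square roots of only finitely many independent rationals. -/
lemma NumberField.exists_mul_eq_sq {N : Type*} [Field N] [NumberField N] {m : ℕ → ℚ} {z : ℕ → N}
    (hm : ∀ i, m i ≠ 0) (hz : ∀ i, z i ^ 2 = algebraMap ℚ N (m i)) :
    ∃ i j, i < j ∧ ∃ s : ℚ, m i * m j = s ^ 2 := by
  by_contra! hcon
  have hcon' : ∀ i j, i ≠ j → ∀ s : ℚ, m i * m j ≠ s ^ 2 := fun i j hij => by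
    rcases hij.lt_or_gt with h | h
    · exact hcon i j h
    · rw [mul_comm]; exact hcon j i h
  have hli : LinearIndependent ℚ z := by
    apply LinearMap.BilinForm.linearIndependent_of_iIsOrtho (B := Algebra.traceForm ℚ N)
    · rw [LinearMap.BilinForm.iIsOrtho_def]
      intro i j hij
      rw [Algebra.traceForm_apply]
      exact trace_eq_zero_of_sq (r := m i * m j) (by rw [mul_pow, hz, hz, map_mul]) (hcon' i j hij)
    · intro i
      rw [Algebra.traceForm_apply, ← sq, hz, Algebra.trace_algebraMap]
      simp [hm i, Module.finrank_pos.ne']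
  exact not_finite_iff_infinite.2 (inferInstance : Infinite ℕ) hli.finite

/-- A sequence of odd numbers, each dividing the next. -/
def chainSeq : ℕ → ℤ
  | 0 => 1
  | k + 1 => chainSeq k * (2 * chainSeq k ^ 2 + 4 * chainSeq k + 1)

/-- Pairwise coprime integers represented by `X² - 2 Y²`. -/
def coprimeSeq (k : ℕ) : ℤ := 2 * chainSeq k ^ 2 + 4 * chainSeq k + 1

lemma odd_chainSeq (k : ℕ) : Odd (chainSeq k) := by
  induction k with
  | zero => exact odd_one
  | succ k ih => exact ih.mul ⟨chainSeq k ^ 2 + 2 * chainSeq k, by ring⟩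

lemma chainSeq_pos (k : ℕ) : 0 < chainSeq k := by
  induction k with
  | zero => exact one_pos
  | succ k ih => rw [chainSeq]; positivity

lemma coprimeSeq_pos (k : ℕ) : 0 < coprimeSeq k := by
  have := chainSeq_pos k
  rw [coprimeSeq]; positivity

lemma coprimeSeq_emod (k : ℕ) : coprimeSeq k % 8 = 7 := by
  obtain ⟨t, ht⟩ := odd_chainSeq k
  have : coprimeSeq k = 8 * (t ^ 2 + 2 * t) + 7 := by rw [coprimeSeq, ht]; ring
  omega

lemma odd_coprimeSeq (k : ℕ) : Odd (coprimeSeq k) := by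
  rw [Int.odd_iff]
  have := coprimeSeq_emod k
  omega

lemma coprimeSeq_dvd {i j : ℕ} (h : i < j) : coprimeSeq i ∣ chainSeq j := by
  induction j with
  | zero => omega
  | succ j ih =>
    rw [chainSeq]
    rcases (Nat.lt_succ_iff.1 h).lt_or_eq with h | rfl
    · exact (ih h).mul_right _
    · exact dvd_mul_left _ _

lemma coprimeSeq_mul_ne_sq {i j : ℕ} (h : i < j) (s : ℚ) :
    (coprimeSeq i : ℚ) * coprimeSeq j ≠ s ^ 2 := by
  intro hs
  have hcop : IsCoprime (coprimeSeq i) (coprimeSeq j) := by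
    obtain ⟨t, ht⟩ := coprimeSeq_dvd h
    refine ⟨-(t * (2 * chainSeq j + 4)), 1, ?_⟩
    rw [coprimeSeq.eq_1 j]
    linear_combination (2 * chainSeq j + 4) * ht
  obtain ⟨r, hr⟩ : ∃ r : ℤ, coprimeSeq i * coprimeSeq j = r ^ 2 := by
    have : IsSquare ((coprimeSeq i * coprimeSeq j : ℤ) : ℚ) := ⟨s, by push_cast; rw [hs, sq]⟩
    rw [Rat.isSquare_intCast_iff] at this
    obtain ⟨r, hr⟩ := this
    exact ⟨r, by rw [hr, sq]⟩
  obtain ⟨t, ht | ht⟩ := Int.sq_of_isCoprime hcop hr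
  · have h8 := coprimeSeq_emod i
    rw [ht] at h8
    rcases Int.even_or_odd' t with ⟨k, rfl | rfl⟩
    · rw [mul_pow] at h8; omega
    · have : (2 * k + 1) ^ 2 = 4 * (k * k + k) + 1 := by ring
      omega
  · have := coprimeSeq_pos i
    nlinarith [sq_nonneg t]

/-- The image of the square class of `2` is constant. -/
lemma IsWittEquiv.exists_rat_two {K L : Type*} [Field K] [Field L] [CharZero K] [CharZero L]
    {α : SqClass K ≃* SqClass L} (hα : IsWittEquiv α) {a b c d : ℚ} {x y : K} {x' y' : L}
    (hK : IsConic a b x y) (hL : IsConic c d x' y') : ∃ q : ℚ, Corr α (2 : K) (q : L) := by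
  obtain ⟨f, hf⟩ := Corr.exists_right (α := α) (two_ne_zero (α := K))
  by_contra hcon
  obtain ⟨N, _, _, j, β, k, Q, E, -, hk, hQ, hE, hfE⟩ := hL.exists_odd_root hf.ne_zero'
    (fun ⟨q, l, hl, hq⟩ => hcon ⟨q, by
      have := hf.mul_sq_right (inv_ne_zero hl)
      rwa [hq, mul_assoc, ← mul_pow, mul_inv_cancel₀ hl, one_pow, mul_one] at this⟩)
  have key : ∀ i, ∃ (m : ℤ) (z : N), Corr α (coprimeSeq i : K) (m : L) ∧ z ^ 2 = m := by
    intro i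
    obtain ⟨m, -, hm⟩ := hα.exists_odd hK hL (odd_coprimeSeq i)
    refine ⟨m, ?_⟩
    obtain ⟨u, v, huv⟩ := Corr.represents hα Corr.one_one (hf.neg hα) hm
      ⟨1 + 2 * chainSeq i, chainSeq i, by rw [coprimeSeq]; push_cast; ring⟩
    obtain ⟨U, V, hV, hUV⟩ := IsFractionRing.div_surjective (A := Polynomial N) (j u)
    obtain ⟨S, T, hT, hST⟩ := IsFractionRing.div_surjective (A := Polynomial N) (j v)
    have hV0 : V ≠ 0 := nonZeroDivisors.ne_zero hV
    have hT0 : T ≠ 0 := nonZeroDivisors.ne_zero hT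
    have hinj := RatFunc.algebraMap_injective N
    have hV' : algebraMap _ (RatFunc N) V ≠ 0 := (map_ne_zero_iff _ hinj).2 hV0
    have hT' : algebraMap _ (RatFunc N) T ≠ 0 := (map_ne_zero_iff _ hinj).2 hT0
    have h1 := congrArg j huv
    obtain ⟨z, hz⟩ := Polynomial.isSquare_of_sq_sub_eq (μ := (m : N)) hQ _ (U * T * E) (S * V)
      (V * T * E) k le_rfl (mul_ne_zero (mul_ne_zero hV0 hT0) hE) hk (by
        apply hinj
        rw [map_mul _ _ ((S * V) ^ 2), ← hfE]
        simp only [map_add, map_mul, map_sub, map_pow, map_intCast, map_neg, map_one, ← hUV, ← hST]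
          at h1 ⊢
        field_simp at h1
        linear_combination -(algebraMap _ (RatFunc N) E) ^ 2 * h1)
    exact ⟨z, hm, hz.symm⟩
  choose m z hm hz using key
  have hm0 : ∀ i, (m i : ℚ) ≠ 0 := fun i => by
    have := (hm i).ne_zero'
    exact_mod_cast this
  obtain ⟨i, k, hik, s, hs⟩ := NumberField.exists_mul_eq_sq (m := fun i => (m i : ℚ)) hm0
    (fun i => by rw [hz, map_intCast])
  have hs0 : s ≠ 0 := by
    rintro rfl
    rw [zero_pow two_ne_zero] at hs
    exact mul_ne_zero (hm0 i) (hm0 k) hs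
  have hs' : (m i : L) * m k = 1 * (s : L) ^ 2 := by
    rw [one_mul]; exact_mod_cast congrArg (Rat.cast : ℚ → L) hs
  have h1 := (hm i).mul (hm k)
  rw [hs'] at h1
  obtain ⟨t, -, ht⟩ := (Corr.one_one.mul_sq_right (by exact_mod_cast hs0)).symm.unique h1.symm
  obtain ⟨r, hr⟩ := hK.exists_rat_sq (q := coprimeSeq i * coprimeSeq k) (z := t)
    (by push_cast; rw [ht, one_mul])
  exact coprimeSeq_mul_ne_sq hik r hr

/-- Up to squares, a nonzero rational number is a squarefree integer. -/
lemma Rat.exists_eq_squarefree_mul_sq {q : ℚ} (hq : q ≠ 0) :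
    ∃ (e : ℤ) (s : ℕ) (r : ℚ), r ≠ 0 ∧ (e = 1 ∨ e = -1) ∧ Squarefree s ∧ q = e * s * r ^ 2 := by
  have hden : (q.den : ℚ) ≠ 0 := by exact_mod_cast q.den_ne_zero
  have hn : 0 < (q.num * q.den).natAbs := Int.natAbs_pos.2
    (mul_ne_zero (Rat.num_ne_zero.2 hq) (by exact_mod_cast q.den_ne_zero))
  obtain ⟨s, t, hs, ht, hst, hsf⟩ := Nat.sq_mul_squarefree_of_pos hn
  have ht0 : (t : ℚ) ≠ 0 := by exact_mod_cast ht.ne'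
  have key : ∀ e : ℤ, q.num * q.den = e * (q.num * q.den).natAbs →
      q = e * s * (t / q.den) ^ 2 := fun e he => by
    rw [← hst] at he
    have he' : (q.num * q.den : ℚ) = e * (t ^ 2 * s) := by exact_mod_cast he
    have hq' : q * q.den ^ 2 = e * (t ^ 2 * s) := by
      rw [← he', sq, ← mul_assoc, Rat.mul_den_eq_num]
    field_simp
    linear_combination hq'
  rcases Int.natAbs_eq (q.num * q.den) with h | h
  · exact ⟨1, s, t / q.den, div_ne_zero ht0 hden, Or.inl rfl, hsf, key 1 (by rwa [one_mul])⟩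
  · exact ⟨-1, s, t / q.den, div_ne_zero ht0 hden, Or.inr rfl, hsf, key (-1) (by rwa [neg_one_mul])⟩

section Main

variable {K L : Type*} [Field K] [Field L] [CharZero K] [CharZero L]
  {α : SqClass K ≃* SqClass L} {a b c d : ℚ} {x y : K} {x' y' : L}

/-- The image of the square class of a prime is constant. -/
lemma IsWittEquiv.exists_rat (hα : IsWittEquiv α) (hK : IsConic a b x y)
    (hL : IsConic c d x' y') {p : ℕ} (hp : p.Prime) : ∃ q : ℚ, Corr α (p : K) (q : L) := by
  rcases hp.eq_two_or_odd' with rfl | h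
  · exact_mod_cast hα.exists_rat_two hK hL
  · exact_mod_cast hα.exists_rat_of_odd hK hL (n := p) (by exact_mod_cast h)

omit [CharZero K] in
lemma Corr.of_mul_sq_right {u : K} {q r : ℚ} (hr : r ≠ 0)
    (h : Corr α u ((q * r ^ 2 : ℚ) : L)) : Corr α u (q : L) := by
  have hr' : (r : L) ≠ 0 := by exact_mod_cast hr
  have := h.mul_sq_right (inv_ne_zero hr')
  push_cast at this
  rwa [mul_assoc, ← mul_pow, mul_inv_cancel₀ hr', one_pow, mul_one] at this

/-- The square class of a prime is sent to the square class of a prime, up to sign. -/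
lemma IsWittEquiv.exists_prime (hα : IsWittEquiv α) (hK : IsConic a b x y)
    (hL : IsConic c d x' y') {p : ℕ} (hp : p.Prime) :
    ∃ (ℓ : ℕ) (e : ℤ), ℓ.Prime ∧ (e = 1 ∨ e = -1) ∧ Corr α (p : K) ((e * ℓ : ℚ) : L) := by
  obtain ⟨q, hq⟩ := hα.exists_rat hK hL hp
  obtain ⟨e, s, r, hr, he, hs, rfl⟩ := Rat.exists_eq_squarefree_mul_sq (q := q) (by
    have := hq.ne_zero'
    exact_mod_cast this)
  replace hq := hq.of_mul_sq_right hr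
  have he1 : IsUnit e := by rcases he with rfl | rfl <;> simp
  have hs1 : s ≠ 1 := by
    rintro rfl
    have h1 : Corr α (e : K) (e : L) := by
      rcases he with rfl | rfl
      · simpa using Corr.one_one (α := α)
      · simpa using Corr.neg_one hα
    obtain ⟨z, hz, hz'⟩ := h1.symm.unique (x'' := (p : K)) (by simpa using hq.symm)
    obtain ⟨t, ht⟩ := hK.exists_rat_sq (q := e * p) (z := e * z) (by
      push_cast
      rw [hz']; ring)
    have hsq : IsSquare ((e * p : ℤ) : ℚ) := ⟨t, by push_cast; rw [ht, sq]⟩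
    rw [Rat.isSquare_intCast_iff] at hsq
    have hpp : Prime (e * p : ℤ) :=
      ((associated_unit_mul_left _ _ he1).prime_iff).2 (Nat.prime_iff_prime_int.1 hp)
    exact hpp.irreducible.not_isSquare hsq
  obtain ⟨ℓ, hℓ, s, rfl⟩ := Nat.exists_prime_and_dvd hs1
  have hdvd : ∀ {k : ℕ} {m : ℕ}, k.Prime → Squarefree (k * m) → ¬ (k : ℤ) ∣ e * m := by
    intro k m hk hkm h
    rw [he1.dvd_mul_left] at h
    exact hk.not_isUnit (hkm k (mul_dvd_mul_left k (by exact_mod_cast h)))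
  have key : ∀ {k m : ℕ}, k.Prime → k * m = ℓ * s → ∀ {n m' : ℤ} {r' : ℚ}, r' ≠ 0 →
      ¬ (k : ℤ) ∣ m' → ¬ (p : ℤ) ∣ n → ¬ Corr α (n : K) ((k * m' * r' ^ 2 : ℚ) : L) := by
    intro k m hk hkm n m' r' hr' hm' hn
    refine hα.not_corr_mul hL hp hk one_ne_zero hr' (hdvd hk (hkm ▸ hs)) hm' hn ?_
    convert hq using 2
    rw [← hkm]
    push_cast
    ring
  rcases eq_or_ne s 1 with rfl | hs'
  · exact ⟨ℓ, e, hℓ, he, by simpa using hq⟩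
  exfalso
  obtain ⟨k, hk, s, rfl⟩ := Nat.exists_prime_and_dvd hs'
  obtain ⟨q₀, h₀⟩ := hα.symm.exists_rat hL hK hℓ
  obtain ⟨n, t, ht, hn, h⟩ := Rat.exists_eq_mul_sq hp (q := q₀) (by
    have := h₀.ne_zero'
    exact_mod_cast this)
  rcases h with rfl | rfl
  · have h₁ := (h₀.of_mul_sq_right ht).of_symm
    refine key hℓ rfl (n := n) (m' := 1) (r' := 1) one_ne_zero ?_ hn (by simpa using h₁)
    intro h
    exact hℓ.not_isUnit (by exact_mod_cast isUnit_of_dvd_one h)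
  · have h₁ := (h₀.of_mul_sq_right ht).of_symm
    have h₂ := (h₁.mul hq).mul_sq_left (inv_ne_zero (Nat.cast_ne_zero (R := K).2 hp.ne_zero))
    have hpK : (p : K) ≠ 0 := Nat.cast_ne_zero.2 hp.ne_zero
    refine key hk (m := ℓ * s) (by ring) (n := n) (m' := e * s) (r' := ℓ)
      (by exact_mod_cast hℓ.ne_zero) (hdvd hk (hs.squarefree_of_dvd (Dvd.intro_left ℓ rfl))) hn ?_
    convert h₂ using 1
    · push_cast
      field_simp
    · push_cast
      ring

/-- The square class of `2` is sent to the square class of `2`, up to sign. -/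
lemma IsWittEquiv.eq_two (hα : IsWittEquiv α) (hK : IsConic a b x y)
    (hL : IsConic c d x' y') {ℓ : ℕ} {e : ℤ} (hℓ : ℓ.Prime) (he : e = 1 ∨ e = -1)
    (h : Corr α (2 : K) ((e * ℓ : ℚ) : L)) : ℓ = 2 := by
  by_contra h2
  have hodd : Odd (e * ℓ : ℤ) := by
    have h1 : Odd (ℓ : ℤ) := by exact_mod_cast hℓ.odd_of_ne_two h2
    have h3 : Odd e := by rcases he with rfl | rfl <;> decide
    exact h3.mul h1
  obtain ⟨m, hm, hm'⟩ := hα.symm.exists_odd hL hK hodd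
  obtain ⟨z, hz, hz'⟩ := h.symm.unique (x'' := (m : K)) (by
    convert hm' using 1; push_cast; ring)
  obtain ⟨t, ht⟩ := hK.exists_rat_sq (q := 2 * m) (z := 2 * z) (by
    push_cast
    rw [hz']; ring)
  have hsq : IsSquare ((2 * m : ℤ) : ℚ) := ⟨t, by push_cast; rw [ht, sq]⟩
  rw [Rat.isSquare_intCast_iff] at hsq
  obtain ⟨k, hk⟩ := hsq
  obtain ⟨i, rfl⟩ := hm
  rcases Int.even_or_odd' k with ⟨j, rfl | rfl⟩
  · have : 2 * j * (2 * j) = 4 * (j * j) := by ring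
    omega
  · have : (2 * j + 1) * (2 * j + 1) = 2 * (2 * (j * j) + 2 * j) + 1 := by ring
    omega

end Main

end

/-- Let `a, b, c, d ∈ ℚ` be nonzero, `K = ℚ_{a,b}`, `L = ℚ_{c,d}`, and let `α` be a Witt
equivalence from `K` to `L`.  Then for each prime integer `p`, `α` maps the square class
of `p` to the square class of `q` or `−q` for some prime integer `q`; moreover if `p = 2`
then `q = 2`. -/
theorem wittEquiv_rat_conic_prime_matching
    (a b c d : ℚ) (ha : a ≠ 0) (hb : b ≠ 0) (hc : c ≠ 0) (hd : d ≠ 0)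
    (K : Type*) [Field K] (ι : ℚ →+* K) (hK : IsConicFunctionField ℚ a b K ι)
    (L : Type*) [Field L] (ι' : ℚ →+* L) (hL : IsConicFunctionField ℚ c d L ι')
    (α : SqClass K ≃* SqClass L) (hα : IsWittEquiv α) :
    ∀ (u : ℚˣ) (p : ℕ), p.Prime → (u : ℚ) = (p : ℚ) →
      ∃ q : ℕ, q.Prime ∧
        (∃ s : ℚˣ, ((s : ℚ) = (q : ℚ) ∨ (s : ℚ) = -(q : ℚ)) ∧
          α (sqCl (Units.map ι.toMonoidHom u)) = sqCl (Units.map ι'.toMonoidHom s)) ∧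
        (p = 2 → q = 2) := by
  intro u p hp hu
  have : CharZero K := charZero_of_injective_ringHom ι.injective
  have : CharZero L := charZero_of_injective_ringHom ι'.injective
  obtain ⟨x, y, hxy⟩ := hK.isConic ha hb
  obtain ⟨x', y', hxy'⟩ := hL.isConic hc hd
  obtain ⟨ℓ, e, hℓ, he, v, v', hv, hv', h⟩ := hα.exists_prime hxy hxy' hp
  have hs : (e * ℓ : ℚ) ≠ 0 := mul_ne_zero
    (by rcases he with rfl | rfl <;> norm_num) (by exact_mod_cast hℓ.ne_zero)
  refine ⟨ℓ, hℓ, ⟨Units.mk0 _ hs, ?_, ?_⟩, ?_⟩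
  · rcases he with rfl | rfl
    · left; simp
    · right; simp
  · have h1 : Units.map ι.toMonoidHom u = v := by
      ext
      rw [hv]
      change ι (u : ℚ) = p
      rw [hu, map_natCast]
    have h2 : Units.map ι'.toMonoidHom (Units.mk0 _ hs) = v' := by
      ext
      rw [hv']
      exact (map_ratCast ι' _).symm ▸ rfl
    rw [h1, h2, h]
  · rintro rfl
    exact hα.eq_two hxy hxy' hℓ he ⟨v, v', by rw [hv]; norm_num, hv', h⟩

end
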